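/- For every ε with 0 < ε < 1 there exists t₀(ε) such that for every integer t ≥ t₀(ε), the number of pairs of integers (n,m) with 1 ≤ m < n, exp((log n)^{2/3+ε}) ≤ m, and (n)_m = t is at most 2. -/

import Mathlib

namespace FallingFactorial

open Finset

/-- The additive energy of `f` on `Y`. -/
def energy {α H : Type*} [DecidableEq H] (f : α → H) (Y : Finset α) : ℕ :=
  #{q ∈ Y ×ˢ Y | f q.1 = f q.2}

section energy
variable {α β H : Type*} [DecidableEq H]

theorem card_pairs_eq_sum (f g : α → H) (Y Z : Finset α) (V : Finset H)
    (hV : ∀ x ∈ Y, f x ∈ V) :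
    #{q ∈ Y ×ˢ Z | f q.1 = g q.2} = ∑ v ∈ V, #{x ∈ Y | f x = v} * #{x ∈ Z | g x = v} := by
  classical
  rw [Finset.card_eq_sum_card_fiberwise (f := fun q : α × α => f q.1) (t := V)]
  · refine Finset.sum_congr rfl fun v _ => ?_
    rw [← Finset.card_product]
    congr 1
    ext ⟨a, b⟩
    simp only [mem_filter, mem_product]
    constructor
    · rintro ⟨⟨⟨h1, h2⟩, h3⟩, h4⟩
      exact ⟨⟨h1, h4⟩, h2, h3 ▸ h4⟩
    · rintro ⟨⟨h1, h2⟩, h3, h4⟩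
      exact ⟨⟨⟨h1, h3⟩, h2.trans h4.symm⟩, h2⟩
  · intro q hq
    simp only [coe_filter, mem_product, Set.mem_ofPred_eq] at hq
    exact hV _ hq.1.1

theorem energy_eq_sum (f : α → H) (Y : Finset α) (V : Finset H) (hV : ∀ x ∈ Y, f x ∈ V) :
    energy f Y = ∑ v ∈ V, #{x ∈ Y | f x = v} ^ 2 := by
  rw [energy, card_pairs_eq_sum f f Y Y V hV]
  exact Finset.sum_congr rfl fun v _ => (sq _).symm

theorem two_mul_card_pairs_le (f g : α → H) (Y : Finset α) :
    2 * #{q ∈ Y ×ˢ Y | f q.1 = g q.2} ≤ energy f Y + energy g Y := by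
  classical
  have hf : ∀ x ∈ Y, f x ∈ Y.image f ∪ Y.image g := fun x hx =>
    mem_union_left _ (mem_image_of_mem _ hx)
  have hg : ∀ x ∈ Y, g x ∈ Y.image f ∪ Y.image g := fun x hx =>
    mem_union_right _ (mem_image_of_mem _ hx)
  rw [card_pairs_eq_sum f g Y Y _ hf, energy_eq_sum f Y _ hf, energy_eq_sum g Y _ hg,
    ← Finset.sum_add_distrib, Finset.mul_sum]
  refine Finset.sum_le_sum fun v _ => ?_
  nlinarith [two_mul_le_add_sq (#{x ∈ Y | f x = v}) (#{x ∈ Y | g x = v})]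

theorem energy_mono_of_injOn {H' : Type*} [DecidableEq H'] (f : α → H) (g : β → H')
    (Y : Finset α) (Z : Finset β) (i : α → β) (hi : ∀ x ∈ Y, i x ∈ Z) (hinj : Set.InjOn i Y)
    (hfg : ∀ x ∈ Y, ∀ y ∈ Y, f x = f y → g (i x) = g (i y)) : energy f Y ≤ energy g Z := by
  classical
  refine Finset.card_le_card_of_injOn (fun q => (i q.1, i q.2)) ?_ ?_
  · rintro ⟨a, b⟩ h
    simp only [coe_filter, mem_product, Set.mem_ofPred_eq] at h ⊢
    exact ⟨⟨hi _ h.1.1, hi _ h.1.2⟩, hfg _ h.1.1 _ h.1.2 h.2⟩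
  · rintro ⟨a, b⟩ h ⟨c, d⟩ h' e
    simp only [coe_filter, mem_product, Set.mem_ofPred_eq, Prod.mk.injEq] at h h' e ⊢
    exact ⟨hinj h.1.1 h'.1.1 e.1, hinj h.1.2 h'.1.2 e.2⟩

theorem energy_mono (f : α → H) {Y Z : Finset α} (h : Y ⊆ Z) : energy f Y ≤ energy f Z :=
  energy_mono_of_injOn f f Y Z id h (Set.injOn_id _) fun _ _ _ _ => id

theorem energy_le_card_sq (f : α → H) (Y : Finset α) : energy f Y ≤ #Y ^ 2 := by
  rw [sq, ← card_product]
  exact card_filter_le _ _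

theorem energy_biUnion_le {ι : Type*} [DecidableEq α] (f : α → H) (I : Finset ι)
    (Y : ι → Finset α) (X : Finset α) (hX : ∀ x ∈ X, ∃ i ∈ I, x ∈ Y i) :
    energy f X ≤ #I * ∑ i ∈ I, energy f (Y i) := by
  refine (energy_mono f (Z := I.biUnion Y) fun x hx => mem_biUnion.2 (hX x hx)).trans ?_
  have hV : ∀ i ∈ I, ∀ x ∈ Y i, f x ∈ (I.biUnion Y).image f := fun i hi x hx =>
    mem_image_of_mem _ (mem_biUnion.2 ⟨i, hi, hx⟩)
  rw [energy_eq_sum f _ ((I.biUnion Y).image f) fun x hx => mem_image_of_mem _ hx]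
  rw [Finset.sum_congr rfl fun i hi => energy_eq_sum f (Y i) _ (hV i hi), Finset.sum_comm,
    Finset.mul_sum]
  refine Finset.sum_le_sum fun v _ => ?_
  have h1 : #{x ∈ I.biUnion Y | f x = v} ≤ ∑ i ∈ I, #{x ∈ Y i | f x = v} := by
    rw [filter_biUnion]
    exact card_biUnion_le
  calc _ ≤ (∑ i ∈ I, #{x ∈ Y i | f x = v}) ^ 2 := Nat.pow_le_pow_left h1 2
    _ ≤ _ := sq_sum_le_card_mul_sum_sq

end energy

theorem map_sum_eq_prod {G : Type*} [AddCommGroup G] {ι : Type*} (ψ : AddChar G ℂ) (s : Finset ι)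
    (f : ι → G) :
    ψ (∑ i ∈ s, f i) = ∏ i ∈ s, ψ (f i) := by
  classical
  induction s using Finset.induction_on with
  | empty => simp
  | insert a s ha ih =>
    rw [Finset.sum_insert ha, Finset.prod_insert ha, AddChar.map_add_eq_mul, ih]

section fourier

variable {G : Type*} [AddCommGroup G] [Fintype G] [DecidableEq G]

theorem energy_eq_fourier {α : Type*} (f : α → G) (Y : Finset α) :
    (Fintype.card G : ℝ) * energy f Y = ∑ ψ : AddChar G ℂ, ‖∑ x ∈ Y, ψ (f x)‖ ^ 2 := by
  classical
  have key : ((Fintype.card G : ℝ) * energy f Y : ℂ) =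
      ∑ ψ : AddChar G ℂ, ((‖∑ x ∈ Y, ψ (f x)‖ ^ 2 : ℝ) : ℂ) := by
    have h : ∀ ψ : AddChar G ℂ, ((‖∑ x ∈ Y, ψ (f x)‖ ^ 2 : ℝ) : ℂ) =
        ∑ q ∈ Y ×ˢ Y, ψ (f q.1 - f q.2) := by
      intro ψ
      push_cast
      rw [← Complex.mul_conj', map_sum, Finset.sum_mul_sum, Finset.sum_product]
      refine Finset.sum_congr rfl fun x _ => Finset.sum_congr rfl fun y _ => ?_
      rw [← AddChar.map_neg_eq_conj, ← AddChar.map_add_eq_mul, sub_eq_add_neg]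
    rw [Finset.sum_congr rfl fun ψ _ => h ψ, Finset.sum_comm]
    rw [Finset.sum_congr rfl fun q _ => AddChar.sum_apply_eq_ite (f q.1 - f q.2)]
    rw [energy, ← Finset.sum_filter]
    simp only [sub_eq_zero, Finset.sum_const, nsmul_eq_mul]
    push_cast
    ring
  exact_mod_cast key

theorem energy_mixed_le_group {α β ι : Type*} [Fintype ι] [DecidableEq ι] [Nonempty ι]
    (τ : β → G) (φ : α → G) (T : Finset β) (A : ι → Finset α) :
    energy (fun q : β × (ι → α) => τ q.1 + ∑ i, φ (q.2 i)) (T ×ˢ Fintype.piFinset A) ≤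
      ∑ i, energy (fun q : β × (ι → α) => τ q.1 + ∑ i, φ (q.2 i))
        (T ×ˢ Fintype.piFinset fun _ => A i) := by
  have hexp : ∀ (B : ι → Finset α) (ψ : AddChar G ℂ),
      ∑ q ∈ T ×ˢ Fintype.piFinset B, ψ (τ q.1 + ∑ i, φ (q.2 i)) =
        (∑ t ∈ T, ψ (τ t)) * ∏ i, ∑ x ∈ B i, ψ (φ x) := by
    intro B ψ
    rw [Finset.sum_product, Finset.sum_mul, Finset.prod_univ_sum]
    refine Finset.sum_congr rfl fun t _ => ?_
    rw [Finset.mul_sum]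
    refine Finset.sum_congr rfl fun x _ => ?_
    rw [AddChar.map_add_eq_mul, map_sum_eq_prod]
  have hpos : (0 : ℝ) < Fintype.card G := by exact_mod_cast Fintype.card_pos
  rw [← Nat.cast_le (α := ℝ), ← mul_le_mul_iff_right₀ hpos]
  push_cast
  rw [energy_eq_fourier, Finset.mul_sum]
  simp only [energy_eq_fourier]
  rw [Finset.sum_comm]
  refine Finset.sum_le_sum fun ψ _ => ?_
  simp only [hexp, norm_mul, mul_pow, norm_prod, Finset.prod_const, Finset.card_univ, norm_pow]
  rw [← Finset.mul_sum]
  refine mul_le_mul_of_nonneg_left ?_ (by positivity)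
  obtain ⟨i₀, -, h₀⟩ := Finset.exists_max_image Finset.univ
    (fun i => ‖∑ x ∈ A i, ψ (φ x)‖) Finset.univ_nonempty
  calc (∏ i, ‖∑ x ∈ A i, ψ (φ x)‖) ^ 2
      ≤ (∏ _i : ι, ‖∑ x ∈ A i₀, ψ (φ x)‖) ^ 2 := by
        gcongr with i
        exact h₀ i (Finset.mem_univ _)
    _ = (‖∑ x ∈ A i₀, ψ (φ x)‖ ^ Fintype.card ι) ^ 2 := by
        rw [Finset.prod_const, Finset.card_univ]
    _ ≤ _ := Finset.single_le_sum
        (f := fun i => (‖∑ x ∈ A i, ψ (φ x)‖ ^ Fintype.card ι) ^ 2)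
        (fun i _ => by positivity) (Finset.mem_univ i₀)

end fourier

theorem exists_zmod_injOn {k : ℕ} (V : Finset (Fin k → ℤ)) :
    ∃ N : ℕ, 0 < N ∧ ∀ v ∈ V, ∀ v' ∈ V,
      (fun j => (v j : ZMod N)) = (fun j => (v' j : ZMod N)) → v = v' := by
  classical
  set N : ℕ := 1 + ∑ q ∈ V ×ˢ V, ∑ j, (q.1 j - q.2 j).natAbs with hN
  refine ⟨N, by omega, fun v hv v' hv' h => ?_⟩
  ext j
  have h1 := congrFun h j
  have h2 : (N : ℤ) ∣ v j - v' j := by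
    exact (ZMod.intCast_eq_intCast_iff_dvd_sub _ _ N).1 h1.symm
  by_contra hne
  have h3 : N ≤ (v j - v' j).natAbs := by
    refine Nat.le_of_dvd (by omega) (Int.natCast_dvd.1 h2)
  have h4 : (v j - v' j).natAbs ≤ ∑ j, (v j - v' j).natAbs :=
    Finset.single_le_sum (f := fun j => (v j - v' j).natAbs) (fun _ _ => Nat.zero_le _)
      (Finset.mem_univ j)
  have h5 : ∑ j, (v j - v' j).natAbs ≤ ∑ q ∈ V ×ˢ V, ∑ j, (q.1 j - q.2 j).natAbs :=
    Finset.single_le_sum (f := fun q : (Fin k → ℤ) × (Fin k → ℤ) =>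
      ∑ j, (q.1 j - q.2 j).natAbs) (fun _ _ => Nat.zero_le _)
      (a := (v, v')) (Finset.mk_mem_product hv hv')
  omega

theorem energy_mixed_le {α β ι : Type*} [Fintype ι] [DecidableEq ι] [Nonempty ι] {k : ℕ}
    (τ : β → Fin k → ℤ) (φ : α → Fin k → ℤ) (T : Finset β) (A : ι → Finset α) :
    energy (fun q : β × (ι → α) => τ q.1 + ∑ i, φ (q.2 i)) (T ×ˢ Fintype.piFinset A) ≤
      ∑ i, energy (fun q : β × (ι → α) => τ q.1 + ∑ i, φ (q.2 i))
        (T ×ˢ Fintype.piFinset fun _ => A i) := by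
  classical
  set F : β × (ι → α) → Fin k → ℤ := fun q => τ q.1 + ∑ i, φ (q.2 i) with hF
  set W : Finset (β × (ι → α)) :=
    (T ×ˢ Fintype.piFinset A) ∪ Finset.univ.biUnion fun i => T ×ˢ Fintype.piFinset fun _ => A i
  obtain ⟨N, hN0, hN⟩ := exists_zmod_injOn (W.image F)
  have : NeZero N := ⟨hN0.ne'⟩
  set c : (Fin k → ℤ) →+ (Fin k → ZMod N) :=
    { toFun := fun v j => (v j : ZMod N), map_zero' := by ext; simp, map_add' := by
        intros; ext; simp } with hc
  have hE : ∀ Z ⊆ W, energy F Z =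
      energy (fun q : β × (ι → α) => c (τ q.1) + ∑ i, c (φ (q.2 i))) Z := by
    intro Z hZ
    have e : ∀ q : β × (ι → α), c (τ q.1) + ∑ i, c (φ (q.2 i)) = c (F q) := by
      intro q; rw [hF]; simp only [map_add, map_sum]
    simp only [e, energy]
    congr 1
    refine Finset.filter_congr fun q hq => ⟨fun h => by rw [h], fun h => ?_⟩
    rw [mem_product] at hq
    exact hN _ (mem_image_of_mem _ (hZ hq.1)) _ (mem_image_of_mem _ (hZ hq.2)) h
  rw [hE _ subset_union_left]
  rw [Finset.sum_congr rfl fun i _ => hE _ (subset_trans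
    (subset_biUnion_of_mem (fun i => T ×ˢ Fintype.piFinset fun _ => A i) (mem_univ i))
    subset_union_right)]
  exact energy_mixed_le_group (fun t => c (τ t)) (fun x => c (φ x)) T A

theorem aeval_esymm_eq_of_psum {R : Type*} [CommRing R] {k : ℕ} (x y : Fin k → R)
    (hk : ∀ j : ℕ, 1 ≤ j → j ≤ k → IsUnit (j : R))
    (h : ∀ j : ℕ, 1 ≤ j → j ≤ k → ∑ i, x i ^ j = ∑ i, y i ^ j) (n : ℕ) (hn : n ≤ k) :
    MvPolynomial.aeval x (MvPolynomial.esymm (Fin k) R n) =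
      MvPolynomial.aeval y (MvPolynomial.esymm (Fin k) R n) := by
  induction n using Nat.strong_induction_on with
  | _ n ih =>
    rcases Nat.eq_zero_or_pos n with rfl | hpos
    · simp
    · have key := MvPolynomial.mul_esymm_eq_sum (Fin k) R n
      have e : ∀ z : Fin k → R, (n : R) * MvPolynomial.aeval z (MvPolynomial.esymm (Fin k) R n) =
          (-1) ^ (n + 1) * ∑ a ∈ antidiagonal n with a.1 < n, (-1) ^ a.1 *
            MvPolynomial.aeval z (MvPolynomial.esymm (Fin k) R a.1) * ∑ i, z i ^ a.2 := by
        intro z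
        have := congrArg (MvPolynomial.aeval z) key
        simpa [map_sum, MvPolynomial.psum] using this
      refine (hk n hpos hn).mul_left_cancel ?_
      rw [e x, e y]
      congr 1
      refine Finset.sum_congr rfl fun a ha => ?_
      rw [mem_filter, HasAntidiagonal.mem_antidiagonal] at ha
      rw [ih a.1 ha.2 (by omega), h a.2 (by omega) (by omega)]

theorem prod_sub_eq_of_psum {R : Type*} [CommRing R] {k : ℕ} (x y : Fin k → R)
    (hk : ∀ j : ℕ, 1 ≤ j → j ≤ k → IsUnit (j : R))
    (h : ∀ j : ℕ, 1 ≤ j → j ≤ k → ∑ i, x i ^ j = ∑ i, y i ^ j) (z : R) :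
    ∏ i, (z - x i) = ∏ i, (z - y i) := by
  have e : ∀ w : Fin k → R, ∏ i, (z - w i) = ∑ j ∈ Finset.range (k + 1),
      (-1) ^ j * (MvPolynomial.aeval w (MvPolynomial.esymm (Fin k) R j) * z ^ (k - j)) := by
    intro w
    have := Multiset.prod_X_sub_X_eq_sum_esymm (Finset.univ.val.map w)
    have := congrArg (Polynomial.eval z) this
    simp only [Multiset.map_map, Function.comp_def] at this
    rw [show (Multiset.map (fun x => Polynomial.X - Polynomial.C (w x)) univ.val).prod =
      ∏ i, (Polynomial.X - Polynomial.C (w i)) from rfl] at this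
    rw [Polynomial.eval_prod] at this
    simp only [Polynomial.eval_sub, Polynomial.eval_X, Polynomial.eval_C] at this
    rw [this, Polynomial.eval_finsetSum]
    simp [MvPolynomial.aeval_esymm_eq_multiset_esymm]
  rw [e x, e y]
  refine Finset.sum_congr rfl fun j hj => ?_
  rw [aeval_esymm_eq_of_psum x y hk h j (by simpa [Nat.lt_succ_iff] using hj)]

theorem isUnit_natCast_zmod_pow {p : ℕ} (hp : p.Prime) (k j : ℕ) (h1 : 1 ≤ j) (h2 : j < p) :
    IsUnit (j : ZMod (p ^ k)) := by
  rw [ZMod.isUnit_iff_coprime]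
  exact Nat.Coprime.pow_right _ (Nat.coprime_of_lt_prime (by omega) h2 hp).symm

theorem isUnit_intCast_zmod_pow {p : ℕ} (hp : p.Prime) (k : ℕ) (z : ℤ) (h : ¬ (p : ℤ) ∣ z) :
    IsUnit (z : ZMod (p ^ k)) := by
  have h1 : IsCoprime z ((p : ℤ) ^ k) := by
    refine IsCoprime.pow_right ?_
    rw [Int.isCoprime_iff_gcd_eq_one, Int.gcd_comm]
    have := (Nat.Prime.coprime_iff_not_dvd hp).2 (fun hd => h (Int.natCast_dvd.2 hd))
    simpa [Int.gcd] using this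
  obtain ⟨a, b, hab⟩ := h1
  refine IsUnit.of_mul_eq_one (a : ZMod (p ^ k)) ?_
  have := congrArg (Int.cast : ℤ → ZMod (p ^ k)) hab
  push_cast at this
  have hp0 : ((p : ZMod (p ^ k)) ^ k) = 0 := by
    rw [← Nat.cast_pow, ZMod.natCast_self]
  rw [hp0, mul_zero, add_zero] at this
  rw [mul_comm]; exact this

/-- Integer tuples with distinct residues mod `p` whose power sums agree mod `p ^ k`
agree mod `p ^ k` up to reindexing. -/
theorem exists_modEq_of_psum {p k : ℕ} (hp : p.Prime) (hk : k < p) (hk1 : 1 ≤ k)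
    (x y : Fin k → ℤ)
    (hy : Function.Injective fun i => (y i : ZMod p))
    (h : ∀ j : ℕ, 1 ≤ j → j ≤ k →
      ((∑ i, x i ^ j : ℤ) : ZMod (p ^ k)) = ((∑ i, y i ^ j : ℤ) : ZMod (p ^ k))) (i : Fin k) :
    ∃ i', (x i : ZMod (p ^ k)) = y i' := by
  have hprod := prod_sub_eq_of_psum (fun i => (x i : ZMod (p ^ k))) (fun i => (y i : ZMod (p ^ k)))
    (fun j h1 h2 => isUnit_natCast_zmod_pow hp k j h1 (by omega))
    (fun j h1 h2 => by simpa using h j h1 h2) (x i : ZMod (p ^ k))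
  rw [Finset.prod_eq_zero (Finset.mem_univ i) (sub_self _)] at hprod
  have hnt : Nontrivial (ZMod (p ^ k)) := by
    have : Fact (1 < p ^ k) := ⟨Nat.one_lt_pow (by omega) hp.one_lt⟩
    infer_instance
  by_cases hall : ∃ i', (p : ℤ) ∣ x i - y i'
  · obtain ⟨i', hi'⟩ := hall
    refine ⟨i', ?_⟩
    rw [← Finset.mul_prod_erase _ _ (Finset.mem_univ i')] at hprod
    have hu : IsUnit (∏ j ∈ Finset.univ.erase i', ((x i : ZMod (p ^ k)) - y j)) := by
      rw [IsUnit.prod_iff]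
      intro j hj
      rw [← Int.cast_sub]
      refine isUnit_intCast_zmod_pow hp k _ fun hd => (Finset.ne_of_mem_erase hj) (hy ?_)
      have := dvd_sub hi' hd
      rw [sub_sub_sub_cancel_left] at this
      exact (ZMod.intCast_eq_intCast_iff_dvd_sub _ _ p).2
        (by rwa [← dvd_neg, neg_sub])
    have := (hu.mul_left_eq_zero).1 hprod.symm
    exact sub_eq_zero.1 this
  · push Not at hall
    exfalso
    have hu : IsUnit (∏ j, ((x i : ZMod (p ^ k)) - y j)) := by
      rw [IsUnit.prod_iff]
      intro j _
      rw [← Int.cast_sub]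
      exact isUnit_intCast_zmod_pow hp k _ (hall j)
    rw [← hprod] at hu
    exact not_isUnit_zero hu

theorem card_Ico_modEq_le (q r : ℕ) (hr : 0 < r) (c : ℤ) :
    #{z ∈ Ico (0 : ℤ) ((q * r : ℕ) : ℤ) | z ≡ c [ZMOD r]} ≤ q := by
  have hr' : (0 : ℤ) < r := by exact_mod_cast hr
  calc _ ≤ #(Ico (0 : ℤ) q) := by
        refine Finset.card_le_card_of_injOn (fun z => z / r) ?_ ?_
        · intro z hz
          simp only [coe_filter, mem_Ico, Set.mem_ofPred_eq, coe_Ico, Set.mem_Ico] at hz ⊢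
          refine ⟨Int.ediv_nonneg hz.1.1 hr'.le, Int.ediv_lt_of_lt_mul hr' ?_⟩
          have := hz.1.2
          push_cast at this
          exact this
        · intro z hz z' hz' h
          simp only [coe_filter, mem_Ico, Set.mem_ofPred_eq] at hz hz' h
          rw [← Int.emod_add_mul_ediv z r, ← Int.emod_add_mul_ediv z' r, h]
          rw [show z % r = z' % r from hz.2.trans hz'.2.symm]
    _ = q := by simp

theorem sum_sub_pow_eq {ι : Type*} [Fintype ι] {k : ℕ} (x x' : ι → ℤ) (b : ℤ)
    (h : ∀ j, 1 ≤ j → j ≤ k → ∑ i, x i ^ j = ∑ i, x' i ^ j) (n : ℕ) (hn : n ≤ k) :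
    ∑ i, (x i - b) ^ n = ∑ i, (x' i - b) ^ n := by
  simp only [sub_eq_add_neg, add_pow]
  rw [Finset.sum_comm, Finset.sum_comm (s := (univ : Finset ι))]
  refine Finset.sum_congr rfl fun m hm => ?_
  rw [mem_range] at hm
  rw [← Finset.sum_mul, ← Finset.sum_mul, ← Finset.sum_mul, ← Finset.sum_mul]
  rcases Nat.eq_zero_or_pos m with rfl | hm0
  · simp
  · rw [h m hm0 (by omega)]

theorem prod_fin_pow_sub (p k : ℕ) : ∏ j : Fin k, p ^ (k - (j + 1)) = p ^ (k * (k - 1) / 2) := by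
  rw [Finset.prod_pow_eq_pow_sum, ← Finset.sum_range_id, ← Finset.sum_range_reflect,
    Finset.sum_range]
  congr 1
  exact Finset.sum_congr rfl fun j _ => by omega

theorem card_psum_modEq_le {p k a : ℕ} (hp : p.Prime) (hk : k < p) (hk1 : 1 ≤ k) (hka : k ≤ a)
    (b : ℤ) (c : Fin k → ℤ) (S : Finset (Fin k → ℤ))
    (hS : ∀ x ∈ S, (∀ i, x i ∈ Ico (0 : ℤ) ((p ^ a : ℕ) : ℤ)) ∧
      (Function.Injective fun i => (x i : ZMod p)) ∧
      ∀ j : Fin k, ∑ i, (x i - b) ^ (j.1 + 1) ≡ c j [ZMOD (p ^ (j.1 + 1) : ℕ)]) :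
    #S ≤ k ^ k * (p ^ (a - k)) ^ k * p ^ (k * (k - 1) / 2) := by
  classical
  have hp0 : 0 < p := hp.pos
  set t : Finset (Fin k → ℤ) := Fintype.piFinset fun j : Fin k =>
    {z ∈ Ico (0 : ℤ) ((p ^ (k - (j + 1)) * p ^ (j.1 + 1) : ℕ) : ℤ) |
      z ≡ c j [ZMOD (p ^ (j.1 + 1) : ℕ)]} with ht
  have htc : #t ≤ p ^ (k * (k - 1) / 2) := by
    rw [ht, Fintype.card_piFinset, ← prod_fin_pow_sub]
    exact Finset.prod_le_prod' fun j _ => card_Ico_modEq_le _ _ (by positivity) _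
  have hpk : (0 : ℤ) < ((p ^ k : ℕ) : ℤ) := by positivity
  set Φ : (Fin k → ℤ) → Fin k → ℤ := fun x j =>
    (∑ i, (x i - b) ^ (j.1 + 1)) % ((p ^ k : ℕ) : ℤ) with hΦ
  refine (Finset.card_le_mul_card_image_of_maps_to (f := Φ) (s := S) (t := t) ?_
    (k ^ k * (p ^ (a - k)) ^ k) ?_).trans (Nat.mul_le_mul_left _ htc)
  · intro x hx
    obtain ⟨-, -, h3⟩ := hS x hx
    rw [ht, Fintype.mem_piFinset]
    intro j
    have e : p ^ (k - (j.1 + 1)) * p ^ (j.1 + 1) = p ^ k := by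
      rw [← pow_add]; congr 1; have := j.2; omega
    rw [mem_filter, mem_Ico, e]
    refine ⟨⟨Int.emod_nonneg _ hpk.ne', Int.emod_lt_of_pos _ hpk⟩, ?_⟩
    refine Int.ModEq.trans ?_ (h3 j)
    refine Int.ModEq.of_dvd (n := ((p ^ k : ℕ) : ℤ)) ?_ (Int.mod_modEq _ _)
    exact_mod_cast pow_dvd_pow p (by have := j.2; omega)
  · intro ν _
    rcases Finset.eq_empty_or_nonempty {x ∈ S | Φ x = ν} with h0 | ⟨y, hy⟩
    · rw [h0]; simp
    rw [mem_filter] at hy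
    obtain ⟨hyS, hyν⟩ := hy
    obtain ⟨hy1, hy2, -⟩ := hS y hyS
    have hsub : {x ∈ S | Φ x = ν} ⊆ (Finset.univ : Finset (Fin k → Fin k)).biUnion fun σ =>
        Fintype.piFinset fun i => {z ∈ Ico (0 : ℤ) ((p ^ (a - k) * p ^ k : ℕ) : ℤ) |
          z ≡ y (σ i) [ZMOD (p ^ k : ℕ)]} := by
      intro x hx
      rw [mem_filter] at hx
      obtain ⟨hxS, hxν⟩ := hx
      obtain ⟨hx1, hx2, -⟩ := hS x hxS
      have key := exists_modEq_of_psum hp hk hk1 (fun i => x i - b) (fun i => y i - b)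
        (fun i i' h => hy2 (by simpa using h)) (fun j h1 h2 => by
          have e := congrFun (hxν.trans hyν.symm) ⟨j - 1, by omega⟩
          simp only [hΦ] at e
          rw [show j - 1 + 1 = j by omega] at e
          exact (ZMod.intCast_eq_intCast_iff _ _ _).2 e)
      choose σ hσ using key
      rw [mem_biUnion]
      refine ⟨σ, mem_univ _, ?_⟩
      rw [Fintype.mem_piFinset]
      intro i
      rw [mem_filter, ← pow_add, Nat.sub_add_cancel hka]
      refine ⟨hx1 i, ?_⟩
      have := (ZMod.intCast_eq_intCast_iff _ _ _).1 (hσ i)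
      simpa using this.add_right b
    refine (card_le_card hsub).trans (card_biUnion_le.trans ?_)
    calc _ ≤ ∑ σ : Fin k → Fin k, (p ^ (a - k)) ^ k := by
          refine Finset.sum_le_sum fun σ _ => ?_
          rw [Fintype.card_piFinset]
          calc _ ≤ ∏ _i : Fin k, p ^ (a - k) :=
                Finset.prod_le_prod' fun j _ => card_Ico_modEq_le _ _ (by positivity) _
            _ = _ := by simp
      _ = _ := by simp

/-- The vector `(z, z ^ 2, …, z ^ k)`. -/
def momentCurve (k : ℕ) (z : ℤ) : Fin k → ℤ := fun j => z ^ (j.1 + 1)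

/-- The sum of `momentCurve` over a tuple. -/
def moments (k : ℕ) {ι : Type*} [Fintype ι] (x : ι → ℤ) : Fin k → ℤ := ∑ i, momentCurve k (x i)

theorem moments_apply (k : ℕ) {ι : Type*} [Fintype ι] (x : ι → ℤ) (j : Fin k) :
    moments k x j = ∑ i, x i ^ (j.1 + 1) := by
  simp [moments, momentCurve]

/-- The number of solutions of the Vinogradov system of degree `k` in `2 s` variables from
`[0, M)`. -/
noncomputable def vinogradov (k s M : ℕ) : ℕ :=
  energy (moments k : (Fin s → ℤ) → Fin k → ℤ) (Fintype.piFinset fun _ => Ico (0 : ℤ) M)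

theorem moments_add_eq_sub {ι κ : Type*} [Fintype ι] [Fintype κ] {k : ℕ} (x x' : κ → ℤ)
    (z z' : ι → ℤ) (b : ℤ) (h : moments k x + moments k z = moments k x' + moments k z')
    (j : Fin k) : ∑ i, (x i - b) ^ (j.1 + 1) + ∑ i, (z i - b) ^ (j.1 + 1) =
      ∑ i, (x' i - b) ^ (j.1 + 1) + ∑ i, (z' i - b) ^ (j.1 + 1) := by
  have := sum_sub_pow_eq (k := k) (Sum.elim x z) (Sum.elim x' z') b (fun n h1 h2 => by
    have := congrFun h ⟨n - 1, by omega⟩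
    simp only [Pi.add_apply, moments_apply, show n - 1 + 1 = n by omega] at this
    simpa [Fintype.sum_sum_type] using this) (j.1 + 1) (by have := j.2; omega)
  simpa [Fintype.sum_sum_type] using this

theorem energy_residue_le {p k s a : ℕ} (hp : p.Prime) (hk : k < p) (hk1 : 1 ≤ k) (hka : k ≤ a + 1)
    (b : ℤ) (T : Finset (Fin k → ℤ))
    (hT : ∀ x ∈ T, (∀ i, x i ∈ Ico (0 : ℤ) ((p ^ (a + 1) : ℕ) : ℤ)) ∧
      (Function.Injective fun i => (x i : ZMod p))) :
    energy (fun q : (Fin k → ℤ) × (Fin s → ℤ) => moments k q.1 + moments k q.2)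
      (T ×ˢ Fintype.piFinset fun _ => {z ∈ Ico (0 : ℤ) ((p ^ (a + 1) : ℕ) : ℤ) | z % p = b}) ≤
      vinogradov k s (p ^ a) * (k ^ k * (p ^ (a + 1 - k)) ^ k * p ^ (k * (k - 1) / 2) *
        p ^ ((a + 1) * k)) := by
  classical
  have hp0 : 0 < p := hp.pos
  have hp0' : (0 : ℤ) < p := by exact_mod_cast hp0
  set R : Finset ((Fin k → ℤ) × (Fin k → ℤ)) := {q ∈ T ×ˢ T | ∀ j : Fin k,
    ∑ i, (q.1 i - b) ^ (j.1 + 1) ≡ ∑ i, (q.2 i - b) ^ (j.1 + 1) [ZMOD (p ^ (j.1 + 1) : ℕ)]} with hR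
  have hTc : #T ≤ p ^ ((a + 1) * k) := by
    calc #T ≤ #(Fintype.piFinset fun _ : Fin k => Ico (0 : ℤ) ((p ^ (a + 1) : ℕ) : ℤ)) :=
          card_le_card fun x hx => Fintype.mem_piFinset.2 (hT x hx).1
      _ = p ^ ((a + 1) * k) := by
          rw [Fintype.card_piFinset]
          simp only [Int.card_Ico, sub_zero, Int.toNat_natCast, prod_const, card_univ,
            Fintype.card_fin, pow_mul]
  have hRc : #R ≤ k ^ k * (p ^ (a + 1 - k)) ^ k * p ^ (k * (k - 1) / 2) * p ^ ((a + 1) * k) := by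
    refine (Finset.card_le_mul_card_image_of_maps_to (f := Prod.snd) (s := R) (t := T) ?_ _ ?_).trans
      (Nat.mul_le_mul_left _ hTc)
    · intro q hq
      rw [hR, mem_filter, mem_product] at hq
      exact hq.1.2
    · intro y _
      calc _ = #({q ∈ R | q.2 = y}.image Prod.fst) := by
            rw [card_image_of_injOn]
            intro q hq q' hq' e
            simp only [coe_filter, Set.mem_ofPred_eq] at hq hq'
            exact Prod.ext e (hq.2.trans hq'.2.symm)
        _ ≤ _ := by
            refine card_psum_modEq_le hp hk hk1 hka b (fun j => ∑ i, (y i - b) ^ (j.1 + 1)) _ ?_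
            intro x hx
            rw [mem_image] at hx
            obtain ⟨q, hq, rfl⟩ := hx
            rw [mem_filter, hR, mem_filter, mem_product] at hq
            obtain ⟨⟨⟨h1, h2⟩, h3⟩, rfl⟩ := hq
            exact ⟨(hT _ h1).1, (hT _ h1).2, h3⟩
  have hpow : ∀ (z : ℤ) (n : ℕ), z % p = b → (z - b) ^ n = (p : ℤ) ^ n * (z / p) ^ n := by
    intro z n h
    rw [← mul_pow]
    congr 1
    have := Int.emod_add_mul_ediv z p
    linarith
  have hsumpow : ∀ (z : Fin s → ℤ) (n : ℕ), (∀ i, z i % p = b) →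
      ∑ i, (z i - b) ^ n = (p : ℤ) ^ n * ∑ i, (z i / p) ^ n := by
    intro z n h
    rw [Finset.mul_sum]
    exact Finset.sum_congr rfl fun i _ => hpow _ _ (h i)
  set A : Finset (Fin s → ℤ) := Fintype.piFinset fun _ =>
    {z ∈ Ico (0 : ℤ) ((p ^ (a + 1) : ℕ) : ℤ) | z % p = b} with hA
  have hAm : ∀ z ∈ A, ∀ i, z i % p = b := fun z hz i =>
    (mem_filter.1 (Fintype.mem_piFinset.1 hz i)).2
  have hAb : ∀ z ∈ A, ∀ i, z i / p ∈ Ico (0 : ℤ) ((p ^ a : ℕ) : ℤ) := by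
    intro z hz i
    have := (mem_filter.1 (Fintype.mem_piFinset.1 hz i)).1
    rw [mem_Ico] at this ⊢
    refine ⟨Int.ediv_nonneg this.1 hp0'.le, Int.ediv_lt_of_lt_mul hp0' ?_⟩
    have h2 := this.2
    push_cast at h2 ⊢
    rwa [pow_succ] at h2
  refine (Finset.card_le_mul_card_image_of_maps_to
    (f := fun q : ((Fin k → ℤ) × (Fin s → ℤ)) × ((Fin k → ℤ) × (Fin s → ℤ)) => (q.1.1, q.2.1))
    (t := R) ?_ (vinogradov k s (p ^ a)) ?_).trans (Nat.mul_le_mul_left _ hRc)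
  · rintro ⟨⟨x, z⟩, ⟨x', z'⟩⟩ hq
    simp only [mem_filter, mem_product] at hq
    obtain ⟨⟨⟨hx, hz⟩, ⟨hx', hz'⟩⟩, h⟩ := hq
    simp only [hR, mem_filter, mem_product]
    refine ⟨⟨hx, hx'⟩, fun j => ?_⟩
    have h1 := moments_add_eq_sub x x' z z' b h j
    rw [hsumpow z _ (hAm z hz), hsumpow z' _ (hAm z' hz')] at h1
    rw [Int.modEq_iff_dvd]
    push_cast
    exact ⟨∑ i, (z i / p) ^ (j.1 + 1) - ∑ i, (z' i / p) ^ (j.1 + 1), by linear_combination -h1⟩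
  · rintro ⟨x, x'⟩ _
    set B : Finset (Fin s → ℤ) := Fintype.piFinset fun _ => Ico (0 : ℤ) ((p ^ a : ℕ) : ℤ) with hB
    set w : Fin k → ℤ := fun j => (∑ i, (x i - b) ^ (j.1 + 1) - ∑ i, (x' i - b) ^ (j.1 + 1)) /
      (p : ℤ) ^ (j.1 + 1) with hw
    have h2 := two_mul_card_pairs_le (fun u : Fin s → ℤ => moments k u + w)
      (fun u : Fin s → ℤ => moments k u) B
    have h3 : energy (fun u : Fin s → ℤ => moments k u + w) B = vinogradov k s (p ^ a) := by
      simp only [energy, add_left_inj, vinogradov, hB]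
    have h4 : energy (fun u : Fin s → ℤ => moments k u) B = vinogradov k s (p ^ a) := rfl
    rw [h3, h4] at h2
    refine le_trans ?_ (by linarith : #{q ∈ B ×ˢ B | moments k q.1 + w = moments k q.2} ≤
      vinogradov k s (p ^ a))
    refine Finset.card_le_card_of_injOn
      (fun q => ((fun i => q.1.2 i / p), (fun i => q.2.2 i / p))) ?_ ?_
    · rintro ⟨⟨y, z⟩, ⟨y', z'⟩⟩ hq
      simp only [coe_filter, mem_product, Set.mem_ofPred_eq, mem_filter, Prod.mk.injEq] at hq
      obtain ⟨⟨⟨⟨hx, hz⟩, ⟨hx', hz'⟩⟩, h⟩, rfl, rfl⟩ := hq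
      simp only [coe_filter, mem_product, Set.mem_ofPred_eq, hB, Fintype.mem_piFinset]
      refine ⟨⟨hAb z hz, hAb z' hz'⟩, ?_⟩
      ext j
      have h1 := moments_add_eq_sub y y' z z' b h j
      rw [hsumpow z _ (hAm z hz), hsumpow z' _ (hAm z' hz')] at h1
      simp only [Pi.add_apply, moments_apply, hw]
      rw [show ∑ i, (y i - b) ^ (j.1 + 1) - ∑ i, (y' i - b) ^ (j.1 + 1) =
        (p : ℤ) ^ (j.1 + 1) * (∑ i, (z' i / p) ^ (j.1 + 1) - ∑ i, (z i / p) ^ (j.1 + 1)) by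
          linear_combination h1]
      rw [Int.mul_ediv_cancel_left _ (by positivity)]
      ring
    · rintro ⟨⟨y, z⟩, ⟨y', z'⟩⟩ hq ⟨⟨y₂, z₂⟩, ⟨y₂', z₂'⟩⟩ hq₂ e
      simp only [coe_filter, mem_product, Set.mem_ofPred_eq, mem_filter, Prod.mk.injEq] at hq hq₂ e
      obtain ⟨⟨⟨⟨hx, hz⟩, ⟨hx', hz'⟩⟩, h⟩, rfl, rfl⟩ := hq
      obtain ⟨⟨⟨⟨hx₂, hz₂⟩, ⟨hx₂', hz₂'⟩⟩, h₂⟩, rfl, rfl⟩ := hq₂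
      have hzz : ∀ u ∈ A, ∀ v ∈ A, (fun i => u i / (p : ℤ)) = (fun i => v i / (p : ℤ)) → u = v := by
        intro u hu v hv e
        ext i
        rw [← Int.emod_add_mul_ediv (u i) p, ← Int.emod_add_mul_ediv (v i) p, hAm u hu i,
          hAm v hv i, congrFun e i]
      rw [hzz z hz z₂ hz₂ e.1, hzz z' hz' z₂' hz₂' e.2]

theorem exists_sum_equiv_of_injective {k s : ℕ} (e : Fin k → Fin (s + k))
    (he : Function.Injective e) :
    ∃ σ : Fin k ⊕ Fin s ≃ Fin (s + k), ∀ i, σ (Sum.inl i) = e i := by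
  classical
  have hc : Fintype.card ((Set.range e)ᶜ : Set (Fin (s + k))) = s := by
    rw [Fintype.card_compl_set, Set.card_range_of_injective he]
    simp
  refine ⟨(Equiv.sumCongr (Equiv.ofInjective e he) (Fintype.equivFinOfCardEq hc).symm).trans
    (Equiv.Set.sumCompl (Set.range e)), fun i => ?_⟩
  simp

theorem distinct_or_few_residues {k s : ℕ} (hk : 1 ≤ k) (y : Fin (s + k) → ℤ) :
    (∃ σ : Fin k ⊕ Fin s ≃ Fin (s + k), Function.Injective fun i => y (σ (Sum.inl i))) ∨
    ∃ (w : Fin k → ℤ) (g : Fin (s + k) → Fin k), (∀ i, y i = w (g i)) ∧ ∀ j, ∃ i, w j = y i := by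
  classical
  set R : Finset ℤ := univ.image y with hR
  rcases le_or_gt k #R with h | h
  · left
    obtain ⟨R', hR', hcard⟩ := Finset.exists_subset_card_eq h
    have hex : ∀ r : R', ∃ i, y i = r := fun r => by
      have := hR' r.2
      simpa [hR] using this
    choose f hf using hex
    set eq := (Finset.equivFinOfCardEq hcard).symm
    obtain ⟨σ, hσ⟩ := exists_sum_equiv_of_injective (k := k) (s := s) (fun i => f (eq i))
      (fun i i' h => eq.injective (Subtype.ext (by rw [← hf, ← hf]; exact congrArg y h)))
    refine ⟨σ, fun i i' h => ?_⟩
    simp only [hσ, hf] at h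
    exact eq.injective (Subtype.ext h)
  · right
    have hmem : ∀ i, y i ∈ R := fun i => mem_image_of_mem _ (mem_univ i)
    set i₀ : Fin (s + k) := ⟨0, by omega⟩
    refine ⟨fun j => if hj : j.1 < #R then (R.equivFin.symm ⟨j.1, hj⟩ : ℤ) else y i₀,
      fun i => Fin.castLE h.le (R.equivFin ⟨y i, hmem i⟩), fun i => ?_, fun j => ?_⟩
    · simp
    · dsimp only
      split_ifs with hj
      · have hex : ∀ r : R, ∃ i, (r : ℤ) = y i := fun r => by
          obtain ⟨i, -, hi⟩ := mem_image.1 r.2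
          exact ⟨i, hi.symm⟩
        exact hex _
      · exact ⟨i₀, rfl⟩

theorem moments_sum_equiv {ι κ μ : Type*} [Fintype ι] [Fintype κ] [Fintype μ] (k : ℕ)
    (σ : κ ⊕ ι ≃ μ) (x : μ → ℤ) :
    moments k x = moments k (fun i => x (σ (Sum.inl i))) +
      moments k (fun i => x (σ (Sum.inr i))) := by
  rw [moments, ← Equiv.sum_comp σ, Fintype.sum_sum_type]
  rfl

theorem vinogradov_add_le (k s M : ℕ) :
    vinogradov k (s + k) M ≤ M ^ (2 * k) * vinogradov k s M := by
  classical
  set T : Finset (Fin k → ℤ) := Fintype.piFinset fun _ => Ico (0 : ℤ) M with hT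
  set A : Finset (Fin s → ℤ) := Fintype.piFinset fun _ => Ico (0 : ℤ) M with hA
  have hTc : #T = M ^ k := by simp [hT, Fintype.card_piFinset]
  set σ : Fin k ⊕ Fin s ≃ Fin (s + k) :=
    (finSumFinEquiv.trans (finCongr (Nat.add_comm k s)))
  set F : (Fin k → ℤ) × (Fin s → ℤ) → Fin k → ℤ := fun q => moments k q.1 + moments k q.2 with hF
  set Z : (Fin k → ℤ) → Finset ((Fin k → ℤ) × (Fin s → ℤ)) := fun t => {t} ×ˢ A with hZ
  calc vinogradov k (s + k) M ≤ energy F (T ×ˢ A) := by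
        refine energy_mono_of_injOn _ _ _ _
          (fun x : Fin (s + k) → ℤ => (fun i => x (σ (Sum.inl i)), fun i => x (σ (Sum.inr i)))) ?_ ?_ ?_
        · intro x hx
          rw [Fintype.mem_piFinset] at hx
          simp only [hT, hA, mem_product, Fintype.mem_piFinset]
          exact ⟨fun i => hx _, fun i => hx _⟩
        · intro x _ x' _ h
          simp only [Prod.mk.injEq] at h
          ext m
          obtain ⟨u, rfl⟩ := σ.surjective m
          rcases u with i | i
          · exact congrFun h.1 i
          · exact congrFun h.2 i
        · intro x _ y _ h
          rw [moments_sum_equiv k σ x, moments_sum_equiv k σ y] at h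
          exact h
    _ ≤ #T * ∑ t ∈ T, energy F (Z t) := by
        refine energy_biUnion_le F T Z _ fun q hq => ?_
        rw [mem_product] at hq
        exact ⟨q.1, hq.1, mem_product.2 ⟨mem_singleton_self _, hq.2⟩⟩
    _ ≤ #T * ∑ _t ∈ T, vinogradov k s M := by
        refine Nat.mul_le_mul_left _ (Finset.sum_le_sum fun t _ => ?_)
        refine energy_mono_of_injOn F _ (Z t) A Prod.snd ?_ ?_ ?_
        · intro q hq
          exact (mem_product.1 hq).2
        · intro q hq q' hq' h
          rw [mem_coe, mem_product, mem_singleton] at hq hq'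
          exact Prod.ext (hq.1.trans hq'.1.symm) h
        · intro q hq q' hq' h
          rw [mem_product, mem_singleton] at hq hq'
          simp only [hF] at h
          rw [hq.1, hq'.1] at h
          exact add_left_cancel h
    _ = _ := by rw [sum_const, smul_eq_mul, hTc]; ring

theorem energy_residue_le_vinogradov {p k s a : ℕ} (hp : 0 < p) (b : ℤ) :
    energy (moments k : (Fin s → ℤ) → Fin k → ℤ)
      (Fintype.piFinset fun _ => {z ∈ Ico (0 : ℤ) ((p ^ (a + 1) : ℕ) : ℤ) | z % p = b}) ≤
      vinogradov k s (p ^ a) := by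
  have hp0' : (0 : ℤ) < p := by exact_mod_cast hp
  have hm : ∀ z ∈ (Fintype.piFinset fun _ : Fin s =>
      {z ∈ Ico (0 : ℤ) ((p ^ (a + 1) : ℕ) : ℤ) | z % p = b}), ∀ i, z i % p = b := fun z hz i =>
    (mem_filter.1 (Fintype.mem_piFinset.1 hz i)).2
  refine energy_mono_of_injOn _ _ _ _ (fun x i => x i / p) ?_ ?_ ?_
  · intro x hx
    rw [Fintype.mem_piFinset] at hx ⊢
    intro i
    have := (mem_filter.1 (hx i)).1
    rw [mem_Ico] at this ⊢
    refine ⟨Int.ediv_nonneg this.1 hp0'.le, Int.ediv_lt_of_lt_mul hp0' ?_⟩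
    have h2 := this.2
    push_cast at h2 ⊢
    rwa [pow_succ] at h2
  · intro x hx y hy h
    ext i
    have e : x i / (p : ℤ) = y i / (p : ℤ) := congrFun h i
    rw [← Int.emod_add_mul_ediv (x i) p, ← Int.emod_add_mul_ediv (y i) p, hm x hx i, hm y hy i, e]
  · intro x hx y hy h
    have hpow : ∀ z : Fin s → ℤ, (∀ i, z i % p = b) → ∀ n, ∑ i, (z i - b) ^ n =
        (p : ℤ) ^ n * ∑ i, (z i / p) ^ n := by
      intro z hz n
      rw [Finset.mul_sum]
      refine Finset.sum_congr rfl fun i _ => ?_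
      rw [← mul_pow]
      congr 1
      have := Int.emod_add_mul_ediv (z i) p
      have := hz i
      linarith
    ext j
    have h1 := sum_sub_pow_eq (k := k) x y b (fun n h1 h2 => by
      have := congrFun h ⟨n - 1, by omega⟩
      simpa only [moments_apply, show n - 1 + 1 = n by omega] using this) (j.1 + 1)
      (by have := j.2; omega)
    rw [hpow x (hm x hx), hpow y (hm y hy)] at h1
    rw [moments_apply, moments_apply]
    exact mul_left_cancel₀ (by positivity) h1

theorem energy_distinct_le {p k s a : ℕ} (hp : p.Prime) (hk : k < p) (hk1 : 1 ≤ k) (hs : 1 ≤ s)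
    (hka : k ≤ a + 1) (T : Finset (Fin k → ℤ))
    (hT : ∀ x ∈ T, (∀ i, x i ∈ Ico (0 : ℤ) ((p ^ (a + 1) : ℕ) : ℤ)) ∧
      (Function.Injective fun i => (x i : ZMod p))) :
    energy (fun q : (Fin k → ℤ) × (Fin s → ℤ) => moments k q.1 + moments k q.2)
      (T ×ˢ Fintype.piFinset fun _ => Ico (0 : ℤ) ((p ^ (a + 1) : ℕ) : ℤ)) ≤
      p ^ (2 * s) * s * (vinogradov k s (p ^ a) *
        (k ^ k * (p ^ (a + 1 - k)) ^ k * p ^ (k * (k - 1) / 2) * p ^ ((a + 1) * k))) := by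
  classical
  have hp0' : (0 : ℤ) < p := by exact_mod_cast hp.pos
  have : Nonempty (Fin s) := ⟨⟨0, hs⟩⟩
  set D := vinogradov k s (p ^ a) *
        (k ^ k * (p ^ (a + 1 - k)) ^ k * p ^ (k * (k - 1) / 2) * p ^ ((a + 1) * k)) with hD
  set I : Finset (Fin s → ℤ) := Fintype.piFinset fun _ => Ico (0 : ℤ) p with hI
  have hIc : #I = p ^ s := by simp [hI, Fintype.card_piFinset]
  refine (energy_biUnion_le _ I (fun c => T ×ˢ Fintype.piFinset fun i =>
    {z ∈ Ico (0 : ℤ) ((p ^ (a + 1) : ℕ) : ℤ) | z % p = c i}) _ ?_).trans ?_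
  · intro q hq
    rw [mem_product, Fintype.mem_piFinset] at hq
    refine ⟨fun i => q.2 i % p, ?_, ?_⟩
    · rw [hI, Fintype.mem_piFinset]
      exact fun i => mem_Ico.2 ⟨Int.emod_nonneg _ hp0'.ne', Int.emod_lt_of_pos _ hp0'⟩
    · rw [mem_product, Fintype.mem_piFinset]
      exact ⟨hq.1, fun i => mem_filter.2 ⟨hq.2 i, rfl⟩⟩
  · calc _ ≤ #I * ∑ c ∈ I, ∑ _i : Fin s, D := by
          refine Nat.mul_le_mul_left _ (Finset.sum_le_sum fun c _ => ?_)
          refine (energy_mixed_le (moments k) (momentCurve k) T fun i =>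
            {z ∈ Ico (0 : ℤ) ((p ^ (a + 1) : ℕ) : ℤ) | z % p = c i}).trans ?_
          exact Finset.sum_le_sum fun i _ => energy_residue_le hp hk hk1 hka (c i) T hT
      _ = _ := by
          rw [sum_const, sum_const, smul_eq_mul, smul_eq_mul, hIc, card_univ, Fintype.card_fin]
          ring

theorem energy_class_le {p k m a : ℕ} (hp : 0 < p) (hm : 1 ≤ m) (c : Fin m → ℤ) :
    energy (moments k : (Fin m → ℤ) → Fin k → ℤ) (Fintype.piFinset fun i =>
      {z ∈ Ico (0 : ℤ) ((p ^ (a + 1) : ℕ) : ℤ) | z % p = c i}) ≤ m * vinogradov k m (p ^ a) := by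
  classical
  have : Nonempty (Fin m) := ⟨⟨0, hm⟩⟩
  set A : Fin m → Finset ℤ := fun i => {z ∈ Ico (0 : ℤ) ((p ^ (a + 1) : ℕ) : ℤ) | z % p = c i}
  set F : Unit × (Fin m → ℤ) → Fin k → ℤ := fun q => 0 + ∑ i, momentCurve k (q.2 i) with hF
  have h1 : ∀ x, F ((), x) = moments k x := fun x => by simp [hF, moments]
  calc _ ≤ energy F ({()} ×ˢ Fintype.piFinset A) := by
        refine energy_mono_of_injOn _ _ _ _ (fun x => ((), x)) ?_ ?_ ?_
        · intro x hx
          exact mem_product.2 ⟨mem_singleton_self _, hx⟩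
        · intro x _ y _ h
          exact (Prod.mk.inj h).2
        · intro x _ y _ h
          rw [h1, h1, h]
    _ ≤ ∑ i, energy F ({()} ×ˢ Fintype.piFinset fun _ => A i) :=
        energy_mixed_le (fun _ => 0) (momentCurve k) {()} A
    _ ≤ ∑ _i : Fin m, vinogradov k m (p ^ a) := by
        refine Finset.sum_le_sum fun i _ => le_trans ?_ (energy_residue_le_vinogradov hp (c i))
        refine energy_mono_of_injOn _ _ _ _ Prod.snd ?_ ?_ ?_
        · intro q hq
          exact (mem_product.1 hq).2
        · intro q _ q' _ h
          exact Prod.ext rfl h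
        · intro q _ q' _ h
          rw [show q = ((), q.2) from rfl, show q' = ((), q'.2) from rfl, h1, h1] at h
          exact h
    _ = _ := by simp

theorem vinogradov_step {p k s a S : ℕ} (hp : p.Prime) (hk2 : 2 ≤ k) (hkp : k ^ 4 ≤ p)
    (hs : k ^ 2 ≤ s) (hka : k ≤ a + 1) (hS : s + k ≤ S) :
    vinogradov k (s + k) (p ^ (a + 1)) * p ^ (k * (k + 1) / 2) ≤
      (4 * S) ^ (4 * S) * p ^ (2 * s + 2 * (a + 1) * k) * vinogradov k s (p ^ a) := by
  classical
  have hp0' : (0 : ℤ) < p := by exact_mod_cast hp.pos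
  have hkp' : k < p := lt_of_lt_of_le (by nlinarith [Nat.pow_le_pow_left hk2 3, pow_succ k 3]) hkp
  have hks : k ≤ s := by nlinarith
  set J := vinogradov k s (p ^ a) with hJ
  set X : Finset (Fin (s + k) → ℤ) :=
    Fintype.piFinset fun _ => Ico (0 : ℤ) ((p ^ (a + 1) : ℕ) : ℤ) with hX
  set Y₁ : (Fin k ⊕ Fin s ≃ Fin (s + k)) → Finset (Fin (s + k) → ℤ) := fun σ =>
    {x ∈ X | Function.Injective fun i => ((x (σ (Sum.inl i)) : ℤ) : ZMod p)} with hY₁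
  set Y₂ : (Fin k → ℤ) × (Fin (s + k) → Fin k) → Finset (Fin (s + k) → ℤ) := fun c =>
    Fintype.piFinset fun i => {z ∈ Ico (0 : ℤ) ((p ^ (a + 1) : ℕ) : ℤ) | z % p = c.1 (c.2 i)}
    with hY₂
  set I₂ : Finset ((Fin k → ℤ) × (Fin (s + k) → Fin k)) :=
    (Fintype.piFinset fun _ => Ico (0 : ℤ) p) ×ˢ univ with hI₂
  have hI₂c : #I₂ = p ^ k * k ^ (s + k) := by
    simp [hI₂, Fintype.card_piFinset]
  have hI₁c : #(univ : Finset (Fin k ⊕ Fin s ≃ Fin (s + k))) = (s + k).factorial := by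
    rw [card_univ, Fintype.card_equiv (finSumFinEquiv.trans (finCongr (Nat.add_comm k s)))]
    simp [Nat.add_comm]
  set G := univ.biUnion Y₁ with hG
  set B := I₂.biUnion Y₂ with hB
  have hcov : ∀ x ∈ X, ∃ i ∈ (univ : Finset Bool), x ∈ (fun i => if i then G else B) i := by
    intro x hx
    rcases distinct_or_few_residues (k := k) (s := s) (by omega) (fun i => x i % p) with
      ⟨σ, hσ⟩ | ⟨w, g, h1, h2⟩
    · refine ⟨true, mem_univ _, ?_⟩
      simp only [if_true, hG, mem_biUnion, mem_univ, true_and, hY₁, mem_filter]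
      exact ⟨σ, hx, fun i i' h => hσ ((ZMod.intCast_eq_intCast_iff' _ _ _).1 h)⟩
    · refine ⟨false, mem_univ _, ?_⟩
      simp only [Bool.false_eq_true, if_false, hB, mem_biUnion]
      refine ⟨(w, g), ?_, ?_⟩
      · simp only [hI₂, mem_product, Fintype.mem_piFinset, mem_univ, and_true]
        intro j
        obtain ⟨i, hi⟩ := h2 j
        rw [hi]
        exact mem_Ico.2 ⟨Int.emod_nonneg _ hp0'.ne', Int.emod_lt_of_pos _ hp0'⟩
      · simp only [hY₂, Fintype.mem_piFinset, mem_filter]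
        exact fun i => ⟨Fintype.mem_piFinset.1 hx i, h1 i⟩
  have hGle : energy (moments k : (Fin (s + k) → ℤ) → Fin k → ℤ) G ≤
      ((s + k).factorial) ^ 2 * (p ^ (2 * s) * s * (J *
        (k ^ k * (p ^ (a + 1 - k)) ^ k * p ^ (k * (k - 1) / 2) * p ^ ((a + 1) * k)))) := by
    refine (energy_biUnion_le _ univ Y₁ G fun x hx => by simpa [hG] using hx).trans ?_
    rw [hI₁c, sq, mul_assoc]
    refine Nat.mul_le_mul_left _ ?_
    rw [← hI₁c, ← smul_eq_mul #univ, ← sum_const]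
    refine Finset.sum_le_sum fun σ _ => ?_
    set T : Finset (Fin k → ℤ) := {x ∈ Fintype.piFinset fun _ =>
      Ico (0 : ℤ) ((p ^ (a + 1) : ℕ) : ℤ) | Function.Injective fun i => ((x i : ℤ) : ZMod p)}
      with hT
    refine le_trans ?_ (energy_distinct_le (s := s) hp hkp' (by omega) (by nlinarith) hka T ?_)
    · refine energy_mono_of_injOn _ _ _ _
          (fun x => (fun i => x (σ (Sum.inl i)), fun i => x (σ (Sum.inr i)))) ?_ ?_ ?_
      · intro x hx
        rw [hY₁, mem_filter, hX, Fintype.mem_piFinset] at hx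
        rw [mem_product, hT, mem_filter, Fintype.mem_piFinset, Fintype.mem_piFinset]
        exact ⟨⟨fun i => hx.1 _, hx.2⟩, fun i => hx.1 _⟩
      · intro x _ x' _ h
        simp only [Prod.mk.injEq] at h
        ext m
        obtain ⟨u, rfl⟩ := σ.surjective m
        rcases u with i | i
        · exact congrFun h.1 i
        · exact congrFun h.2 i
      · intro x _ y _ h
        rw [moments_sum_equiv k σ x, moments_sum_equiv k σ y] at h
        exact h
    · intro x hx
      rw [hT, mem_filter, Fintype.mem_piFinset] at hx
      exact hx
  have hBle : energy (moments k : (Fin (s + k) → ℤ) → Fin k → ℤ) B ≤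
      (p ^ k * k ^ (s + k)) ^ 2 * ((s + k) * ((p ^ a) ^ (2 * k) * J)) := by
    refine (energy_biUnion_le _ I₂ Y₂ B fun x hx => by simpa [hB] using hx).trans ?_
    rw [hI₂c, sq, mul_assoc (p ^ k * k ^ (s + k)) (p ^ k * k ^ (s + k))]
    refine Nat.mul_le_mul_left _ ?_
    rw [← hI₂c, ← smul_eq_mul #I₂, ← sum_const]
    refine Finset.sum_le_sum fun c _ => ?_
    refine (energy_class_le hp.pos (by omega) fun i => c.1 (c.2 i)).trans ?_
    exact Nat.mul_le_mul_left _ (vinogradov_add_le k s (p ^ a))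
  have htot : vinogradov k (s + k) (p ^ (a + 1)) ≤ 2 * (energy (moments k) G +
      energy (moments k) B) := by
    refine (energy_biUnion_le _ univ _ X hcov).trans ?_
    simp
  have e1 : (p ^ (a + 1 - k)) ^ k * p ^ (k * (k - 1) / 2) * p ^ (k * (k + 1) / 2) =
      p ^ ((a + 1) * k) := by
    rw [← pow_mul, ← pow_add, ← pow_add]
    congr 1
    have h1 : k * (k - 1) / 2 + k * (k + 1) / 2 = k * k := by
      obtain ⟨j, rfl⟩ : ∃ j, k = j + 1 := ⟨k - 1, by omega⟩
      have h2 : 2 ∣ (j + 1) * (j + 1 - 1) := by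
        rw [Nat.add_sub_cancel, mul_comm]; exact (Nat.even_mul_succ_self j).two_dvd
      have h3 : 2 ∣ (j + 1) * (j + 1 + 1) := (Nat.even_mul_succ_self (j + 1)).two_dvd
      rw [← Nat.add_div_of_dvd_right h2, Nat.add_sub_cancel]
      apply Nat.div_eq_of_eq_mul_left (by norm_num)
      ring
    rw [add_assoc, h1, ← Nat.add_mul, Nat.sub_add_cancel hka]
  have e2 : p ^ (k * (k + 1) / 2) * k ^ (2 * (s + k)) ≤ p ^ (2 * s) := by
    have h1 : k * (k + 1) / 2 ≤ s := by
      apply Nat.div_le_of_le_mul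
      nlinarith
    calc p ^ (k * (k + 1) / 2) * k ^ (2 * (s + k)) ≤ p ^ s * k ^ (4 * s) :=
          Nat.mul_le_mul (Nat.pow_le_pow_right hp.pos h1)
            (Nat.pow_le_pow_right (by omega) (by omega))
      _ = p ^ s * (k ^ 4) ^ s := by rw [pow_mul]
      _ ≤ p ^ s * p ^ s := Nat.mul_le_mul_left _ (Nat.pow_le_pow_left hkp s)
      _ = _ := by rw [← pow_add]; congr 1; ring
  have e3 : 2 * (((s + k).factorial) ^ 2 * s * k ^ k + (s + k)) ≤ (4 * S) ^ (4 * S) := by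
    have hS1 : 1 ≤ S := by omega
    have f1 : (s + k).factorial ≤ S ^ S :=
      (Nat.factorial_le_pow _).trans ((Nat.pow_le_pow_left hS _).trans
        (Nat.pow_le_pow_right hS1 hS))
    have f2 : k ^ k ≤ S ^ S := (Nat.pow_le_pow_left (by omega : k ≤ S) k).trans
      (Nat.pow_le_pow_right hS1 (by omega))
    have f3 : S ≤ S ^ S := Nat.le_self_pow (by omega) S
    calc 2 * (((s + k).factorial) ^ 2 * s * k ^ k + (s + k))
        ≤ 2 * ((S ^ S) ^ 2 * S ^ S * S ^ S + S ^ S * 1) := by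
          gcongr
          · omega
          · omega
      _ ≤ 2 * ((S ^ S) ^ 2 * S ^ S * S ^ S + S ^ S * (S ^ S) ^ 3) := by
          gcongr
          exact Nat.one_le_pow _ _ (by positivity)
      _ = 4 * S ^ (4 * S) := by rw [← pow_mul, ← pow_mul]; ring
      _ ≤ 4 ^ (4 * S) * S ^ (4 * S) := by
          gcongr
          exact Nat.le_self_pow (by omega) 4
      _ = _ := by rw [mul_pow]
  calc vinogradov k (s + k) (p ^ (a + 1)) * p ^ (k * (k + 1) / 2)
      ≤ 2 * (((s + k).factorial) ^ 2 * (p ^ (2 * s) * s * (J *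
        (k ^ k * (p ^ (a + 1 - k)) ^ k * p ^ (k * (k - 1) / 2) * p ^ ((a + 1) * k)))) +
        (p ^ k * k ^ (s + k)) ^ 2 * ((s + k) * ((p ^ a) ^ (2 * k) * J))) *
        p ^ (k * (k + 1) / 2) := by
        refine Nat.mul_le_mul_right _ (htot.trans ?_)
        exact Nat.mul_le_mul_left _ (Nat.add_le_add hGle hBle)
    _ = 2 * (((s + k).factorial) ^ 2 * s * k ^ k * (p ^ (2 * s) * p ^ ((a + 1) * k) *
        ((p ^ (a + 1 - k)) ^ k * p ^ (k * (k - 1) / 2) * p ^ (k * (k + 1) / 2))) +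
        (s + k) * ((p ^ (k * (k + 1) / 2) * k ^ (2 * (s + k))) * p ^ (2 * (a + 1) * k))) * J := by
        have : (p ^ k * k ^ (s + k)) ^ 2 * (p ^ a) ^ (2 * k) =
            k ^ (2 * (s + k)) * p ^ (2 * (a + 1) * k) := by
          rw [mul_pow, ← pow_mul, ← pow_mul, ← pow_mul, mul_right_comm, ← pow_add]
          rw [show k * 2 + a * (2 * k) = 2 * (a + 1) * k by ring, mul_comm, mul_comm 2 (s + k)]
        linear_combination (2 * (s + k) * J * p ^ (k * (k + 1) / 2)) * this
    _ ≤ 2 * (((s + k).factorial) ^ 2 * s * k ^ k * (p ^ (2 * s) * p ^ ((a + 1) * k) *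
        p ^ ((a + 1) * k)) +
        (s + k) * (p ^ (2 * s) * p ^ (2 * (a + 1) * k))) * J := by
        rw [e1]
        gcongr
    _ = 2 * (((s + k).factorial) ^ 2 * s * k ^ k + (s + k)) *
        p ^ (2 * s + 2 * (a + 1) * k) * J := by
        have : p ^ ((a + 1) * k) * p ^ ((a + 1) * k) = p ^ (2 * (a + 1) * k) := by
          rw [← pow_add]; congr 1; ring
        rw [pow_add, mul_assoc (p ^ (2 * s)), this]
        ring
    _ ≤ _ := by gcongr

theorem vinogradov_le {p k r S : ℕ} (hp : p.Prime) (hk2 : 2 ≤ k) (hkp : k ^ 4 ≤ p)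
    (hS : k ^ 2 + r * k ≤ S) :
    vinogradov k (k ^ 2 + r * k) (p ^ (r + k)) * p ^ (r * (k * (k + 1) / 2)) ≤
      ((4 * S) ^ (4 * S)) ^ r * p ^ (2 * (k ^ 2 + r * k) * (r + k)) := by
  induction r with
  | zero =>
    simp only [zero_mul, add_zero, pow_zero, mul_one, one_mul, zero_add]
    refine (energy_le_card_sq _ _).trans ?_
    rw [Fintype.card_piFinset]
    simp only [Int.card_Ico, sub_zero, Int.toNat_natCast, prod_const, card_univ, Fintype.card_fin]
    rw [← pow_mul, ← pow_mul]
    exact Nat.pow_le_pow_right hp.pos (by nlinarith)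
  | succ r ih =>
    have hr : k ^ 2 + (r + 1) * k = (k ^ 2 + r * k) + k := by ring
    rw [hr] at hS ⊢
    have ih' := ih (by omega)
    have hstep := vinogradov_step (a := r + k) hp hk2 hkp
      (Nat.le_add_right (k ^ 2) (r * k)) (by omega) hS
    rw [show r + 1 + k = r + k + 1 by ring]
    calc _ = (vinogradov k (k ^ 2 + r * k + k) (p ^ (r + k + 1)) * p ^ (k * (k + 1) / 2)) *
          p ^ (r * (k * (k + 1) / 2)) := by rw [Nat.add_mul, one_mul, pow_add]; ring
      _ ≤ (4 * S) ^ (4 * S) * p ^ (2 * (k ^ 2 + r * k) + 2 * (r + k + 1) * k) *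
          (vinogradov k (k ^ 2 + r * k) (p ^ (r + k)) * p ^ (r * (k * (k + 1) / 2))) := by
          rw [← mul_assoc]
          exact Nat.mul_le_mul_right _ hstep
      _ ≤ (4 * S) ^ (4 * S) * p ^ (2 * (k ^ 2 + r * k) + 2 * (r + k + 1) * k) *
          (((4 * S) ^ (4 * S)) ^ r * p ^ (2 * (k ^ 2 + r * k) * (r + k))) :=
          Nat.mul_le_mul_left _ ih'
      _ = _ := by
          rw [pow_succ ((4 * S) ^ (4 * S)),
            show 2 * (k ^ 2 + r * k + k) * (r + k + 1) =
              (2 * (k ^ 2 + r * k) + 2 * (r + k + 1) * k) + 2 * (k ^ 2 + r * k) * (r + k) by ring,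
            pow_add p]
          ring

/-- `e (x) = exp (2 π i x)`. -/
noncomputable def eu (x : ℝ) : ℂ := Complex.exp ((2 * Real.pi * x : ℝ) * Complex.I)

theorem eu_add (x y : ℝ) : eu (x + y) = eu x * eu y := by
  rw [eu, eu, eu, ← Complex.exp_add]
  congr 1
  push_cast
  ring

@[simp] theorem eu_zero : eu 0 = 1 := by simp [eu]

@[simp] theorem norm_eu (x : ℝ) : ‖eu x‖ = 1 := Complex.norm_exp_ofReal_mul_I _

theorem eu_sum {ι : Type*} (s : Finset ι) (f : ι → ℝ) : eu (∑ i ∈ s, f i) = ∏ i ∈ s, eu (f i) := by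
  classical
  induction s using Finset.induction_on with
  | empty => simp
  | insert a s ha ih => rw [sum_insert ha, prod_insert ha, eu_add, ih]

theorem conj_eu (x : ℝ) : (starRingEnd ℂ) (eu x) = eu (-x) := by
  rw [eu, eu, ← Complex.exp_conj, map_mul, Complex.conj_ofReal, Complex.conj_I]
  congr 1
  push_cast
  ring

theorem eu_nat_mul (n : ℕ) (x : ℝ) : eu (n * x) = eu x ^ n := by
  rw [eu, eu, ← Complex.exp_nat_mul]
  congr 1
  push_cast
  ring

theorem eu_int (n : ℤ) : eu n = 1 := by
  rw [eu, Complex.exp_eq_one_iff]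
  exact ⟨n, by push_cast; ring⟩

theorem norm_eu_sub_one_ge (x : ℝ) : 4 * |x - round x| ≤ ‖eu x - 1‖ := by
  set θ := x - round x with hθ
  have h1 : eu x = eu θ := by
    have : x = θ + round x := by rw [hθ]; ring
    rw [this, eu_add, eu_int, mul_one]
  have hab : |θ| ≤ 1 / 2 := abs_sub_round x
  have h2 : ‖eu θ - 1‖ = 2 * |Real.sin (Real.pi * θ)| := by
    have : eu θ - 1 = eu (θ / 2) * (2 * Real.sin (Real.pi * θ) * Complex.I) := by
      have e1 : eu θ = eu (θ / 2) * eu (θ / 2) := by rw [← eu_add]; ring_nf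
      have e2 : (1 : ℂ) = eu (θ / 2) * eu (-(θ / 2)) := by rw [← eu_add]; simp
      rw [show eu θ - 1 = eu (θ / 2) * (eu (θ / 2) - eu (-(θ / 2))) by
        rw [mul_sub, ← e1, ← e2]]
      congr 1
      rw [Complex.ofReal_sin, Complex.sin, eu, eu]
      have a1 : ((2 * Real.pi * (θ / 2) : ℝ) : ℂ) * Complex.I =
        ((Real.pi * θ : ℝ) : ℂ) * Complex.I := by push_cast; ring
      have a2 : ((2 * Real.pi * -(θ / 2) : ℝ) : ℂ) * Complex.I =
        -((Real.pi * θ : ℝ) : ℂ) * Complex.I := by push_cast; ring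
      rw [a1, a2]
      linear_combination (Complex.exp (↑(Real.pi * θ) * Complex.I) -
        Complex.exp (-↑(Real.pi * θ) * Complex.I)) * Complex.I_mul_I
    rw [this, norm_mul, norm_eu, one_mul, norm_mul, norm_mul, Complex.norm_I, mul_one,
      Complex.norm_real, Real.norm_eq_abs]
    norm_num
  rw [h1, h2]
  have h3 := Real.mul_abs_le_abs_sin (x := Real.pi * θ) (by
    rw [abs_mul, abs_of_pos Real.pi_pos]
    nlinarith [Real.pi_pos])
  rw [abs_mul, abs_of_pos Real.pi_pos] at h3
  have : 2 / Real.pi * (Real.pi * |θ|) = 2 * |θ| := by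
    field_simp
  linarith

theorem norm_sum_eu_le (N : ℕ) (x : ℝ) (hx : 0 < |x - round x|) :
    ‖∑ n ∈ range N, eu (n * x)‖ ≤ 1 / (2 * |x - round x|) := by
  have h1 := norm_eu_sub_one_ge x
  have hne : eu x ≠ 1 := by
    intro h
    rw [h, sub_self, norm_zero] at h1
    linarith
  simp only [eu_nat_mul]
  rw [geom_sum_eq hne, norm_div]
  calc ‖eu x ^ N - 1‖ / ‖eu x - 1‖ ≤ 2 / (4 * |x - round x|) := by
        gcongr
        refine (norm_sub_le _ _).trans ?_
        rw [norm_pow, norm_eu, one_pow, norm_one]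
        norm_num
    _ = _ := by rw [div_eq_div_iff (by positivity) (by positivity)]; ring

theorem norm_sum_eu_le_card {ι : Type*} (s : Finset ι) (f : ι → ℝ) :
    ‖∑ n ∈ s, eu (f n)‖ ≤ #s := by
  refine (norm_sum_le _ _).trans ?_
  simp

theorem card_int_abs_sub_lt_le (S : Finset ℤ) (c r : ℝ) (hr : 0 ≤ r)
    (h : ∀ z ∈ S, |(z : ℝ) - c| ≤ r) : (#S : ℝ) ≤ 2 * r + 1 := by
  have hsub : S ⊆ Icc ⌈c - r⌉ ⌊c + r⌋ := by
    intro z hz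
    have := abs_le.1 (h z hz)
    rw [mem_Icc]
    exact ⟨Int.ceil_le.2 (by linarith), Int.le_floor.2 (by linarith)⟩
  have h1 : (#S : ℝ) ≤ ((⌊c + r⌋ + 1 - ⌈c - r⌉).toNat : ℝ) := by
    exact_mod_cast (card_le_card hsub).trans (by rw [Int.card_Icc])
  refine h1.trans ?_
  have h2 : (((⌊c + r⌋ + 1 - ⌈c - r⌉).toNat : ℤ) : ℝ) ≤ 2 * r + 1 := by
    rcases le_total (⌊c + r⌋ + 1 - ⌈c - r⌉) 0 with h0 | h0
    · rw [Int.toNat_of_nonpos h0]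
      push_cast; linarith
    · rw [Int.toNat_of_nonneg h0]
      push_cast
      linarith [Int.floor_le (c + r), Int.le_ceil (c - r)]
  exact_mod_cast h2

/-- Average over frequencies of incomplete linear exponential sums. -/
noncomputable def linearAverage (γ : ℝ) (N : ℕ) : ℝ :=
  ∑ l ∈ Icc (-(N : ℤ)) N, ‖∑ n ∈ range (N + 1), eu (n * (γ * l))‖

theorem linearAverage_nonneg (γ : ℝ) (N : ℕ) : 0 ≤ linearAverage γ N :=
  sum_nonneg fun _ _ => norm_nonneg _

theorem linearAverage_le_trivial (γ : ℝ) (N : ℕ) (hN : 1 ≤ N) :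
    linearAverage γ N ≤ 6 * (N : ℝ) ^ 2 := by
  have hN' : (1 : ℝ) ≤ N := by exact_mod_cast hN
  calc linearAverage γ N ≤ ∑ _l ∈ Icc (-(N : ℤ)) N, ((N : ℝ) + 1) := by
        refine sum_le_sum fun l _ => (norm_sum_eu_le_card _ _).trans ?_
        simp
    _ = (2 * N + 1) * (N + 1) := by
        rw [sum_const, Int.card_Icc, nsmul_eq_mul]
        rw [show ((N : ℤ) + 1 - -(N : ℤ)).toNat = 2 * N + 1 by omega]
        push_cast; ring
    _ ≤ _ := by nlinarith

theorem linearAverage_neg (γ : ℝ) (N : ℕ) : linearAverage (-γ) N = linearAverage γ N := by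
  refine sum_congr rfl fun l _ => ?_
  rw [← Complex.norm_conj, map_sum]
  simp only [conj_eu]
  congr 1
  refine sum_congr rfl fun n _ => ?_
  congr 1
  ring

theorem linearAverage_le (γ : ℝ) (N : ℕ) (hN : 1 ≤ N) (h0 : 0 < γ) (h1 : γ ≤ 1) :
    linearAverage γ N ≤ 20 * (N : ℝ) ^ 2 * (√γ + 1 / (N * √γ)) := by
  have hN' : (1 : ℝ) ≤ N := by exact_mod_cast hN
  set τ := √γ with hτ
  have hτ0 : 0 < τ := Real.sqrt_pos.2 h0
  have hτ2 : τ * τ = γ := Real.mul_self_sqrt h0.le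
  have hτ1 : τ ≤ 1 := Real.sqrt_le_one.2 h1
  set B : Finset ℤ := {l ∈ Icc (-(N : ℤ)) N | |γ * l - round (γ * l)| < τ} with hB
  have hBc : (#B : ℝ) ≤ (2 * (1 / τ) + 1) * (2 * (γ * N + 1 / 2) + 1) := by
    set t : Finset ℤ := B.image fun l : ℤ => round (γ * l) with ht
    have htc : (#t : ℝ) ≤ 2 * (γ * N + 1 / 2) + 1 := by
      refine card_int_abs_sub_lt_le t 0 _ (by positivity) fun z hz => ?_
      rw [ht, mem_image] at hz
      obtain ⟨l, hl, rfl⟩ := hz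
      rw [hB, mem_filter, mem_Icc] at hl
      have hlN : |(l : ℝ)| ≤ N := abs_le.2 ⟨by exact_mod_cast hl.1.1, by exact_mod_cast hl.1.2⟩
      have e1 := abs_sub_round (γ * l)
      have e2 : |γ * l| ≤ γ * N := by
        rw [abs_mul, abs_of_pos h0]
        exact mul_le_mul_of_nonneg_left hlN h0.le
      rw [sub_zero]
      have := abs_sub_abs_le_abs_sub ((round (γ * l) : ℤ) : ℝ) (γ * l)
      rw [abs_sub_comm] at this
      linarith
    have hfib : ∀ m ∈ t, #(B.filter fun l : ℤ => round (γ * (l : ℝ)) = m) ≤ ⌊2 * (1 / τ) + 1⌋₊ := by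
      intro m _
      refine Nat.le_floor ?_
      refine card_int_abs_sub_lt_le _ (m / γ) _ (by positivity) fun z hz => ?_
      rw [mem_filter, hB, mem_filter] at hz
      obtain ⟨⟨-, hz1⟩, hz2⟩ := hz
      rw [hz2] at hz1
      have : (z : ℝ) - m / γ = (γ * z - m) / γ := by field_simp
      rw [this, abs_div, abs_of_pos h0, div_le_div_iff₀ h0 hτ0]
      nlinarith
    have := card_le_mul_card_image B ⌊2 * (1 / τ) + 1⌋₊ hfib
    calc (#B : ℝ) ≤ (⌊2 * (1 / τ) + 1⌋₊ : ℝ) * #t := by exact_mod_cast this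
      _ ≤ (2 * (1 / τ) + 1) * (2 * (γ * N + 1 / 2) + 1) := by
        gcongr
        exact Nat.floor_le (by positivity)
  have hsplit : linearAverage γ N ≤ #B * (N + 1 : ℝ) + (2 * N + 1) * (1 / (2 * τ)) := by
    have hpart := sum_filter_add_sum_filter_not (Icc (-(N : ℤ)) N)
      (fun l : ℤ => |γ * l - round (γ * l)| < τ)
      (fun l : ℤ => ‖∑ n ∈ range (N + 1), eu (n * (γ * l))‖)
    rw [linearAverage, ← hpart, ← hB]
    refine add_le_add ?_ ?_
    · calc _ ≤ ∑ _l ∈ B, ((N : ℝ) + 1) := by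
            refine sum_le_sum fun l _ => (norm_sum_eu_le_card _ _).trans ?_
            simp
        _ = _ := by rw [sum_const, nsmul_eq_mul]
    · calc _ ≤ ∑ _l ∈ Icc (-(N : ℤ)) N, 1 / (2 * τ) := by
            refine (sum_le_sum (g := fun _ => 1 / (2 * τ)) fun l hl => ?_).trans
              (sum_le_sum_of_subset_of_nonneg (filter_subset _ _) fun _ _ _ => by positivity)
            rw [mem_filter, not_lt] at hl
            refine (norm_sum_eu_le _ _ (hτ0.trans_le hl.2)).trans ?_
            gcongr
            exact hl.2
        _ = _ := by
            rw [sum_const, Int.card_Icc, nsmul_eq_mul]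
            rw [show ((N : ℤ) + 1 - -(N : ℤ)).toNat = 2 * N + 1 by omega]
            push_cast; ring
  have hinv : 1 ≤ 1 / τ := by rw [le_div_iff₀ hτ0]; linarith
  set u := 1 / τ with hu
  have huτ : u * τ = 1 := by rw [hu]; field_simp
  have e1 : 1 / (2 * τ) = u / 2 := by rw [hu]; field_simp
  have e2 : 1 / (N * τ) = u / N := by rw [hu]; field_simp
  rw [e2]
  have e3 : 20 * (N : ℝ) ^ 2 * (τ + u / N) = 20 * N ^ 2 * τ + 20 * N * u := by
    field_simp
  rw [e3]
  have hγu : γ * u = τ := by rw [← hτ2]; linear_combination τ * huτ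
  have h5 : (2 * u + 1) * (2 * (γ * N + 1 / 2) + 1) ≤ 3 * u * (2 * γ * N + 2) := by
    have : 0 ≤ 2 * γ * N + 2 := by positivity
    nlinarith
  have h6 : (#B : ℝ) ≤ 6 * τ * N + 6 * u := by
    refine (hBc.trans h5).trans (le_of_eq ?_)
    linear_combination (6 * N) * hγu
  have h7 : (#B : ℝ) * (N + 1) ≤ (6 * τ * N + 6 * u) * (2 * N) := by
    refine mul_le_mul h6 (by linarith) (by positivity) (by positivity)
  rw [e1] at hsplit
  have h8 : (2 * (N : ℝ) + 1) * (u / 2) ≤ 3 * N * (u / 2) := by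
    refine mul_le_mul_of_nonneg_right (by linarith) (by linarith)
  have h9 : 0 ≤ (N : ℝ) * u := by positivity
  have h10 : 0 ≤ (N : ℝ) ^ 2 * τ := by positivity
  nlinarith

theorem sum_Ico_int_eq_sum_range {β : Type*} [AddCommMonoid β] (M : ℕ) (f : ℤ → β) :
    ∑ n ∈ Ico (0 : ℤ) M, f n = ∑ n ∈ range M, f n := by
  symm
  refine sum_bij (fun n _ => (n : ℤ)) ?_ ?_ ?_ ?_
  · intro n hn
    rw [mem_range] at hn
    rw [mem_Ico]; omega
  · intro a _ b _ h
    exact_mod_cast h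
  · intro z hz
    rw [mem_Ico] at hz
    exact ⟨z.toNat, by rw [mem_range]; omega, by omega⟩
  · intro _ _; rfl

theorem exists_norm_one_mul_eq (z : ℂ) : ∃ c : ℂ, ‖c‖ = 1 ∧ c * z = ‖z‖ := by
  by_cases hz : z = 0
  · exact ⟨1, by simp, by simp [hz]⟩
  · have hn : (‖z‖ : ℂ) ≠ 0 := by exact_mod_cast norm_ne_zero_iff.2 hz
    refine ⟨(starRingEnd ℂ) z / ‖z‖, ?_, ?_⟩
    · rw [norm_div, Complex.norm_conj, Complex.norm_real, norm_norm, div_self (norm_ne_zero_iff.2 hz)]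
    · rw [div_mul_eq_mul_div, mul_comm, Complex.mul_conj', sq, mul_div_assoc, div_self hn, mul_one]

theorem pow_sum_le_card_pow_mul {ι : Type*} (S : Finset ι) (f : ι → ℝ) (hf : ∀ i ∈ S, 0 ≤ f i)
    (s : ℕ) (hs : 1 ≤ s) : (∑ i ∈ S, f i) ^ s ≤ (#S : ℝ) ^ (s - 1) * ∑ i ∈ S, f i ^ s := by
  obtain ⟨n, rfl⟩ : ∃ n, s = n + 1 := ⟨s - 1, by omega⟩
  rcases S.eq_empty_or_nonempty with rfl | hne
  · simp
  have h := pow_sum_div_card_le_sum_pow (s := S) (f := f) hf n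
  have hc : (0 : ℝ) < #S := by exact_mod_cast hne.card_pos
  rw [div_le_iff₀ (by positivity)] at h
  rw [Nat.add_sub_cancel]
  linarith

theorem sum_pow_eu {k s : ℕ} (I : Finset ℤ) (w : ℤ → ℂ) (g : Fin k → ℝ) :
    (∑ b ∈ I, w b * eu (∑ j, g j * momentCurve k b j)) ^ s =
      ∑ y ∈ Fintype.piFinset fun _ : Fin s => I,
        (∏ i, w (y i)) * eu (∑ j, g j * moments k y j) := by
  have h := Finset.prod_univ_sum (fun _ : Fin s => I)
    (fun _ b => w b * eu (∑ j, g j * momentCurve k b j))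
  rw [prod_const, card_univ, Fintype.card_fin] at h
  rw [h]
  refine sum_congr rfl fun y _ => ?_
  rw [prod_mul_distrib, ← eu_sum]
  congr 2
  rw [sum_comm]
  refine sum_congr rfl fun j _ => ?_
  rw [moments, Finset.sum_apply, ← mul_sum]
  push_cast
  rfl

theorem card_moments_sub_le (k s M : ℕ) (l : Fin k → ℤ) :
    #{q ∈ (Fintype.piFinset fun _ : Fin s => Ico (0 : ℤ) M) ×ˢ
      (Fintype.piFinset fun _ : Fin s => Ico (0 : ℤ) M) |
        moments k q.1 - moments k q.2 = l} ≤ vinogradov k s M := by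
  classical
  have h2 := two_mul_card_pairs_le (moments k : (Fin s → ℤ) → Fin k → ℤ)
    (fun u : Fin s → ℤ => moments k u + l) (Fintype.piFinset fun _ => Ico (0 : ℤ) M)
  have h3 : energy (fun u : Fin s → ℤ => moments k u + l)
      (Fintype.piFinset fun _ => Ico (0 : ℤ) M) = vinogradov k s M := by
    simp only [energy, add_left_inj, vinogradov]
  have h4 : energy (moments k : (Fin s → ℤ) → Fin k → ℤ)
      (Fintype.piFinset fun _ => Ico (0 : ℤ) M) = vinogradov k s M := rfl
  rw [h3, h4] at h2
  have h5 : #{q ∈ (Fintype.piFinset fun _ : Fin s => Ico (0 : ℤ) M) ×ˢ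
      (Fintype.piFinset fun _ : Fin s => Ico (0 : ℤ) M) | moments k q.1 - moments k q.2 = l} =
      #{q ∈ (Fintype.piFinset fun _ : Fin s => Ico (0 : ℤ) M) ×ˢ
      (Fintype.piFinset fun _ : Fin s => Ico (0 : ℤ) M) |
        moments k q.1 = moments k q.2 + l} := by
    congr 1
    refine filter_congr fun q _ => ?_
    rw [sub_eq_iff_eq_add, add_comm]
  rw [h5]
  omega

theorem moments_mem_box {k s M : ℕ} (y : Fin s → ℤ)
    (hy : y ∈ Fintype.piFinset fun _ : Fin s => Ico (0 : ℤ) M) (j : Fin k) :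
    0 ≤ moments k y j ∧ moments k y j ≤ ((s * M ^ (j.1 + 1) : ℕ) : ℤ) := by
  rw [Fintype.mem_piFinset] at hy
  rw [moments_apply]
  constructor
  · exact sum_nonneg fun i _ => pow_nonneg (mem_Ico.1 (hy i)).1 _
  · calc ∑ i, y i ^ (j.1 + 1) ≤ ∑ _i : Fin s, (M : ℤ) ^ (j.1 + 1) := by
          refine sum_le_sum fun i _ => ?_
          exact pow_le_pow_left₀ (mem_Ico.1 (hy i)).1 (mem_Ico.1 (hy i)).2.le _
      _ = _ := by simp

theorem sum_box_norm_pow_le (k s M : ℕ) (c : ℤ → ℂ) (hc : ∀ a, ‖c a‖ = 1) (γ : Fin k → ℝ) :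
    ∑ n ∈ Fintype.piFinset fun j : Fin k => Ico (0 : ℤ) ((s * M ^ (j.1 + 1) + 1 : ℕ) : ℤ),
      ‖∑ a ∈ Ico (0 : ℤ) M, c a * eu (∑ j, (γ j * n j) * momentCurve k a j)‖ ^ (2 * s) ≤
    vinogradov k s M * ∏ j : Fin k, linearAverage (γ j) (s * M ^ (j.1 + 1)) := by
  classical
  set P : Finset (Fin s → ℤ) := Fintype.piFinset fun _ : Fin s => Ico (0 : ℤ) M with hP
  set Box : Finset (Fin k → ℤ) :=
    Fintype.piFinset fun j : Fin k => Ico (0 : ℤ) ((s * M ^ (j.1 + 1) + 1 : ℕ) : ℤ) with hBox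
  set g : (Fin k → ℤ) → ℝ := fun l =>
    ∏ j : Fin k, ‖∑ n ∈ range (s * M ^ (j.1 + 1) + 1), eu (n * (γ j * l j))‖ with hg
  have hg0 : ∀ l, 0 ≤ g l := fun l => prod_nonneg fun _ _ => norm_nonneg _
  have hC : ∀ x : Fin s → ℤ, ‖∏ i, c (x i)‖ = 1 := fun x => by simp [norm_prod, hc]
  have hexp : ∀ n ∈ Box,
      ((‖∑ a ∈ Ico (0 : ℤ) M, c a * eu (∑ j, (γ j * n j) * momentCurve k a j)‖ ^ (2 * s) : ℝ) : ℂ) =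
      ∑ q ∈ P ×ˢ P, ((∏ i, c (q.1 i)) * (starRingEnd ℂ) (∏ i, c (q.2 i))) *
        eu (∑ j, n j * (γ j * ((moments k q.1 - moments k q.2) j : ℤ))) := by
    intro n _
    rw [mul_comm 2 s, pow_mul, ← norm_pow, sum_pow_eu]
    push_cast
    rw [← Complex.mul_conj', map_sum, sum_mul_sum, sum_product]
    refine sum_congr rfl fun x _ => sum_congr rfl fun y _ => ?_
    rw [map_mul, conj_eu, mul_mul_mul_comm, ← eu_add]
    congr 2
    rw [← sum_neg_distrib, ← sum_add_distrib]
    refine sum_congr rfl fun j _ => ?_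
    simp only [Pi.sub_apply]
    push_cast
    ring
  have hsum : ((∑ n ∈ Box,
      ‖∑ a ∈ Ico (0 : ℤ) M, c a * eu (∑ j, (γ j * n j) * momentCurve k a j)‖ ^ (2 * s) : ℝ) : ℂ) =
      ∑ q ∈ P ×ˢ P, ((∏ i, c (q.1 i)) * (starRingEnd ℂ) (∏ i, c (q.2 i))) *
        ∏ j, ∑ n ∈ range (s * M ^ (j.1 + 1) + 1),
          eu (n * (γ j * ((moments k q.1 - moments k q.2) j : ℤ))) := by
    rw [Complex.ofReal_sum, sum_congr rfl hexp, sum_comm]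
    refine sum_congr rfl fun q _ => ?_
    rw [← mul_sum]
    congr 1
    simp only [eu_sum]
    rw [hBox, ← Finset.prod_univ_sum (fun j : Fin k => Ico (0 : ℤ) ((s * M ^ (j.1 + 1) + 1 : ℕ) : ℤ))
      (fun j n => eu (n * (γ j * ((moments k q.1 - moments k q.2) j : ℤ))))]
    refine prod_congr rfl fun j _ => ?_
    rw [sum_Ico_int_eq_sum_range]
    simp
  have hle : ∑ n ∈ Box,
      ‖∑ a ∈ Ico (0 : ℤ) M, c a * eu (∑ j, (γ j * n j) * momentCurve k a j)‖ ^ (2 * s) ≤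
      ∑ q ∈ P ×ˢ P, g (moments k q.1 - moments k q.2) := by
    have h1 := congrArg norm hsum
    rw [Complex.norm_real, Real.norm_of_nonneg (sum_nonneg fun _ _ => by positivity)] at h1
    rw [h1]
    refine (norm_sum_le _ _).trans (sum_le_sum fun q _ => ?_)
    rw [norm_mul, norm_mul, Complex.norm_conj, hC, hC, one_mul, one_mul, norm_prod]
  set Box' : Finset (Fin k → ℤ) := Fintype.piFinset fun j : Fin k =>
    Icc (-((s * M ^ (j.1 + 1) : ℕ) : ℤ)) ((s * M ^ (j.1 + 1) : ℕ) : ℤ) with hBox'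
  refine hle.trans ?_
  rw [← sum_fiberwise_of_maps_to (s := P ×ˢ P) (t := Box')
    (g := fun q => moments k q.1 - moments k q.2)]
  · calc _ ≤ ∑ l ∈ Box', (vinogradov k s M : ℝ) * g l := by
          refine sum_le_sum fun l _ => ?_
          rw [sum_congr rfl (g := fun _ => g l) fun q hq => by rw [(mem_filter.1 hq).2]]
          rw [sum_const, nsmul_eq_mul]
          refine mul_le_mul_of_nonneg_right ?_ (hg0 l)
          exact_mod_cast card_moments_sub_le k s M l
      _ = _ := by
          rw [← mul_sum]
          congr 1
          rw [hBox', hg]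
          dsimp only
          rw [← Finset.prod_univ_sum (fun j : Fin k =>
            Icc (-((s * M ^ (j.1 + 1) : ℕ) : ℤ)) ((s * M ^ (j.1 + 1) : ℕ) : ℤ))
            (fun j l => ‖∑ n ∈ range (s * M ^ (j.1 + 1) + 1), eu (n * (γ j * l))‖)]
          rfl
  · intro q hq
    rw [mem_product] at hq
    rw [hBox', Fintype.mem_piFinset]
    intro j
    have h1 := moments_mem_box (k := k) q.1 hq.1 j
    have h2 := moments_mem_box (k := k) q.2 hq.2 j
    rw [mem_Icc, Pi.sub_apply]
    constructor <;> linarith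

theorem norm_bilinear_pow_le (k s M : ℕ) (hs : 1 ≤ s) (γ : Fin k → ℝ) :
    ‖∑ a ∈ range M, ∑ b ∈ range M, eu (∑ j : Fin k, γ j * ((a : ℝ) * b) ^ (j.1 + 1))‖ ^ (2 * s ^ 2) ≤
      (M : ℝ) ^ (4 * s * (s - 1)) * (vinogradov k s M : ℝ) ^ 2 *
        ∏ j : Fin k, linearAverage (γ j) (s * M ^ (j.1 + 1)) := by
  classical
  set P : Finset (Fin s → ℤ) := Fintype.piFinset fun _ : Fin s => Ico (0 : ℤ) M with hP
  have hPc : (#P : ℝ) = (M : ℝ) ^ s := by simp [hP, Fintype.card_piFinset]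
  set Box : Finset (Fin k → ℤ) :=
    Fintype.piFinset fun j : Fin k => Ico (0 : ℤ) ((s * M ^ (j.1 + 1) + 1 : ℕ) : ℤ) with hBox
  have hmaps : ∀ y ∈ P, moments k y ∈ Box := by
    intro y hy
    rw [hBox, Fintype.mem_piFinset]
    intro j
    have := moments_mem_box (k := k) y hy j
    rw [mem_Ico]
    push_cast at this ⊢
    constructor <;> linarith
  set S : ℤ → ℂ := fun a => ∑ b ∈ Ico (0 : ℤ) M,
    1 * eu (∑ j, (γ j * momentCurve k a j) * momentCurve k b j) with hS
  have hU : ∑ a ∈ range M, ∑ b ∈ range M, eu (∑ j : Fin k, γ j * ((a : ℝ) * b) ^ (j.1 + 1)) =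
      ∑ a ∈ Ico (0 : ℤ) M, S a := by
    rw [sum_Ico_int_eq_sum_range]
    refine sum_congr rfl fun a _ => ?_
    rw [hS]
    dsimp only
    rw [sum_Ico_int_eq_sum_range]
    refine sum_congr rfl fun b _ => ?_
    rw [one_mul]
    congr 1
    refine sum_congr rfl fun j _ => ?_
    simp only [momentCurve]
    push_cast
    ring
  rw [hU]
  choose c hc1 hc2 using fun a : ℤ => exists_norm_one_mul_eq (S a ^ s)
  set B : (Fin k → ℤ) → ℝ := fun n =>
    ‖∑ a ∈ Ico (0 : ℤ) M, c a * eu (∑ j, (γ j * n j) * momentCurve k a j)‖ with hB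
  have hB0 : ∀ n, 0 ≤ B n := fun n => norm_nonneg _
  have h1 : ∑ a ∈ Ico (0 : ℤ) M, ‖S a‖ ^ s ≤ ∑ y ∈ P, B (moments k y) := by
    have e : ((∑ a ∈ Ico (0 : ℤ) M, ‖S a‖ ^ s : ℝ) : ℂ) =
        ∑ y ∈ P, ∑ a ∈ Ico (0 : ℤ) M, c a * eu (∑ j, (γ j * moments k y j) * momentCurve k a j) := by
      rw [sum_comm, Complex.ofReal_sum]
      refine sum_congr rfl fun a _ => ?_
      rw [← norm_pow, ← hc2, ← mul_sum]
      congr 1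
      rw [hS]
      dsimp only
      rw [sum_pow_eu]
      refine sum_congr rfl fun y _ => ?_
      rw [prod_const_one, one_mul]
      congr 1
      exact sum_congr rfl fun j _ => by ring
    have e2 := congrArg norm e
    rw [Complex.norm_real, Real.norm_of_nonneg (sum_nonneg fun _ _ => by positivity)] at e2
    rw [e2]
    exact norm_sum_le _ _
  have h2 : (∑ y ∈ P, B (moments k y) ^ s) ^ 2 ≤ (vinogradov k s M : ℝ) *
      (vinogradov k s M * ∏ j : Fin k, linearAverage (γ j) (s * M ^ (j.1 + 1))) := by
    have e : ∑ y ∈ P, B (moments k y) ^ s =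
        ∑ n ∈ Box, (#{y ∈ P | moments k y = n} : ℝ) * B n ^ s := by
      rw [← sum_fiberwise_of_maps_to hmaps]
      refine sum_congr rfl fun n _ => ?_
      rw [sum_congr rfl (g := fun _ => B n ^ s) fun q hq => by rw [(mem_filter.1 hq).2]]
      rw [sum_const, nsmul_eq_mul]
    rw [e]
    refine (sum_mul_sq_le_sq_mul_sq _ _ _).trans ?_
    have e3 : ∑ n ∈ Box, (#{y ∈ P | moments k y = n} : ℝ) ^ 2 = vinogradov k s M := by
      rw [vinogradov, energy_eq_sum _ _ Box hmaps]
      push_cast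
      rfl
    rw [e3]
    refine mul_le_mul_of_nonneg_left ?_ (Nat.cast_nonneg _)
    refine le_trans (le_of_eq ?_) (sum_box_norm_pow_le k s M c hc1 γ)
    refine sum_congr rfl fun n _ => ?_
    rw [← pow_mul, mul_comm s 2]
  have hM0 : (0 : ℝ) ≤ M := Nat.cast_nonneg _
  have hIc : (#(Ico (0 : ℤ) M) : ℝ) = M := by simp
  have h3 : ‖∑ a ∈ Ico (0 : ℤ) M, S a‖ ^ s ≤ (M : ℝ) ^ (s - 1) * ∑ y ∈ P, B (moments k y) := by
    calc _ ≤ (∑ a ∈ Ico (0 : ℤ) M, ‖S a‖) ^ s :=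
          pow_le_pow_left₀ (norm_nonneg _) (norm_sum_le _ _) _
      _ ≤ (M : ℝ) ^ (s - 1) * ∑ a ∈ Ico (0 : ℤ) M, ‖S a‖ ^ s := by
          have := pow_sum_le_card_pow_mul (Ico (0 : ℤ) M) (fun a => ‖S a‖)
            (fun _ _ => norm_nonneg _) s hs
          rwa [hIc] at this
      _ ≤ _ := mul_le_mul_of_nonneg_left h1 (by positivity)
  have h4 : (∑ y ∈ P, B (moments k y)) ^ s ≤ ((M : ℝ) ^ s) ^ (s - 1) *
      ∑ y ∈ P, B (moments k y) ^ s := by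
    have := pow_sum_le_card_pow_mul P (fun y => B (moments k y)) (fun _ _ => hB0 _) s hs
    rwa [hPc] at this
  have hY0 : 0 ≤ ∑ y ∈ P, B (moments k y) := sum_nonneg fun _ _ => hB0 _
  have hsm : s * (s - 1) + s * (s - 1) + (s * (s - 1) + s * (s - 1)) = 4 * s * (s - 1) := by ring
  calc ‖∑ a ∈ Ico (0 : ℤ) M, S a‖ ^ (2 * s ^ 2)
      = ((‖∑ a ∈ Ico (0 : ℤ) M, S a‖ ^ s) ^ s) ^ 2 := by
        rw [← pow_mul, ← pow_mul]; congr 1; ring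
    _ ≤ (((M : ℝ) ^ (s - 1) * ∑ y ∈ P, B (moments k y)) ^ s) ^ 2 := by
        gcongr
    _ = (((M : ℝ) ^ (s - 1)) ^ s * (∑ y ∈ P, B (moments k y)) ^ s) ^ 2 := by rw [mul_pow]
    _ ≤ (((M : ℝ) ^ (s - 1)) ^ s * (((M : ℝ) ^ s) ^ (s - 1) *
      ∑ y ∈ P, B (moments k y) ^ s)) ^ 2 := by
        gcongr
    _ = (M : ℝ) ^ (4 * s * (s - 1)) * (∑ y ∈ P, B (moments k y) ^ s) ^ 2 := by
        rw [mul_pow, mul_pow, ← pow_mul, ← pow_mul, ← pow_mul, ← pow_mul, ← mul_assoc, ← pow_add]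
        congr 2
        rw [← hsm]; ring
    _ ≤ (M : ℝ) ^ (4 * s * (s - 1)) * ((vinogradov k s M : ℝ) *
      (vinogradov k s M * ∏ j : Fin k, linearAverage (γ j) (s * M ^ (j.1 + 1)))) := by
        gcongr
    _ = _ := by ring

theorem norm_eu_sub_eu_le (x y : ℝ) : ‖eu x - eu y‖ ≤ 2 * Real.pi * |x - y| := by
  have h1 : eu x = eu y * eu (x - y) := by rw [← eu_add]; ring_nf
  have h2 : ‖eu (x - y) - 1‖ ≤ |2 * Real.pi * (x - y)| := by
    have := Real.norm_exp_I_mul_ofReal_sub_one_le (x := 2 * Real.pi * (x - y))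
    rw [Real.norm_eq_abs] at this
    rw [eu, mul_comm]
    exact this
  calc ‖eu x - eu y‖ = ‖eu y * (eu (x - y) - 1)‖ := by rw [h1]; ring_nf
    _ = ‖eu (x - y) - 1‖ := by rw [norm_mul, norm_eu, one_mul]
    _ ≤ _ := h2
    _ = _ := by rw [abs_mul, abs_of_pos (by positivity)]

/-- Shifting the summation range by `h` changes a sum of unimodular terms by at most `2 * h`. -/
theorem norm_sum_shift_sub_le (F : ℕ → ℂ) (hF : ∀ n, ‖F n‖ ≤ 1) (A B h : ℕ) (hAB : A ≤ B) :
    ‖∑ q ∈ Ioc A B, F q - ∑ q ∈ Ioc A B, F (q + h)‖ ≤ 2 * h := by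
  have h1 : ∑ q ∈ Ioc A B, F (q + h) = ∑ q ∈ Ioc (A + h) (B + h), F q := by
    rw [← Finset.map_add_right_Ioc, sum_map]
    rfl
  have h2 := sum_Ioc_consecutive F hAB (Nat.le_add_right B h)
  have h3 := sum_Ioc_consecutive F (Nat.le_add_right A h) (by omega : A + h ≤ B + h)
  have h4 : ∀ N, ‖∑ q ∈ Ioc N (N + h), F q‖ ≤ h := fun N => by
    refine (norm_sum_le_of_le _ fun q _ => hF q).trans ?_
    simp
  have h5 : ∑ q ∈ Ioc A B, F q - ∑ q ∈ Ioc A B, F (q + h) =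
      ∑ q ∈ Ioc A (A + h), F q - ∑ q ∈ Ioc B (B + h), F q := by
    rw [h1]
    linear_combination h2 - h3
  rw [h5]
  linarith [norm_sub_le (∑ q ∈ Ioc A (A + h), F q) (∑ q ∈ Ioc B (B + h), F q), h4 A, h4 B]

theorem norm_sum_mul_sq_le (F : ℕ → ℂ) (hF : ∀ n, ‖F n‖ ≤ 1) (A B M : ℕ) (hAB : A ≤ B) :
    ‖∑ q ∈ Ioc A B, F q‖ * (M : ℝ) ^ 2 ≤
      ∑ q ∈ Ioc A B, ‖∑ a ∈ range M, ∑ b ∈ range M, F (q + a * b)‖ + 2 * (M : ℝ) ^ 4 := by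
  have h1 : (∑ q ∈ Ioc A B, F q) * (M : ℂ) ^ 2 =
      ∑ q ∈ Ioc A B, ∑ a ∈ range M, ∑ b ∈ range M, F (q + a * b) +
      ∑ a ∈ range M, ∑ b ∈ range M,
        (∑ q ∈ Ioc A B, F q - ∑ q ∈ Ioc A B, F (q + a * b)) := by
    have h2 : ∑ q ∈ Ioc A B, ∑ a ∈ range M, ∑ b ∈ range M, F (q + a * b) =
        ∑ a ∈ range M, ∑ b ∈ range M, ∑ q ∈ Ioc A B, F (q + a * b) := by
      rw [sum_comm]
      refine sum_congr rfl fun a _ => ?_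
      rw [sum_comm]
    rw [h2]
    simp only [sum_sub_distrib, sum_const, card_range, nsmul_eq_mul]
    ring
  have h3 : ‖∑ a ∈ range M, ∑ b ∈ range M,
      (∑ q ∈ Ioc A B, F q - ∑ q ∈ Ioc A B, F (q + a * b))‖ ≤ 2 * (M : ℝ) ^ 4 := by
    have h4 : ∀ a ∈ range M, ∀ b ∈ range M,
        ‖∑ q ∈ Ioc A B, F q - ∑ q ∈ Ioc A B, F (q + a * b)‖ ≤ 2 * (M : ℝ) ^ 2 := by
      intro a ha b hb
      refine (norm_sum_shift_sub_le F hF A B (a * b) hAB).trans ?_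
      push_cast
      have ha : (a : ℝ) ≤ M := by exact_mod_cast (mem_range.1 ha).le
      have hb : (b : ℝ) ≤ M := by exact_mod_cast (mem_range.1 hb).le
      nlinarith [mul_le_mul ha hb (by positivity) (by positivity)]
    refine (norm_sum_le_of_le _ fun a ha => norm_sum_le_of_le _ fun b hb => h4 a ha b hb).trans ?_
    simp only [sum_const, card_range, nsmul_eq_mul]
    exact le_of_eq (by ring)
  calc ‖∑ q ∈ Ioc A B, F q‖ * (M : ℝ) ^ 2 = ‖(∑ q ∈ Ioc A B, F q) * (M : ℂ) ^ 2‖ := by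
        simp
    _ ≤ _ := by
      rw [h1]
      exact (norm_add_le _ _).trans (add_le_add (norm_sum_le _ _) h3)

/-- The Taylor expansion of `y / (q + h)` with exact remainder. -/
theorem div_add_eq_taylor (y q h : ℝ) (hq : 0 < q) (hh : 0 ≤ h) (k : ℕ) :
    y / (q + h) = y / q + ∑ j : Fin k, ((-1) ^ (j.1 + 1) * y / q ^ (j.1 + 2)) * h ^ (j.1 + 1) +
      (-(h / q)) ^ (k + 1) * (y / (q + h)) := by
  rw [Fin.sum_univ_eq_sum_range (fun j => ((-1) ^ (j + 1) * y / q ^ (j + 2)) * h ^ (j + 1))]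
  induction k with
  | zero =>
    have : q + h ≠ 0 := by positivity
    have hq' := hq.ne'
    simp only [range_zero, sum_empty, zero_add, pow_one]
    field_simp
    ring
  | succ k ih =>
    rw [sum_range_succ]
    have : q + h ≠ 0 := by positivity
    have h2 : (-(h / q)) ^ (k + 1) * (y / (q + h)) =
        ((-1) ^ (k + 1) * y / q ^ (k + 2)) * h ^ (k + 1) +
          (-(h / q)) ^ (k + 1 + 1) * (y / (q + h)) := by
      rw [neg_pow (h / q) (k + 1), neg_pow (h / q) (k + 1 + 1), div_pow, div_pow]
      field_simp
      ring
    rw [h2] at ih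
    linarith

theorem norm_sum_eu_shift_le (k M q : ℕ) (y : ℝ) (hq : 0 < q) (hy : 0 ≤ y) :
    ‖∑ a ∈ range M, ∑ b ∈ range M, eu (y / ((q + a * b : ℕ) : ℝ))‖ ≤
      ‖∑ a ∈ range M, ∑ b ∈ range M, eu (∑ j : Fin k,
        ((-1) ^ (j.1 + 1) * y / (q : ℝ) ^ (j.1 + 2)) * ((a : ℝ) * b) ^ (j.1 + 1))‖ +
      (M : ℝ) ^ 2 * (2 * Real.pi * (((M : ℝ) ^ 2 / q) ^ (k + 1) * (y / q))) := by
  have hq' : (0 : ℝ) < q := by exact_mod_cast hq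
  set G : ℕ → ℕ → ℝ := fun a b => ∑ j : Fin k,
        ((-1) ^ (j.1 + 1) * y / (q : ℝ) ^ (j.1 + 2)) * ((a : ℝ) * b) ^ (j.1 + 1) with hG
  have h1 : ‖∑ a ∈ range M, ∑ b ∈ range M, eu (G a b)‖ =
      ‖∑ a ∈ range M, ∑ b ∈ range M, eu (y / q + G a b)‖ := by
    simp only [eu_add, ← mul_sum, norm_mul, norm_eu, one_mul]
  rw [h1]
  have h2 : ∀ a ∈ range M, ∀ b ∈ range M,
      ‖eu (y / ((q + a * b : ℕ) : ℝ)) - eu (y / q + G a b)‖ ≤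
        2 * Real.pi * (((M : ℝ) ^ 2 / q) ^ (k + 1) * (y / q)) := by
    intro a ha b hb
    have ha : (a : ℝ) ≤ M := by exact_mod_cast (mem_range.1 ha).le
    have hb : (b : ℝ) ≤ M := by exact_mod_cast (mem_range.1 hb).le
    refine (norm_eu_sub_eu_le _ _).trans ?_
    refine mul_le_mul_of_nonneg_left ?_ (by positivity)
    have h3 := div_add_eq_taylor y q ((a : ℝ) * b) hq' (by positivity) k
    have h4 : y / ((q + a * b : ℕ) : ℝ) - (y / q + G a b) =
        (-((a : ℝ) * b / q)) ^ (k + 1) * (y / (q + a * b)) := by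
      push_cast
      simp only [hG]
      linarith
    rw [h4, abs_mul, abs_pow, abs_neg, abs_of_nonneg (by positivity),
      abs_of_nonneg (by positivity)]
    have h5 : (a : ℝ) * b ≤ (M : ℝ) ^ 2 := by
      nlinarith [mul_le_mul ha hb (by positivity) (by positivity)]
    have h6 : (q : ℝ) ≤ q + a * b := by
      have : (0 : ℝ) ≤ a * b := by positivity
      linarith
    gcongr
  have h7 : ‖∑ a ∈ range M, ∑ b ∈ range M, (eu (y / ((q + a * b : ℕ) : ℝ)) -
      eu (y / q + G a b))‖ ≤ (M : ℝ) ^ 2 * (2 * Real.pi * (((M : ℝ) ^ 2 / q) ^ (k + 1) * (y / q))) := by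
    refine (norm_sum_le_of_le _ fun a ha => norm_sum_le_of_le _ fun b hb => h2 a ha b hb).trans ?_
    simp only [sum_const, card_range, nsmul_eq_mul]
    exact le_of_eq (by ring)
  simp only [sum_sub_distrib] at h7
  have h8 := norm_sub_norm_le (∑ a ∈ range M, ∑ b ∈ range M, eu (y / ((q + a * b : ℕ) : ℝ)))
    (∑ a ∈ range M, ∑ b ∈ range M, eu (y / q + G a b))
  linarith

theorem sqrt_add_inv_le_exp {w j a N s p q : ℕ} {y l P : ℝ} (hw : 1 ≤ w)
    (hj1 : 2 * w ≤ j + 1) (hj2 : j + 1 < 3 * w) (hl : 0 ≤ l) (hs : 1 ≤ s) (hp : 0 < p)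
    (hN : N = s * (p ^ a) ^ (j + 1)) (hP : P = Real.log p)
    (hPa : 23 * l / 48 ≤ a * (P + 1)) (hq1 : Real.exp l ≤ q) (hq2 : (q : ℝ) ≤ Real.exp (l + 1))
    (hy1 : Real.exp ((1 + w / 4) * l) ≤ y) (hy2 : y ≤ Real.exp (w * l)) :
    0 < y / (q : ℝ) ^ (j + 2) ∧ y / (q : ℝ) ^ (j + 2) ≤ 1 ∧
      √(y / (q : ℝ) ^ (j + 2)) + 1 / (N * √(y / (q : ℝ) ^ (j + 2))) ≤
        Real.exp (1 + 3 * w * (a + 1) - w * l / 16) := by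
  have hy0 : 0 < y := (Real.exp_pos _).trans_le hy1
  have hq0 : (0 : ℝ) < q := (Real.exp_pos _).trans_le hq1
  have hw' : (1 : ℝ) ≤ w := by exact_mod_cast hw
  have hj1' : 2 * (w : ℝ) ≤ j + 1 := by exact_mod_cast hj1
  have hj2' : (j : ℝ) + 2 ≤ 3 * w := by exact_mod_cast (by omega : j + 2 ≤ 3 * w)
  set γ := y / (q : ℝ) ^ (j + 2) with hγ
  have hγ0 : 0 < γ := by positivity
  set x := Real.log γ with hx
  have hx' : x = Real.log y - (j + 2) * Real.log q := by
    rw [hx, hγ, Real.log_div hy0.ne' (by positivity), Real.log_pow]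
    push_cast
    ring
  have ly1 : (1 + w / 4) * l ≤ Real.log y := (Real.le_log_iff_exp_le hy0).2 hy1
  have ly2 : Real.log y ≤ w * l := (Real.log_le_iff_le_exp hy0).2 hy2
  have lq1 : l ≤ Real.log q := (Real.le_log_iff_exp_le hq0).2 hq1
  have lq2 : Real.log q ≤ l + 1 := (Real.log_le_iff_le_exp hq0).2 hq2
  have hx1 : x ≤ -(w * l) := by
    have : (2 * (w : ℝ)) * l ≤ (j + 2) * Real.log q :=
      mul_le_mul (by linarith) lq1 hl (by linarith)
    rw [hx']
    nlinarith
  have hx2 : (1 + w / 4) * l - (j + 2) * (l + 1) ≤ x := by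
    have : ((j : ℝ) + 2) * Real.log q ≤ (j + 2) * (l + 1) :=
      mul_le_mul_of_nonneg_left lq2 (by positivity)
    rw [hx']
    linarith
  have hγe : γ = Real.exp x := (Real.exp_log hγ0).symm
  have hsq : √γ = Real.exp (x / 2) := by
    rw [hγe, Real.sqrt_eq_rpow, ← Real.exp_mul]
    ring_nf
  refine ⟨hγ0, ?_, ?_⟩
  · rw [hγe, Real.exp_le_one_iff]
    have : 0 ≤ w * l := by positivity
    linarith
  have hNx : Real.exp ((j + 1) * (a * P)) ≤ N := by
    have h1 : Real.exp ((j + 1) * (a * P)) = ((p : ℝ) ^ a) ^ (j + 1) := by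
      rw [hP, ← Real.log_pow, ← Nat.cast_succ, ← Real.log_pow, Real.exp_log (by positivity)]
    rw [h1, hN]
    push_cast
    have : (1 : ℝ) ≤ s := by exact_mod_cast hs
    nlinarith [show (0 : ℝ) ≤ ((p : ℝ) ^ a) ^ (j + 1) by positivity]
  have h2 : 1 / (N * √γ) ≤ Real.exp (3 * w * (a + 1) - w * l / 16) := by
    have h3 : Real.exp ((j + 1) * (a * P) + x / 2) ≤ N * √γ := by
      rw [Real.exp_add, hsq]
      exact mul_le_mul_of_nonneg_right hNx (Real.exp_pos _).le
    calc 1 / (N * √γ) ≤ 1 / Real.exp ((j + 1) * (a * P) + x / 2) :=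
          one_div_le_one_div_of_le (Real.exp_pos _) h3
      _ = Real.exp (-((j + 1) * (a * P) + x / 2)) := by rw [Real.exp_neg, one_div]
      _ ≤ _ := by
        apply Real.exp_le_exp.2
        have h4 : ((j : ℝ) + 1) * (23 * l / 48) ≤ (j + 1) * (a * (P + 1)) :=
          mul_le_mul_of_nonneg_left hPa (by positivity)
        have h5 : ((j : ℝ) + 1) * a ≤ 3 * w * a :=
          mul_le_mul_of_nonneg_right (by linarith) (by positivity)
        have h6 : ((j : ℝ) + 1) * l ≤ 3 * w * l :=
          mul_le_mul_of_nonneg_right (by linarith) hl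
        nlinarith
  have h3 : √γ ≤ Real.exp (3 * w * (a + 1) - w * l / 16) := by
    rw [hsq]
    apply Real.exp_le_exp.2
    have : 0 ≤ w * l := by positivity
    have : (0 : ℝ) ≤ 3 * w * (a + 1) := by positivity
    linarith
  have h4 : Real.exp (1 + 3 * w * (a + 1) - w * l / 16) =
      Real.exp 1 * Real.exp (3 * w * (a + 1) - w * l / 16) := by
    rw [← Real.exp_add]
    ring_nf
  rw [h4]
  have h5 : (2 : ℝ) ≤ Real.exp 1 := by
    have := Real.add_one_le_exp (1 : ℝ)
    linarith
  nlinarith [Real.exp_pos (3 * w * (a + 1) - w * l / 16)]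

theorem prod_linearAverage_le {w k a s p q : ℕ} {y l P : ℝ} (hw : 1 ≤ w) (hk : 3 * w ≤ k)
    (hl : 0 ≤ l) (hs : 1 ≤ s) (hp : 0 < p) (hP : P = Real.log p)
    (hPa : 23 * l / 48 ≤ a * (P + 1)) (hq1 : Real.exp l ≤ q) (hq2 : (q : ℝ) ≤ Real.exp (l + 1))
    (hy1 : Real.exp ((1 + w / 4) * l) ≤ y) (hy2 : y ≤ Real.exp (w * l)) :
    ∏ j : Fin k, linearAverage ((-1) ^ (j.1 + 1) * y / (q : ℝ) ^ (j.1 + 2))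
        (s * (p ^ a) ^ (j.1 + 1)) ≤
      Real.exp (3 * k + 2 * k * Real.log s + k * (k + 1) * (a * P) +
        w * (1 + 3 * w * (a + 1) - w * l / 16)) := by
  set lam := 1 + 3 * w * (a + 1) - w * l / 16 with hlam
  set g : ℕ → ℝ := fun j => if j ∈ Ico (2 * w - 1) (3 * w - 1) then lam else 0 with hg
  have he3 : (20 : ℝ) ≤ Real.exp 3 := by
    have h1 := Real.exp_one_gt_d9
    have : Real.exp 3 = Real.exp 1 ^ 3 := by rw [← Real.exp_nat_mul]; norm_num
    rw [this]
    calc (20 : ℝ) ≤ 2.718 ^ 3 := by norm_num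
      _ ≤ _ := by gcongr; linarith
  have h1 : ∀ j : Fin k, linearAverage ((-1) ^ (j.1 + 1) * y / (q : ℝ) ^ (j.1 + 2))
        (s * (p ^ a) ^ (j.1 + 1)) ≤
      Real.exp (3 + 2 * Real.log s + 2 * (j.1 + 1) * (a * P) + g j.1) := by
    intro j
    set N := s * (p ^ a) ^ (j.1 + 1) with hN
    have hN1 : 1 ≤ N := Nat.mul_pos hs (by positivity)
    have hs0 : (0 : ℝ) < s := by exact_mod_cast hs
    have hN2 : (N : ℝ) ^ 2 = Real.exp (2 * Real.log s + 2 * (j.1 + 1) * (a * P)) := by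
      have : (N : ℝ) = Real.exp (Real.log s + (j.1 + 1) * (a * P)) := by
        rw [Real.exp_add, Real.exp_log hs0, hP, ← Real.log_pow, ← Nat.cast_succ, ← Real.log_pow,
          Real.exp_log (by positivity), hN, Nat.succ_eq_add_one]
        push_cast
        ring
      rw [this, ← Real.exp_nat_mul]
      congr 1
      push_cast
      ring
    have h3 : linearAverage ((-1) ^ (j.1 + 1) * y / (q : ℝ) ^ (j.1 + 2)) N =
        linearAverage (y / (q : ℝ) ^ (j.1 + 2)) N := by
      rcases neg_one_pow_eq_or ℝ (j.1 + 1) with h | h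
      · rw [h, one_mul]
      · rw [h, neg_one_mul, neg_div, linearAverage_neg]
    rw [h3, add_assoc 3, add_assoc 3, Real.exp_add, Real.exp_add, ← hN2, ← mul_assoc]
    by_cases hj : j.1 ∈ Ico (2 * w - 1) (3 * w - 1)
    · have hj' := mem_Ico.1 hj
      obtain ⟨c1, c2, c3⟩ := sqrt_add_inv_le_exp (j := j.1) hw (by omega) (by omega) hl hs hp hN hP
        hPa hq1 hq2 hy1 hy2
      simp only [hg, if_pos hj]
      refine (linearAverage_le _ _ hN1 c1 c2).trans ?_
      gcongr
    · simp only [hg, if_neg hj, Real.exp_zero, mul_one]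
      refine (linearAverage_le_trivial _ _ hN1).trans ?_
      gcongr
      linarith
  refine (prod_le_prod (fun _ _ => linearAverage_nonneg _ _) fun j _ => h1 j).trans ?_
  rw [← Real.exp_sum]
  apply Real.exp_le_exp.2
  rw [sum_add_distrib, sum_add_distrib, Fin.sum_univ_eq_sum_range (fun j => g j)]
  have h2 : ∑ j ∈ range k, g j = w * lam := by
    simp only [hg]
    rw [sum_ite_mem, inter_eq_right.2, sum_const, Nat.card_Ico, nsmul_eq_mul]
    · congr 2
      omega
    · intro j hj
      have := mem_Ico.1 hj
      exact mem_range.2 (by omega)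
  have h3 : ∑ j : Fin k, 2 * ((j.1 : ℝ) + 1) * (a * P) = k * (k + 1) * (a * P) := by
    rw [Fin.sum_univ_eq_sum_range (fun j => 2 * ((j : ℝ) + 1) * (a * P)), ← sum_mul]
    congr 1
    clear * -
    induction k with
    | zero => simp
    | succ k ih => rw [sum_range_succ, ih]; push_cast; ring
  rw [h2, h3]
  simp only [sum_add_distrib, sum_const, card_univ, Fintype.card_fin, nsmul_eq_mul]
  exact le_of_eq (by ring)

theorem exponent_le {w l P k r s a : ℝ} (hw : 2 ≤ w) (hk : k = 24 * w) (hr : r = 19999 * k)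
    (hs : s = 20000 * k ^ 2) (ha : a = 20000 * k) (hl : 10 ^ 20 * w ^ 2 ≤ l)
    (hPa : 48 * a * P ≤ 23 * l) :
    8 * s * r * Real.log (4 * s) + k ^ 2 * (k + 1) * P + 3 * k + 2 * k * Real.log s +
      w * (1 + 3 * w * (a + 1) - w * l / 16) ≤ -(2 * s ^ 2 * (l / (10 ^ 17 * w ^ 2))) := by
  have hw0 : 0 < w := by linarith
  have hs0 : 0 < s := by rw [hs, hk]; positivity
  have hls : Real.log (4 * s) ≤ 14 * k := by
    have h1 : (4 * s) = 80000 * k ^ 2 := by rw [hs]; ring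
    have hk0 : 0 < k := by linarith
    have h2 : Real.log k ≤ k := (Real.log_le_sub_one_of_pos hk0).trans (by linarith)
    have h3 : Real.log 80000 ≤ 17 := by
      have : (80000 : ℝ) ≤ 2 ^ 17 := by norm_num
      calc Real.log 80000 ≤ Real.log (2 ^ 17) := Real.log_le_log (by norm_num) this
        _ = 17 * Real.log 2 := by rw [Real.log_pow]; norm_num
        _ ≤ 17 := by linarith [Real.log_two_lt_d9]
    rw [h1, Real.log_mul (by norm_num) (by positivity), Real.log_pow]
    push_cast
    nlinarith
  have hls2 : Real.log s ≤ 14 * k := (Real.log_le_log hs0 (by linarith)).trans hls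
  have hP : k ^ 2 * (k + 1) * P ≤ w ^ 2 * l / 32 := by
    have h1 : 23040000 * w * P ≤ 23 * l := by
      rw [ha, hk] at hPa
      linarith
    by_cases hP0 : P ≤ 0
    · have h2 : k ^ 2 * (k + 1) * P ≤ 0 :=
        mul_nonpos_of_nonneg_of_nonpos (by rw [hk]; positivity) hP0
      have : 0 ≤ l := le_trans (by positivity) hl
      have : 0 ≤ w ^ 2 * l / 32 := by positivity
      linarith
    push Not at hP0
    have h2 : k ^ 2 * (k + 1) ≤ 576 * w ^ 2 * (48 * w) := by
      rw [hk]
      have : (24 * w) ^ 2 = 576 * w ^ 2 := by ring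
      rw [this]
      exact mul_le_mul_of_nonneg_left (by linarith) (by positivity)
    calc k ^ 2 * (k + 1) * P ≤ 576 * w ^ 2 * (48 * w) * P :=
          mul_le_mul_of_nonneg_right h2 hP0.le
      _ = w ^ 2 * (576 * 48 / 23040000) * (23040000 * w * P) := by ring
      _ ≤ w ^ 2 * (576 * 48 / 23040000) * (23 * l) :=
          mul_le_mul_of_nonneg_left h1 (by positivity)
      _ ≤ w ^ 2 * l / 32 := by
          have : 0 ≤ l := le_trans (by positivity) hl
          have : 0 ≤ w ^ 2 * l := by positivity
          linarith
  have h1 : 8 * s * r * Real.log (4 * s) ≤ 8 * s * r * (14 * k) :=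
    mul_le_mul_of_nonneg_left hls (by rw [hs, hr, hk]; positivity)
  have h2 : 2 * k * Real.log s ≤ 2 * k * (14 * k) :=
    mul_le_mul_of_nonneg_left hls2 (by rw [hk]; positivity)
  have h3 : 2 * s ^ 2 * (l / (10 ^ 17 * w ^ 2)) =
      2 * (20000 * 576) ^ 2 / 10 ^ 17 * (w ^ 2 * l) := by
    rw [hs, hk]
    field_simp
    ring
  have h4 : 8 * s * r * (14 * k) = 8 * 20000 * 19999 * 14 * 24 ^ 4 * w ^ 4 := by
    rw [hs, hr, hk]
    ring
  have h5 : w * (1 + 3 * w * (a + 1) - w * l / 16) =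
      w + 3 * w ^ 2 + 1440000 * w ^ 3 - w ^ 2 * l / 16 := by
    rw [ha, hk]
    ring
  have h6 : 2 * k * (14 * k) = 16128 * w ^ 2 := by
    rw [hk]
    ring
  have h7 : 10 ^ 20 * w ^ 4 ≤ w ^ 2 * l := by
    nlinarith [mul_le_mul_of_nonneg_left hl (by positivity : 0 ≤ w ^ 2)]
  have h8 : w ^ 3 ≤ w ^ 4 := pow_le_pow_right₀ (by linarith) (by norm_num)
  have h9 : w ^ 2 ≤ w ^ 4 := pow_le_pow_right₀ (by linarith) (by norm_num)
  have h10 : w ≤ w ^ 4 := le_self_pow₀ (by linarith) (by norm_num)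
  rw [h3, h5]
  rw [h4] at h1
  rw [h6] at h2
  linarith

theorem norm_bilinear_le_exp {w p q : ℕ} {y l : ℝ} (hw : 2 ≤ w) (hp : p.Prime)
    (hkp : (24 * w) ^ 4 ≤ p) (hl : 10 ^ 20 * (w : ℝ) ^ 2 ≤ l)
    (hp1 : 48 * (480000 * w) * Real.log p ≤ 23 * l)
    (hp2 : 23 * l ≤ 48 * (480000 * w) * (Real.log p + 1))
    (hq1 : Real.exp l ≤ q) (hq2 : (q : ℝ) ≤ Real.exp (l + 1))
    (hy1 : Real.exp ((1 + w / 4) * l) ≤ y) (hy2 : y ≤ Real.exp (w * l)) :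
    ‖∑ a ∈ range (p ^ (480000 * w)), ∑ b ∈ range (p ^ (480000 * w)),
      eu (∑ j : Fin (24 * w),
        ((-1) ^ (j.1 + 1) * y / (q : ℝ) ^ (j.1 + 2)) * ((a : ℝ) * b) ^ (j.1 + 1))‖ ≤
      (((p ^ (480000 * w) : ℕ) : ℝ)) ^ 2 * Real.exp (-(l / (10 ^ 17 * w ^ 2))) := by
  obtain ⟨k, hk⟩ : ∃ k, k = 24 * w := ⟨_, rfl⟩
  obtain ⟨r, hr⟩ : ∃ r, r = 19999 * k := ⟨_, rfl⟩
  obtain ⟨s, hs⟩ : ∃ s, s = k ^ 2 + r * k := ⟨_, rfl⟩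
  obtain ⟨a, ha⟩ : ∃ a, a = r + k := ⟨_, rfl⟩
  have hak : a = 480000 * w := by omega
  have hs2 : s = 20000 * k ^ 2 := by rw [hs, hr]; ring
  rw [← hk, ← hak]
  obtain ⟨P, hP⟩ : ∃ P, P = Real.log p := ⟨_, rfl⟩
  obtain ⟨M, hM⟩ : ∃ M, M = p ^ a := ⟨_, rfl⟩
  have hp0 : (0 : ℝ) < p := by exact_mod_cast hp.pos
  have hs1 : 1 ≤ s := by
    rw [hs2]
    have : 0 < k := by omega
    exact Nat.mul_pos (by norm_num) (by positivity)
  have hl0 : 0 ≤ l := le_trans (by positivity) hl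
  have hkr : (k : ℝ) = 24 * w := by rw [hk]; push_cast; ring
  have har : (a : ℝ) = 480000 * w := by rw [hak]; push_cast; ring
  have hMr : (M : ℝ) = Real.exp (a * P) := by
    rw [hM, hP, ← Real.log_pow, Real.exp_log (by positivity)]
    push_cast
    rfl
  have hv : (vinogradov k s M : ℝ) ≤
      Real.exp (4 * s * r * Real.log (4 * s) + 2 * s * (a * P) - r * (k * (k + 1) / 2) * P) := by
    have h1 := vinogradov_le hp (by omega : 2 ≤ k) (hk ▸ hkp) (le_refl (k ^ 2 + r * k))
    rw [← hs, ← ha, ← hM] at h1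
    have h2 : (vinogradov k s M : ℝ) * (p : ℝ) ^ (r * (k * (k + 1) / 2)) ≤
        ((4 * s : ℝ) ^ (4 * s)) ^ r * (p : ℝ) ^ (2 * s * a) := by
      exact_mod_cast h1
    have hpe : ∀ n : ℕ, (p : ℝ) ^ n = Real.exp (n * P) := fun n => by
      rw [hP, ← Real.log_pow, Real.exp_log (by positivity)]
    have hse : ((4 * s : ℝ) ^ (4 * s)) ^ r = Real.exp (4 * s * r * Real.log (4 * s)) := by
      have : (0 : ℝ) < 4 * s := by positivity
      rw [← pow_mul, ← Real.exp_log (pow_pos this _), Real.log_pow]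
      push_cast
      ring_nf
    rw [hpe, hpe, hse, ← Real.exp_add, ← le_div_iff₀ (Real.exp_pos _), ← Real.exp_sub] at h2
    refine h2.trans (Real.exp_le_exp.2 (le_of_eq ?_))
    have h3 : ((k * (k + 1) / 2 : ℕ) : ℝ) = (k : ℝ) * (k + 1) / 2 := by
      rw [Nat.cast_div (Nat.even_mul_succ_self k).two_dvd (by norm_num)]
      push_cast
      rfl
    push_cast
    rw [h3]
    ring
  have hprod := prod_linearAverage_le (a := a) (s := s) (by omega : 1 ≤ w)
    (by omega : 3 * w ≤ k) hl0 hs1 hp.pos hP (by rw [har, hP]; linarith) hq1 hq2 hy1 hy2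
  have hmain := norm_bilinear_pow_le k s M hs1
    (fun j => (-1) ^ (j.1 + 1) * y / (q : ℝ) ^ (j.1 + 2))
  rw [← hM] at hprod ⊢
  set U := ‖∑ a ∈ range M, ∑ b ∈ range M, eu (∑ j : Fin k,
    ((-1) ^ (j.1 + 1) * y / (q : ℝ) ^ (j.1 + 2)) * ((a : ℝ) * b) ^ (j.1 + 1))‖ with hU
  have hexp : U ^ (2 * s ^ 2) ≤
      (Real.exp (2 * (a * P) - l / (10 ^ 17 * w ^ 2))) ^ (2 * s ^ 2) := by
    have hM4 : (M : ℝ) ^ (4 * s * (s - 1)) = Real.exp (4 * s * (s - 1) * (a * P)) := by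
      rw [hMr, ← Real.exp_nat_mul]
      push_cast [Nat.cast_sub hs1]
      ring_nf
    have hv2 : (vinogradov k s M : ℝ) ^ 2 ≤ Real.exp (2 * (4 * s * r * Real.log (4 * s) +
        2 * s * (a * P) - r * (k * (k + 1) / 2) * P)) := by
      refine (pow_le_pow_left₀ (Nat.cast_nonneg _) hv 2).trans (le_of_eq ?_)
      rw [← Real.exp_nat_mul]
      push_cast
      rfl
    have hprod0 : 0 ≤ ∏ j : Fin k, linearAverage ((-1) ^ (j.1 + 1) * y / (q : ℝ) ^ (j.1 + 2))
        (s * M ^ (j.1 + 1)) := prod_nonneg fun _ _ => linearAverage_nonneg _ _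
    refine hmain.trans ?_
    rw [hM4]
    calc _ ≤ Real.exp (4 * s * (s - 1) * (a * P)) * Real.exp (2 * (4 * s * r * Real.log (4 * s) +
        2 * s * (a * P) - r * (k * (k + 1) / 2) * P)) * _ := by
          refine mul_le_mul (mul_le_mul_of_nonneg_left hv2 (Real.exp_pos _).le) hprod hprod0
            (by positivity)
      _ ≤ _ := by
          rw [← Real.exp_add, ← Real.exp_add, ← Real.exp_nat_mul]
          apply Real.exp_le_exp.2
          have h := exponent_le (w := w) (l := l) (P := P) (k := k) (r := r) (s := s) (a := a)
            (by exact_mod_cast hw) hkr (by rw [hr]; push_cast; ring)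
            (by rw [hs2]; push_cast; ring) (by rw [har, hkr]; ring) hl
            (by rw [har, hP]; exact hp1)
          have har2 : (a : ℝ) = r + k := by rw [ha]; push_cast; ring
          push_cast
          have h2 : (4 * s * (s - 1) * (a * P) + 2 * (4 * s * r * Real.log (4 * s) +
            2 * s * (a * P) - r * (k * (k + 1) / 2) * P) +
            (3 * k + 2 * k * Real.log s + k * (k + 1) * (a * P) +
              w * (1 + 3 * w * (a + 1) - w * l / 16)) : ℝ) = 4 * s ^ 2 * (a * P) +
            (8 * s * r * Real.log (4 * s) + k ^ 2 * (k + 1) * P + 3 * k + 2 * k * Real.log s +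
      w * (1 + 3 * w * (a + 1) - w * l / 16)) := by
            rw [har2]
            ring
          rw [h2]
          linarith
  have h3 := (pow_le_pow_iff_left₀ (norm_nonneg _) (Real.exp_pos _).le (by positivity)).1 hexp
  refine h3.trans (le_of_eq ?_)
  rw [hMr, ← Real.exp_nat_mul, ← Real.exp_add]
  push_cast
  ring_nf

theorem exists_prime_log_le {x : ℝ} (hx : 2 ≤ Real.exp x) :
    ∃ p : ℕ, p.Prime ∧ Real.log p ≤ x ∧ x ≤ Real.log p + 1 := by
  have h1 : 1 ≤ ⌊Real.exp x / 2⌋₊ := Nat.le_floor (by push_cast; linarith)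
  obtain ⟨p, hp, hp1, hp2⟩ := Nat.exists_prime_lt_and_le_two_mul ⌊Real.exp x / 2⌋₊ (by omega)
  have hp0 : (0 : ℝ) < p := by exact_mod_cast hp.pos
  refine ⟨p, hp, ?_, ?_⟩
  · rw [Real.log_le_iff_le_exp hp0]
    have h2 : (⌊Real.exp x / 2⌋₊ : ℝ) ≤ Real.exp x / 2 := Nat.floor_le (by positivity)
    have h3 : (p : ℝ) ≤ 2 * ⌊Real.exp x / 2⌋₊ := by exact_mod_cast hp2
    linarith
  · have h2 : Real.exp x / 2 < p := (Nat.lt_floor_add_one _).trans_le (by exact_mod_cast hp1)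
    have h3 : Real.log (Real.exp x / 2) ≤ Real.log p := Real.log_le_log (by positivity) h2.le
    rw [Real.log_div (Real.exp_pos _).ne' (by norm_num), Real.log_exp] at h3
    linarith [Real.log_two_lt_d9]

theorem norm_sum_eu_div_le_of_pow {w Q A B : ℕ} {y : ℝ} (hw : 2 ≤ w)
    (hl : 10 ^ 20 * (w : ℝ) ^ 2 ≤ Real.log Q) (hQA : Q ≤ A) (hAB : A ≤ B) (hBQ : B ≤ 2 * Q)
    (hy1 : Real.exp ((1 + w / 4) * Real.log Q) ≤ y) (hy2 : y ≤ Real.exp (w * Real.log Q)) :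
    ‖∑ q ∈ Ioc A B, eu (y / q)‖ ≤ 10 * Q * Real.exp (-(Real.log Q / (10 ^ 17 * w ^ 2))) := by
  obtain ⟨l, hle⟩ : ∃ l, l = Real.log Q := ⟨_, rfl⟩
  rw [← hle] at hl hy1 hy2 ⊢
  have hw' : (2 : ℝ) ≤ w := by exact_mod_cast hw
  have hw2 : (w : ℝ) ≤ w ^ 2 := le_self_pow₀ (by linarith) (by norm_num)
  have hl1 : 10 ^ 20 * (w : ℝ) ≤ l := by nlinarith
  have hl0 : 0 < l := by linarith
  have hQ0 : 0 < Q := by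
    rcases Nat.eq_zero_or_pos Q with h | h
    · rw [h] at hle
      simp at hle
      linarith
    · exact h
  have hQ0' : (0 : ℝ) < Q := by exact_mod_cast hQ0
  have hQe : (Q : ℝ) = Real.exp l := by rw [hle, Real.exp_log hQ0']
  set x := 23 * l / (48 * (480000 * w)) with hx
  have hxl : 10 ^ 13 * (w : ℝ) ≤ x := by
    rw [hx, le_div_iff₀ (by positivity)]
    nlinarith
  obtain ⟨p, hp, hp1, hp2⟩ := exists_prime_log_le (x := x)
    (by linarith [Real.add_one_le_exp x])
  have hp0 : (0 : ℝ) < p := by exact_mod_cast hp.pos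
  have hp1' : 48 * (480000 * w) * Real.log p ≤ 23 * l := by
    rw [hx, le_div_iff₀ (by positivity)] at hp1
    linarith
  have hp2' : 23 * l ≤ 48 * (480000 * w) * (Real.log p + 1) := by
    rw [hx, div_le_iff₀ (by positivity)] at hp2
    linarith
  have hkp : (24 * w) ^ 4 ≤ p := by
    have h1 : (24 * w : ℝ) ≤ Real.exp (24 * w) := by linarith [Real.add_one_le_exp (24 * w : ℝ)]
    have h2 : (24 * w : ℝ) ^ 4 ≤ p := by
      calc (24 * w : ℝ) ^ 4 ≤ Real.exp (24 * w) ^ 4 := by gcongr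
        _ = Real.exp (96 * w) := by rw [← Real.exp_nat_mul]; push_cast; ring_nf
        _ ≤ Real.exp (Real.log p) := Real.exp_le_exp.2 (by linarith)
        _ = p := Real.exp_log hp0
    exact_mod_cast h2
  obtain ⟨M, hM⟩ : ∃ M, M = p ^ (480000 * w) := ⟨_, rfl⟩
  have hM0 : (0 : ℝ) < M := by
    rw [hM]
    exact_mod_cast pow_pos hp.pos _
  have hMe : (M : ℝ) ≤ Real.exp (23 * l / 48) := by
    have h1 : (M : ℝ) = Real.exp (480000 * w * Real.log p) := by
      rw [hM, Nat.cast_pow, ← Real.exp_log (pow_pos hp0 _), Real.log_pow]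
      push_cast
      rfl
    rw [h1]
    exact Real.exp_le_exp.2 (by linarith)
  have hM2 : (M : ℝ) ^ 2 ≤ Real.exp (23 * l / 24) := by
    calc (M : ℝ) ^ 2 ≤ Real.exp (23 * l / 48) ^ 2 := by gcongr
      _ = _ := by rw [← Real.exp_nat_mul]; push_cast; ring_nf
  have hy0 : 0 ≤ y := (Real.exp_pos _).le.trans hy1
  obtain ⟨E, hE⟩ : ∃ E, E = Real.exp (-(l / (10 ^ 17 * w ^ 2))) := ⟨_, rfl⟩
  have hmain := norm_sum_mul_sq_le (fun n => eu (y / n)) (fun n => by simp) A B M hAB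
  have hterm : ∀ q ∈ Ioc A B, ‖∑ a ∈ range M, ∑ b ∈ range M, eu (y / ((q + a * b : ℕ) : ℝ))‖ ≤
      (M : ℝ) ^ 2 * (E + 7 * Real.exp (-l)) := by
    intro q hq
    rw [mem_Ioc] at hq
    have hq0 : 0 < q := by omega
    have hqQ : (Q : ℝ) ≤ q := by exact_mod_cast (by omega : Q ≤ q)
    have hqQ2 : (q : ℝ) ≤ Real.exp (l + 1) := by
      have h1 : (q : ℝ) ≤ 2 * Q := by exact_mod_cast (by omega : q ≤ 2 * Q)
      rw [Real.exp_add, ← hQe]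
      have := Real.add_one_le_exp (1 : ℝ)
      nlinarith
    have h1 := norm_bilinear_le_exp hw hp hkp hl hp1' hp2' (hQe ▸ hqQ) hqQ2 hy1 hy2
    rw [← hM, ← hE] at h1
    have h2 := norm_sum_eu_shift_le (24 * w) M q y hq0 hy0
    refine h2.trans ?_
    have h3 : ((M : ℝ) ^ 2 / q) ^ (24 * w + 1) * (y / q) ≤ Real.exp (-l) := by
      calc ((M : ℝ) ^ 2 / q) ^ (24 * w + 1) * (y / q) ≤
          (Real.exp (23 * l / 24) / Real.exp l) ^ (24 * w + 1) *
            (Real.exp (w * l) / Real.exp l) := by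
            rw [← hQe]
            gcongr
        _ = Real.exp ((24 * w + 1) * (23 * l / 24 - l) + (w * l - l)) := by
            rw [← Real.exp_sub, ← Real.exp_sub, ← Real.exp_nat_mul, ← Real.exp_add]
            push_cast
            rfl
        _ ≤ _ := Real.exp_le_exp.2 (by nlinarith)
    have hpi : 2 * Real.pi ≤ 7 := by linarith [Real.pi_lt_d2]
    calc _ ≤ (M : ℝ) ^ 2 * E + (M : ℝ) ^ 2 * (7 * Real.exp (-l)) := by
          refine add_le_add h1 (mul_le_mul_of_nonneg_left ?_ (by positivity))
          exact mul_le_mul hpi h3 (by positivity) (by norm_num)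
      _ = _ := by ring
  have hcard : ((B - A : ℕ) : ℝ) ≤ Q := by exact_mod_cast (by omega : B - A ≤ Q)
  have hE0 : 0 < E := by rw [hE]; exact Real.exp_pos _
  have h1 : ‖∑ q ∈ Ioc A B, eu (y / q)‖ * (M : ℝ) ^ 2 ≤
      Q * ((M : ℝ) ^ 2 * (E + 7 * Real.exp (-l))) + 2 * (M : ℝ) ^ 4 := by
    refine hmain.trans (add_le_add_left ?_ _)
    refine (sum_le_sum hterm).trans ?_
    rw [sum_const, Nat.card_Ioc, nsmul_eq_mul]
    gcongr
  have h2 : ‖∑ q ∈ Ioc A B, eu (y / q)‖ ≤ Q * (E + 7 * Real.exp (-l)) + 2 * (M : ℝ) ^ 2 := by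
    refine le_of_mul_le_mul_right ?_ (by positivity : (0 : ℝ) < (M : ℝ) ^ 2)
    refine h1.trans (le_of_eq (by ring))
  have hdiv : l / (10 ^ 17 * w ^ 2) ≤ l / 24 := by
    apply div_le_div_of_nonneg_left hl0.le (by norm_num)
    nlinarith
  have h3 : Real.exp (-l) ≤ E := by
    rw [hE]
    exact Real.exp_le_exp.2 (by linarith)
  have h3' : (1 : ℝ) ≤ Q * E := by
    calc (1 : ℝ) = Q * Real.exp (-l) := by rw [hQe, ← Real.exp_add]; simp
      _ ≤ _ := by gcongr
  have h4 : (M : ℝ) ^ 2 ≤ Q * E := by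
    refine hM2.trans ?_
    rw [hQe, hE, ← Real.exp_add]
    exact Real.exp_le_exp.2 (by linarith)
  have h5 : Q * Real.exp (-l) = 1 := by rw [hQe, ← Real.exp_add]; simp
  rw [← hE]
  nlinarith

/-- A Vinogradov-type bound for exponential sums with phase `y / q` over a dyadic range. -/
theorem norm_sum_eu_div_le {w Q A B : ℕ} {y : ℝ} (hw : 2 ≤ w)
    (hl : 10 ^ 20 * (w : ℝ) ^ 2 ≤ Real.log Q) (hQA : Q ≤ A) (hAB : A ≤ B) (hBQ : B ≤ 2 * Q)
    (hy1 : Real.exp (3 / 2 * Real.log Q) ≤ |y|) (hy2 : |y| ≤ Real.exp (w * Real.log Q)) :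
    ‖∑ q ∈ Ioc A B, eu (y / q)‖ ≤ 10 * Q * Real.exp (-(Real.log Q / (10 ^ 17 * w ^ 2))) := by
  have habs : ‖∑ q ∈ Ioc A B, eu (y / q)‖ = ‖∑ q ∈ Ioc A B, eu (|y| / q)‖ := by
    rcases abs_choice y with h | h
    · rw [h]
    · rw [h, ← Complex.norm_conj, map_sum]
      simp only [conj_eu, neg_div]
  rw [habs]
  have hw' : (2 : ℝ) ≤ w := by exact_mod_cast hw
  have hl0 : 0 < Real.log Q := by nlinarith
  have hy0 : 0 < |y| := (Real.exp_pos _).trans_le hy1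
  set v := max 2 ⌈Real.log |y| / Real.log Q⌉₊ with hv
  have hvw : v ≤ w := by
    refine max_le hw (Nat.ceil_le.2 ?_)
    rw [div_le_iff₀ hl0]
    exact (Real.log_le_iff_le_exp hy0).2 hy2
  have hvw' : (v : ℝ) ≤ w := by exact_mod_cast hvw
  have hv2 : 2 ≤ v := le_max_left _ _
  have hv2' : (2 : ℝ) ≤ v := by exact_mod_cast hv2
  have hupper : |y| ≤ Real.exp (v * Real.log Q) := by
    rw [← Real.log_le_iff_le_exp hy0, ← div_le_iff₀ hl0]
    exact (Nat.le_ceil _).trans (by exact_mod_cast le_max_right _ _)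
  have hlower : Real.exp ((1 + v / 4) * Real.log Q) ≤ |y| := by
    by_cases hv3 : v = 2
    · rw [hv3]
      push_cast
      norm_num
      exact hy1
    · have h1 : v = ⌈Real.log |y| / Real.log Q⌉₊ := by omega
      have h2 : (v : ℝ) < Real.log |y| / Real.log Q + 1 := by
        rw [h1]
        refine Nat.ceil_lt_add_one (div_nonneg ?_ hl0.le)
        exact le_trans (by positivity) ((Real.le_log_iff_exp_le hy0).2 hy1)
      have h3 : (3 : ℝ) ≤ v := by exact_mod_cast (by omega : 3 ≤ v)
      rw [← Real.le_log_iff_exp_le hy0, ← le_div_iff₀ hl0]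
      linarith
  refine (norm_sum_eu_div_le_of_pow hv2 (le_trans (by gcongr) hl) hQA hAB hBQ hlower
    hupper).trans ?_
  have : 10 ^ 17 * (v : ℝ) ^ 2 ≤ 10 ^ 17 * w ^ 2 := by gcongr
  gcongr

open ArithmeticFunction in
/-- Splitting a Dirichlet convolution over an interval. -/
theorem sum_dirichlet_mul_eq (F G : ArithmeticFunction ℝ) (Φ : ℕ → ℂ) (A B : ℕ) :
    ∑ n ∈ Ioc A B, ((F * G) n : ℂ) * Φ n =
      ∑ a ∈ Ioc 0 B, (F a : ℂ) * ∑ b ∈ Ioc (A / a) (B / a), (G b : ℂ) * Φ (a * b) := by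
  have h1 : ∀ n ∈ Ioc A B, ((F * G) n : ℂ) * Φ n =
      ∑ a ∈ Ioc 0 B, ∑ b ∈ Ioc 0 B, if a * b = n then (F a : ℂ) * (G b * Φ (a * b)) else 0 := by
    intro n hn
    rw [mem_Ioc] at hn
    rw [ArithmeticFunction.mul_apply, Complex.ofReal_sum, sum_mul, ← sum_product', ← sum_filter]
    have h2 : n.divisorsAntidiagonal = (Ioc 0 B ×ˢ Ioc 0 B).filter fun p => p.1 * p.2 = n := by
      ext ⟨a, b⟩
      simp only [Nat.mem_divisorsAntidiagonal, mem_filter, mem_product, mem_Ioc]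
      constructor
      · rintro ⟨h, hn0⟩
        have ha : 0 < a := Nat.pos_of_ne_zero fun h' => hn0 (by rw [← h, h', zero_mul])
        have hb : 0 < b := Nat.pos_of_ne_zero fun h' => hn0 (by rw [← h, h', mul_zero])
        exact ⟨⟨⟨ha, by nlinarith⟩, hb, by nlinarith⟩, h⟩
      · rintro ⟨-, h⟩
        exact ⟨h, by omega⟩
    rw [h2]
    refine sum_congr rfl fun p hp => ?_
    rw [(mem_filter.1 hp).2]
    push_cast
    ring
  rw [sum_congr rfl h1, sum_comm]
  refine sum_congr rfl fun a ha => ?_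
  rw [mem_Ioc] at ha
  rw [sum_comm, mul_sum]
  have h3 : ∀ b, (∑ n ∈ Ioc A B, if a * b = n then (F a : ℂ) * (G b * Φ (a * b)) else 0) =
      if b ∈ Ioc (A / a) (B / a) then (F a : ℂ) * (G b * Φ (a * b)) else 0 := by
    intro b
    rw [sum_ite_eq]
    refine if_congr ?_ rfl rfl
    rw [mem_Ioc, mem_Ioc, Nat.div_lt_iff_lt_mul ha.1, Nat.le_div_iff_mul_le ha.1, mul_comm]
  simp only [h3]
  rw [sum_ite_mem, inter_eq_right.2]
  intro b hb
  rw [mem_Ioc] at hb ⊢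
  exact ⟨(Nat.zero_le _).trans_lt hb.1, hb.2.trans (Nat.div_le_self _ _)⟩

/-- The restriction of an arithmetic function to `n ≤ U`. -/
noncomputable def cutoff (U : ℕ) (F : ArithmeticFunction ℝ) : ArithmeticFunction ℝ :=
  ⟨fun n => if n ≤ U then F n else 0, by simp⟩

theorem cutoff_apply (U : ℕ) (F : ArithmeticFunction ℝ) (n : ℕ) :
    cutoff U F n = if n ≤ U then F n else 0 := rfl

theorem sub_cutoff_apply (U : ℕ) (F : ArithmeticFunction ℝ) (n : ℕ) :
    (F - cutoff U F) n = if n ≤ U then 0 else F n := by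
  have : (F - cutoff U F) n = F n - cutoff U F n := by
    rw [sub_eq_add_neg, ArithmeticFunction.add_apply, ArithmeticFunction.neg_apply, sub_eq_add_neg]
  rw [this, cutoff_apply]
  split_ifs <;> simp

open ArithmeticFunction in
/-- Vaughan's identity. -/
theorem vaughan_identity (U : ℕ) :
    vonMangoldt = cutoff U vonMangoldt + cutoff U ((moebius : ArithmeticFunction ℤ) : ArithmeticFunction ℝ) * log -
      cutoff U ((moebius : ArithmeticFunction ℤ) : ArithmeticFunction ℝ) * cutoff U vonMangoldt * ((zeta : ArithmeticFunction ℕ) : ArithmeticFunction ℝ) +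
      (vonMangoldt - cutoff U vonMangoldt) *
        ((((moebius : ArithmeticFunction ℤ) : ArithmeticFunction ℝ) - cutoff U ((moebius : ArithmeticFunction ℤ) : ArithmeticFunction ℝ)) *
          ((zeta : ArithmeticFunction ℕ) : ArithmeticFunction ℝ)) := by
  have h1 : (vonMangoldt : ArithmeticFunction ℝ) * ((zeta : ArithmeticFunction ℕ) : ArithmeticFunction ℝ) = log :=
    vonMangoldt_mul_zeta
  have h2 : ((moebius : ArithmeticFunction ℤ) : ArithmeticFunction ℝ) * ((zeta : ArithmeticFunction ℕ) : ArithmeticFunction ℝ) = 1 :=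
    coe_moebius_mul_coe_zeta
  rw [← h1]
  linear_combination (cutoff U vonMangoldt - vonMangoldt) * h2

/-- Summation by parts against the logarithm. -/
theorem norm_sum_log_mul_le (z : ℕ → ℂ) (K : ℝ) (A B : ℕ) (hA : 1 ≤ A) (hAB : A ≤ B)
    (h : ∀ C, A ≤ C → C ≤ B → ‖∑ b ∈ Ioc C B, z b‖ ≤ K) :
    ‖∑ b ∈ Ioc A B, (Real.log b : ℂ) * z b‖ ≤ K * Real.log B := by
  have key : ‖∑ b ∈ Ioc A B, ((Real.log b - Real.log A : ℝ) : ℂ) * z b‖ ≤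
      K * (Real.log B - Real.log A) := by
    obtain ⟨d, rfl⟩ := Nat.exists_eq_add_of_le hAB
    clear hAB
    induction d generalizing A with
    | zero => simp
    | succ d ih =>
      have hd : A + (d + 1) = A + 1 + d := by ring
      rw [hd] at h ⊢
      have ih' := ih (A + 1) (by omega) fun C h1 h2 => h C (by omega) h2
      have h1 : ∑ b ∈ Ioc A (A + 1 + d), ((Real.log b - Real.log A : ℝ) : ℂ) * z b =
          ∑ b ∈ Ioc (A + 1) (A + 1 + d),
            ((Real.log b - Real.log ((A + 1 : ℕ) : ℝ) : ℝ) : ℂ) * z b +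
          ((Real.log ((A + 1 : ℕ) : ℝ) - Real.log A : ℝ) : ℂ) *
            ∑ b ∈ Ioc A (A + 1 + d), z b := by
        have hsplit : ∀ f : ℕ → ℂ, ∑ b ∈ Ioc A (A + 1 + d), f b =
            f (A + 1) + ∑ b ∈ Ioc (A + 1) (A + 1 + d), f b := fun f => by
          rw [← sum_Ioc_consecutive f (Nat.le_succ A) (by omega : A + 1 ≤ A + 1 + d)]
          simp
        rw [hsplit, hsplit, mul_add, mul_sum, add_left_comm, ← sum_add_distrib]
        congr 1
        refine sum_congr rfl fun b _ => ?_
        push_cast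
        ring
      have h2 : 0 ≤ Real.log ((A + 1 : ℕ) : ℝ) - Real.log A := by
        rw [sub_nonneg]
        exact Real.log_le_log (by exact_mod_cast hA) (by push_cast; linarith)
      have h3 := h A le_rfl (by omega)
      rw [h1]
      refine (norm_add_le _ _).trans ?_
      rw [norm_mul, Complex.norm_real, Real.norm_eq_abs, abs_of_nonneg h2]
      nlinarith
  have h1 : ∑ b ∈ Ioc A B, (Real.log b : ℂ) * z b =
      ∑ b ∈ Ioc A B, ((Real.log b - Real.log A : ℝ) : ℂ) * z b +
        (Real.log A : ℂ) * ∑ b ∈ Ioc A B, z b := by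
    rw [mul_sum, ← sum_add_distrib]
    refine sum_congr rfl fun b _ => ?_
    push_cast
    ring
  have h2 : 0 ≤ Real.log A := Real.log_natCast_nonneg A
  rw [h1]
  refine (norm_add_le _ _).trans ?_
  rw [norm_mul, Complex.norm_real, Real.norm_eq_abs, abs_of_nonneg h2]
  nlinarith [h A le_rfl hAB]

/-- Cancellation in all short sums with phase `y / q`, `|y| ≤ |x|`, over dyadic ranges beyond
`U`. -/
def PhaseBound (η : ℝ) (U : ℕ) (x : ℝ) : Prop :=
  ∀ D A B : ℕ, U ≤ D → D ≤ A → A ≤ B → B ≤ 2 * D → ∀ y : ℝ, (D : ℝ) ^ 3 ≤ y ^ 2 → |y| ≤ |x| →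
    ‖∑ q ∈ Ioc A B, eu (y / q)‖ ≤ η * D

theorem PhaseBound.norm_sum_le {η : ℝ} {U : ℕ} {x : ℝ} (h : PhaseBound η U x) (hη : 0 ≤ η)
    {D : ℕ} (hD : U ≤ D) {y : ℝ} (hyx : |y| ≤ |x|) (i : ℕ) :
    ∀ A B : ℕ, D ≤ A → A ≤ B → B ≤ 2 ^ i * D → ((2 : ℝ) ^ i * D) ^ 3 ≤ y ^ 2 →
    ‖∑ q ∈ Ioc A B, eu (y / q)‖ ≤ (2 ^ i - 1) * (η * D) := by
  induction i with
  | zero =>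
    intro A B h1 h2 h3 _
    have : A = B := by omega
    simp [this]
  | succ i ih =>
    intro A B h1 h2 h3 h4
    have h5 : ((2 : ℝ) ^ i * D) ^ 3 ≤ y ^ 2 := by
      refine le_trans ?_ h4
      gcongr
      · norm_num
      · omega
    have hUD : U ≤ 2 ^ i * D := hD.trans (Nat.le_mul_of_pos_left D (by positivity))
    have hηD : 0 ≤ η * D := by positivity
    have h2i : (1 : ℝ) ≤ 2 ^ i := one_le_pow₀ (by norm_num)
    have hp := fun A' B' a b c => h (2 ^ i * D) A' B' hUD a b c y (by push_cast; exact h5) hyx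
    push_cast at hp
    rcases le_total B (2 ^ i * D) with hB | hB
    · refine (ih A B h1 h2 hB h5).trans ?_
      rw [pow_succ]
      nlinarith
    rcases le_total (2 ^ i * D) A with hA | hA
    · refine (hp A B hA h2 (by rw [pow_succ] at h3; linarith)).trans ?_
      rw [pow_succ]
      nlinarith
    · rw [← sum_Ioc_consecutive _ hA hB]
      refine (norm_add_le _ _).trans ?_
      have := ih A _ h1 hA le_rfl h5
      have := hp (2 ^ i * D) B le_rfl hB (by rw [pow_succ] at h3; linarith)
      rw [pow_succ]
      nlinarith

theorem sum_Ioc_inv_le (N : ℕ) : ∑ a ∈ Ioc 0 N, (1 : ℝ) / a ≤ 1 + Real.log N := by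
  have h := harmonic_le_one_add_log N
  rw [harmonic_eq_sum_Icc] at h
  push_cast at h
  have h2 : Ioc 0 N = Icc 1 N := rfl
  simpa only [one_div, h2] using h

theorem typeI_inner_le {η : ℝ} {U A B a : ℕ} {x : ℝ} (h : PhaseBound η U x) (hη : 0 ≤ η)
    (hUA : U ^ 3 ≤ A) (hAB : A ≤ B) (hBA : B ≤ 4 * A) (hBU : B ≤ 32 * U ^ 3) (hU : 1 ≤ U)
    (hx : 2 ^ 24 * (U : ℝ) ^ 9 ≤ x ^ 2) (ha : 1 ≤ a) (haU : a ≤ U ^ 2) (C : ℕ) (hC : A / a ≤ C)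
    (hCB : C ≤ B / a) :
    ‖∑ b ∈ Ioc C (B / a), eu (x / ((a * b : ℕ) : ℝ))‖ ≤ 7 * η * B * (1 / a) := by
  have ha' : (1 : ℝ) ≤ a := by exact_mod_cast ha
  have hD : U ≤ A / a := by
    rw [Nat.le_div_iff_mul_le ha]
    calc U * a ≤ U * U ^ 2 := Nat.mul_le_mul_left _ haU
      _ = U ^ 3 := by ring
      _ ≤ A := hUA
  have h1 : A / a * a ≤ A := Nat.div_mul_le_self A a
  have h1' : ((A / a : ℕ) : ℝ) * a ≤ A := by exact_mod_cast h1
  have h2 : B / a ≤ 2 ^ 3 * (A / a) := by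
    have h3 : A < (A / a + 1) * a := by
      have := Nat.lt_div_mul_add (a := A) (b := a) ha
      linarith
    have h4 : B / a < 4 * (A / a + 1) := by
      rw [Nat.div_lt_iff_lt_mul ha]
      nlinarith
    omega
  have hAU : (A : ℝ) ≤ 32 * U ^ 3 := by exact_mod_cast hAB.trans hBU
  have h5 := h.norm_sum_le hη hD (y := x / a) (by
    rw [abs_div, abs_of_pos (by linarith : (0 : ℝ) < a)]
    exact div_le_self (abs_nonneg _) ha') 3 C (B / a) hC hCB h2 (by
      rw [div_pow, le_div_iff₀ (by positivity)]
      calc (2 ^ 3 * ((A / a : ℕ) : ℝ)) ^ 3 * (a : ℝ) ^ 2 ≤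
            (2 ^ 3 * ((A / a : ℕ) : ℝ)) ^ 3 * (a : ℝ) ^ 3 := by
            gcongr
            · norm_num
        _ = 2 ^ 9 * (((A / a : ℕ) : ℝ) * a) ^ 3 := by ring
        _ ≤ 2 ^ 9 * (32 * U ^ 3) ^ 3 := by
            have h8 := pow_le_pow_left₀ (by positivity) (h1'.trans hAU) 3
            linarith
        _ = 2 ^ 24 * (U : ℝ) ^ 9 := by ring
        _ ≤ _ := hx)
  have h6 : ∀ b : ℕ, x / ((a * b : ℕ) : ℝ) = x / a / b := fun b => by
    push_cast
    rw [div_div]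
  simp only [h6]
  refine h5.trans ?_
  have h7 : ((A / a : ℕ) : ℝ) ≤ B * (1 / a) := by
    rw [mul_one_div, le_div_iff₀ (by linarith)]
    exact h1'.trans (by exact_mod_cast hAB)
  nlinarith

theorem typeI_sum_le {B U : ℕ} {K L : ℝ} (F : ArithmeticFunction ℝ) (I : ℕ → ℂ)
    (hK : 0 ≤ K) (hL : 0 ≤ L) (hF : ∀ a, 1 ≤ a → a ≤ B → |F a| ≤ K)
    (hF0 : ∀ a, U ^ 2 < a → F a = 0)
    (hI : ∀ a, 1 ≤ a → a ≤ B → a ≤ U ^ 2 → ‖I a‖ ≤ L * (1 / a)) :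
    ‖∑ a ∈ Ioc 0 B, (F a : ℂ) * I a‖ ≤ K * L * (1 + Real.log B) := by
  calc ‖∑ a ∈ Ioc 0 B, (F a : ℂ) * I a‖ ≤ ∑ a ∈ Ioc 0 B, K * L * (1 / (a : ℝ)) := by
        refine norm_sum_le_of_le _ fun a ha => ?_
        rw [mem_Ioc] at ha
        rw [norm_mul, Complex.norm_real, Real.norm_eq_abs]
        rcases le_or_gt a (U ^ 2) with haU | haU
        · rw [mul_assoc]
          exact mul_le_mul (hF a ha.1 ha.2) (hI a ha.1 ha.2 haU) (norm_nonneg _) hK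
        · rw [hF0 a haU]
          simp only [abs_zero, zero_mul]
          positivity
    _ ≤ _ := by
        rw [← mul_sum]
        exact mul_le_mul_of_nonneg_left (sum_Ioc_inv_le B) (by positivity)

theorem abs_cutoff_moebius_le (U a : ℕ) :
    |cutoff U ((ArithmeticFunction.moebius : ArithmeticFunction ℤ) : ArithmeticFunction ℝ) a|
      ≤ 1 := by
  rw [cutoff_apply]
  split_ifs
  · rw [ArithmeticFunction.intCoe_apply]
    exact_mod_cast ArithmeticFunction.abs_moebius_le_one
  · simp

theorem abs_cutoff_mul_cutoff_le (U a : ℕ) :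
    |(cutoff U ((ArithmeticFunction.moebius : ArithmeticFunction ℤ) : ArithmeticFunction ℝ) *
      cutoff U ArithmeticFunction.vonMangoldt) a| ≤ Real.log a := by
  rw [ArithmeticFunction.mul_apply]
  calc _ ≤ ∑ p ∈ a.divisorsAntidiagonal, ArithmeticFunction.vonMangoldt p.2 := by
        refine (abs_sum_le_sum_abs _ _).trans (sum_le_sum fun p _ => ?_)
        rw [abs_mul]
        have h1 := abs_cutoff_moebius_le U p.1
        have h2 : |cutoff U ArithmeticFunction.vonMangoldt p.2| ≤
            ArithmeticFunction.vonMangoldt p.2 := by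
          rw [cutoff_apply]
          split_ifs
          · rw [abs_of_nonneg ArithmeticFunction.vonMangoldt_nonneg]
          · simp
        exact (mul_le_mul h1 h2 (abs_nonneg _) zero_le_one).trans (by rw [one_mul])
    _ = Real.log a := by
        rw [Nat.sum_divisorsAntidiagonal' (fun _ d => ArithmeticFunction.vonMangoldt d),
          ArithmeticFunction.vonMangoldt_sum]

theorem cutoff_mul_cutoff_eq_zero (U a : ℕ) (ha : U ^ 2 < a) (F G : ArithmeticFunction ℝ) :
    (cutoff U F * cutoff U G) a = 0 := by
  rw [ArithmeticFunction.mul_apply]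
  refine sum_eq_zero fun p hp => ?_
  rw [Nat.mem_divisorsAntidiagonal] at hp
  rw [cutoff_apply, cutoff_apply]
  split_ifs with h1 h2
  · exfalso
    have := Nat.mul_le_mul h1 h2
    rw [hp.1] at this
    nlinarith
  all_goals simp

theorem card_divisors_sq_le {b K : ℕ} (hb : b ∈ Ioc 0 K) :
    #b.divisors ^ 2 ≤ #{t ∈ Ioc 0 K ×ˢ Ioc 0 K ×ˢ Ioc 0 K | t.1 * (t.2.1 * t.2.2) ∣ b} := by
  rw [mem_Ioc] at hb
  rw [sq, ← card_product]
  refine card_le_card_of_injOn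
    (fun p => (Nat.gcd p.1 p.2, p.1 / Nat.gcd p.1 p.2, p.2 / Nat.gcd p.1 p.2)) ?_ ?_
  · rintro ⟨e, f⟩ hp
    simp only [coe_product, Set.mem_prod, mem_coe, Nat.mem_divisors] at hp
    obtain ⟨⟨he, -⟩, hf, -⟩ := hp
    have he0 := Nat.pos_of_dvd_of_pos he hb.1
    have hf0 := Nat.pos_of_dvd_of_pos hf hb.1
    have heb := Nat.le_of_dvd hb.1 he
    have hfb := Nat.le_of_dvd hb.1 hf
    have hg0 := Nat.gcd_pos_of_pos_left f he0
    have hge : Nat.gcd e f ≤ e := Nat.gcd_le_left f he0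
    have hgf : Nat.gcd e f ≤ f := Nat.gcd_le_right e hf0
    simp only [mem_coe, mem_filter, mem_product, mem_Ioc]
    refine ⟨⟨⟨hg0, by omega⟩, ⟨Nat.div_pos hge hg0, ?_⟩, Nat.div_pos hgf hg0, ?_⟩, ?_⟩
    · exact (Nat.div_le_self _ _).trans (by omega)
    · exact (Nat.div_le_self _ _).trans (by omega)
    · have h1 : Nat.gcd e f * (e / Nat.gcd e f * (f / Nat.gcd e f)) = Nat.lcm e f := by
        rw [← mul_assoc, Nat.mul_div_cancel' (Nat.gcd_dvd_left e f), Nat.lcm,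
          Nat.mul_div_assoc _ (Nat.gcd_dvd_right e f)]
      rw [h1]
      exact Nat.lcm_dvd he hf
  · rintro ⟨e, f⟩ _ ⟨e', f'⟩ _ h
    simp only [Prod.mk.injEq] at h ⊢
    obtain ⟨h1, h2, h3⟩ := h
    constructor
    · rw [← Nat.mul_div_cancel' (Nat.gcd_dvd_left e f), h2, h1,
        Nat.mul_div_cancel' (Nat.gcd_dvd_left e' f')]
    · rw [← Nat.mul_div_cancel' (Nat.gcd_dvd_right e f), h3, h1,
        Nat.mul_div_cancel' (Nat.gcd_dvd_right e' f')]

theorem sum_card_divisors_sq_le (K : ℕ) :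
    ∑ b ∈ Ioc 0 K, (#b.divisors : ℝ) ^ 2 ≤ K * (1 + Real.log K) ^ 3 := by
  set S := Ioc 0 K ×ˢ Ioc 0 K ×ˢ Ioc 0 K with hS
  have h1 : ∑ b ∈ Ioc 0 K, #b.divisors ^ 2 ≤
      ∑ t ∈ S, K / (t.1 * (t.2.1 * t.2.2)) := by
    calc ∑ b ∈ Ioc 0 K, #b.divisors ^ 2 ≤
        ∑ b ∈ Ioc 0 K, #{t ∈ S | t.1 * (t.2.1 * t.2.2) ∣ b} :=
          sum_le_sum fun b hb => card_divisors_sq_le hb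
      _ = ∑ t ∈ S, #{b ∈ Ioc 0 K | t.1 * (t.2.1 * t.2.2) ∣ b} := by
          simp only [card_filter]
          exact sum_comm
      _ = _ := sum_congr rfl fun t _ => Nat.Ioc_filter_dvd_card_eq_div _ _
  calc ∑ b ∈ Ioc 0 K, (#b.divisors : ℝ) ^ 2 ≤
      ((∑ t ∈ S, K / (t.1 * (t.2.1 * t.2.2)) : ℕ) : ℝ) := by exact_mod_cast h1
    _ ≤ ∑ t ∈ S, (K : ℝ) * ((1 / t.1) * ((1 / t.2.1) * (1 / t.2.2))) := by
        push_cast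
        refine sum_le_sum fun t _ => Nat.cast_div_le.trans (le_of_eq ?_)
        push_cast
        simp only [div_eq_mul_inv, mul_inv, one_mul]
    _ = K * (∑ a ∈ Ioc 0 K, (1 : ℝ) / a) ^ 3 := by
        rw [hS, ← mul_sum, sum_product]
        simp only [sum_product, ← mul_sum]
        simp only [← sum_mul]
        ring
    _ ≤ _ := by
        gcongr
        exact sum_Ioc_inv_le K

/-- The correlation of two phases over the range cut out by the hyperbola conditions. -/
theorem norm_sum_corr_le {η : ℝ} {U A B D b b' : ℕ} {x : ℝ} (h : PhaseBound η U x) (hη : 0 ≤ η)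
    (hU : 1 ≤ U) (hD : U ≤ D) (hx : (B : ℝ) ^ 4 ≤ x ^ 2 * D) (hb : b ∈ Ioc 0 (B / D))
    (hb' : b' ∈ Ioc 0 (B / D)) (hne : b ≠ b') :
    ‖∑ a ∈ Ioc D (2 * D) with ((A < a * b ∧ a * b ≤ B) ∧ A < a * b' ∧ a * b' ≤ B),
      eu (x / ((a * b : ℕ) : ℝ) - x / ((a * b' : ℕ) : ℝ))‖ ≤ η * D := by
  have hD0 : 0 < D := by omega
  rw [mem_Ioc, Nat.le_div_iff_mul_le hD0] at hb hb'
  obtain ⟨hb0, hbB⟩ := hb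
  obtain ⟨hb0', hbB'⟩ := hb'
  set y : ℝ := x / b - x / b' with hy
  have hfil : (Ioc D (2 * D)).filter
      (fun a => (A < a * b ∧ a * b ≤ B) ∧ A < a * b' ∧ a * b' ≤ B) =
      Ioc (max D (max (A / b) (A / b'))) (min (2 * D) (min (B / b) (B / b'))) := by
    ext a
    simp only [mem_filter, mem_Ioc, max_lt_iff, le_min_iff, Nat.div_lt_iff_lt_mul hb0,
      Nat.div_lt_iff_lt_mul hb0', Nat.le_div_iff_mul_le hb0, Nat.le_div_iff_mul_le hb0']
    tauto
  have hph : ∀ a : ℕ, x / ((a * b : ℕ) : ℝ) - x / ((a * b' : ℕ) : ℝ) = y / a := fun a => by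
    push_cast
    rw [hy, sub_div, div_div, div_div, mul_comm (b : ℝ), mul_comm (b' : ℝ)]
  rw [hfil]
  simp only [hph]
  set L := max D (max (A / b) (A / b'))
  set R := min (2 * D) (min (B / b) (B / b'))
  rcases le_or_gt L R with hLR | hLR
  swap
  · rw [Ioc_eq_empty (by omega), sum_empty, norm_zero]
    positivity
  have rb0 : (1 : ℝ) ≤ b := by exact_mod_cast hb0
  have rb0' : (1 : ℝ) ≤ b' := by exact_mod_cast hb0'
  have hy2 : y = x * (b' - b) / (b * b') := by
    rw [hy]
    field_simp
  refine h D L R hD (le_max_left _ _) hLR (min_le_left _ _) y ?_ ?_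
  · have rD : (0 : ℝ) < D := by exact_mod_cast hD0
    have h1 : (1 : ℝ) ≤ (b' - b) ^ 2 := by
      have h2 : (1 : ℤ) ≤ ((b' : ℤ) - b) ^ 2 := by
        have : (b' : ℤ) - b ≠ 0 := by omega
        have := sq_pos_of_ne_zero this
        omega
      exact_mod_cast h2
    have h3 : (D : ℝ) ^ 3 * (b * b') ^ 2 ≤ x ^ 2 := by
      have r1 : (b : ℝ) * D ≤ B := by exact_mod_cast hbB
      have r2 : (b' : ℝ) * D ≤ B := by exact_mod_cast hbB'
      have h4 : ((b : ℝ) * D) ^ 2 * (b' * D) ^ 2 ≤ (B : ℝ) ^ 2 * B ^ 2 := by gcongr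
      refine le_of_mul_le_mul_right ?_ rD
      nlinarith
    rw [hy2, div_pow, le_div_iff₀ (by positivity), mul_pow]
    nlinarith [sq_nonneg x]
  · rw [hy2, abs_div, abs_mul, abs_of_pos (by positivity : (0 : ℝ) < b * b'),
      div_le_iff₀ (by positivity)]
    have : |(b' : ℝ) - b| ≤ b * b' := by
      rw [abs_le]
      constructor <;> nlinarith
    exact mul_le_mul_of_nonneg_left this (abs_nonneg x)

theorem norm_bilinear_sq_le {η : ℝ} {U A B D : ℕ} {x : ℝ} (h : PhaseBound η U x) (hη : 0 ≤ η)
    (hU : 1 ≤ U) (hD : U ≤ D) (hx : (B : ℝ) ^ 4 ≤ x ^ 2 * D) (S : Finset ℕ)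
    (hS : S ⊆ Ioc D (2 * D)) (α β : ℕ → ℝ) :
    ‖∑ a ∈ S, (β a : ℂ) * ∑ b ∈ Ioc (A / a) (B / a), (α b : ℂ) * eu (x / ((a * b : ℕ) : ℝ))‖ ^ 2 ≤
      (∑ a ∈ S, β a ^ 2) * ((D + η * B) * ∑ b ∈ Ioc 0 (B / D), α b ^ 2) := by
  have hD0 : 0 < D := by omega
  set J := Ioc 0 (B / D) with hJ
  set W : ℕ → ℕ → ℂ := fun a b =>
    if A < a * b ∧ a * b ≤ B then eu (x / ((a * b : ℕ) : ℝ)) else 0 with hW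
  set z : ℕ → ℂ := fun a => ∑ b ∈ J, (α b : ℂ) * W a b with hz
  have hinner : ∀ a ∈ S, ∑ b ∈ Ioc (A / a) (B / a), (α b : ℂ) * eu (x / ((a * b : ℕ) : ℝ)) =
      z a := by
    intro a ha
    have ha' := mem_Ioc.1 (hS ha)
    have ha0 : 0 < a := by omega
    have hset : Ioc (A / a) (B / a) = J.filter fun b => A < a * b ∧ a * b ≤ B := by
      ext b
      rw [mem_filter, hJ, mem_Ioc, mem_Ioc, Nat.div_lt_iff_lt_mul ha0,
        Nat.le_div_iff_mul_le ha0, Nat.le_div_iff_mul_le hD0, mul_comm b a]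
      constructor
      · rintro ⟨h1, h2⟩
        refine ⟨⟨Nat.pos_of_ne_zero ?_, ?_⟩, h1, h2⟩
        · rintro rfl
          simp at h1
        · nlinarith
      · tauto
    rw [hset, sum_filter, hz]
    refine sum_congr rfl fun b _ => ?_
    simp only [hW]
    split_ifs <;> simp
  have hcorr : ∀ b ∈ J, ∀ b' ∈ J,
      ‖∑ a ∈ Ioc D (2 * D), W a b * (starRingEnd ℂ) (W a b')‖ ≤
        (if b = b' then (D : ℝ) else 0) + η * D := by
    intro b hb b' hb'
    by_cases hbb : b = b'
    · rw [if_pos hbb]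
      have h1 : ‖∑ a ∈ Ioc D (2 * D), W a b * (starRingEnd ℂ) (W a b')‖ ≤ D := by
        calc _ ≤ ∑ a ∈ Ioc D (2 * D), (1 : ℝ) := by
              refine norm_sum_le_of_le _ fun a _ => ?_
              have h2 : ∀ b, ‖W a b‖ ≤ 1 := fun b => by
                simp only [hW]
                split_ifs <;> simp
              rw [norm_mul, Complex.norm_conj]
              exact mul_le_one₀ (h2 b) (norm_nonneg _) (h2 b')
          _ = D := by
              simp only [sum_const, Nat.card_Ioc, nsmul_eq_mul, mul_one]
              congr 1
              omega
      have : 0 ≤ η * D := by positivity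
      linarith
    · rw [if_neg hbb, zero_add]
      have h1 := norm_sum_corr_le (A := A) h hη hU hD hx hb hb' hbb
      rw [sum_filter] at h1
      refine (le_of_eq ?_).trans h1
      congr 1
      refine sum_congr rfl fun a _ => ?_
      simp only [hW, ite_and]
      split_ifs <;> simp [sub_eq_add_neg, eu_add, conj_eu]
  have hsum : ∑ a ∈ Ioc D (2 * D), ‖z a‖ ^ 2 ≤ (D + η * B) * ∑ b ∈ J, α b ^ 2 := by
    have h1 : ((∑ a ∈ Ioc D (2 * D), ‖z a‖ ^ 2 : ℝ) : ℂ) =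
        ∑ b ∈ J, ∑ b' ∈ J, ((α b * α b' : ℝ) : ℂ) *
          ∑ a ∈ Ioc D (2 * D), W a b * (starRingEnd ℂ) (W a b') := by
      simp only [mul_sum]
      rw [sum_congr rfl fun b _ => sum_comm, sum_comm]
      push_cast
      refine sum_congr rfl fun a _ => ?_
      rw [← Complex.mul_conj', hz]
      simp only [map_sum, map_mul, Complex.conj_ofReal]
      rw [sum_mul_sum]
      refine sum_congr rfl fun b _ => sum_congr rfl fun b' _ => ?_
      ring
    have h0 : 0 ≤ ∑ a ∈ Ioc D (2 * D), ‖z a‖ ^ 2 := sum_nonneg fun _ _ => by positivity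
    have h2 : ∑ a ∈ Ioc D (2 * D), ‖z a‖ ^ 2 ≤ ∑ b ∈ J, ∑ b' ∈ J,
        |α b| * |α b'| * ((if b = b' then (D : ℝ) else 0) + η * D) := by
      rw [← abs_of_nonneg h0, ← Real.norm_eq_abs, ← Complex.norm_real, h1]
      refine norm_sum_le_of_le _ fun b hb => norm_sum_le_of_le _ fun b' hb' => ?_
      rw [norm_mul, Complex.norm_real, Real.norm_eq_abs, abs_mul]
      exact mul_le_mul_of_nonneg_left (hcorr b hb b' hb') (by positivity)
    have h3 : ∑ b ∈ J, ∑ b' ∈ J, |α b| * |α b'| * ((if b = b' then (D : ℝ) else 0) + η * D) =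
        D * ∑ b ∈ J, α b ^ 2 + η * D * (∑ b ∈ J, |α b|) ^ 2 := by
      simp only [mul_add, sum_add_distrib, mul_ite, mul_zero, sum_ite_eq]
      congr 1
      · rw [mul_sum]
        refine sum_congr rfl fun b hb => ?_
        rw [if_pos hb, ← sq, sq_abs]
        ring
      · rw [sq, sum_mul_sum, mul_sum]
        refine sum_congr rfl fun b _ => ?_
        rw [mul_sum]
        refine sum_congr rfl fun b' _ => ?_
        ring
    have h4 : (∑ b ∈ J, |α b|) ^ 2 ≤ ((B / D : ℕ) : ℝ) * ∑ b ∈ J, α b ^ 2 := by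
      have := sq_sum_le_card_mul_sum_sq (s := J) (f := fun b => |α b|)
      simpa [hJ] using this
    have h5 : (D : ℝ) * ((B / D : ℕ) : ℝ) ≤ B := by exact_mod_cast Nat.mul_div_le B D
    have h6 : 0 ≤ ∑ b ∈ J, α b ^ 2 := sum_nonneg fun _ _ => sq_nonneg _
    rw [h3] at h2
    refine h2.trans ?_
    have h7 : η * D * (∑ b ∈ J, |α b|) ^ 2 ≤ η * D * (((B / D : ℕ) : ℝ) * ∑ b ∈ J, α b ^ 2) :=
      mul_le_mul_of_nonneg_left h4 (by positivity)
    have h8 : η * (D * ((B / D : ℕ) : ℝ)) * ∑ b ∈ J, α b ^ 2 ≤ η * B * ∑ b ∈ J, α b ^ 2 := by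
      gcongr
    linarith
  rw [sum_congr rfl fun a ha => by rw [hinner a ha]]
  calc ‖∑ a ∈ S, (β a : ℂ) * z a‖ ^ 2 ≤ (∑ a ∈ S, |β a| * ‖z a‖) ^ 2 := by
        refine pow_le_pow_left₀ (norm_nonneg _) ?_ 2
        refine norm_sum_le_of_le _ fun a _ => ?_
        rw [norm_mul, Complex.norm_real, Real.norm_eq_abs]
    _ ≤ (∑ a ∈ S, |β a| ^ 2) * ∑ a ∈ S, ‖z a‖ ^ 2 := sum_mul_sq_le_sq_mul_sq _ _ _
    _ = (∑ a ∈ S, β a ^ 2) * ∑ a ∈ S, ‖z a‖ ^ 2 := by simp only [sq_abs]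
    _ ≤ _ := by
        refine mul_le_mul_of_nonneg_left (le_trans ?_ hsum) (sum_nonneg fun _ _ => sq_nonneg _)
        exact sum_le_sum_of_subset_of_nonneg hS fun _ _ _ => by positivity

theorem norm_sum_le_of_dyadic {T : ℝ} {U N : ℕ} (f : ℕ → ℂ) (hT : 0 ≤ T)
    (h : ∀ D M : ℕ, U ≤ D → D ≤ M → M ≤ 2 * D → M ≤ N → ‖∑ a ∈ Ioc D M, f a‖ ≤ T) (k : ℕ) :
    ∀ M : ℕ, U ≤ M → M ≤ N → M ≤ 2 ^ k * U → ‖∑ a ∈ Ioc U M, f a‖ ≤ k * T := by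
  induction k with
  | zero =>
    intro M h1 h2 h3
    have : U = M := by omega
    simp [this]
  | succ k ih =>
    intro M h1 h2 h3
    push_cast
    rcases le_total M (2 ^ k * U) with h4 | h4
    · linarith [ih M h1 h2 h4]
    · have h5 : U ≤ 2 ^ k * U := Nat.le_mul_of_pos_left _ (by positivity)
      rw [← sum_Ioc_consecutive f h5 h4]
      have h6 := ih (2 ^ k * U) h5 (h4.trans h2) le_rfl
      have h7 := h (2 ^ k * U) M h5 h4 (by rw [pow_succ] at h3; linarith) h2
      linarith [norm_add_le (∑ a ∈ Ioc U (2 ^ k * U), f a) (∑ a ∈ Ioc (2 ^ k * U) M, f a)]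

theorem abs_sub_cutoff_moebius_mul_zeta_le (U b : ℕ) :
    |((((ArithmeticFunction.moebius : ArithmeticFunction ℤ) : ArithmeticFunction ℝ) -
      cutoff U ((ArithmeticFunction.moebius : ArithmeticFunction ℤ) : ArithmeticFunction ℝ)) *
      ((ArithmeticFunction.zeta : ArithmeticFunction ℕ) : ArithmeticFunction ℝ)) b| ≤
      #b.divisors := by
  rw [ArithmeticFunction.coe_mul_zeta_apply]
  calc _ ≤ ∑ i ∈ b.divisors, (1 : ℝ) := by
        refine (abs_sum_le_sum_abs _ _).trans (sum_le_sum fun p _ => ?_)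
        rw [sub_cutoff_apply]
        split_ifs
        · simp
        · rw [ArithmeticFunction.intCoe_apply]
          exact_mod_cast ArithmeticFunction.abs_moebius_le_one
    _ = _ := by simp

theorem sub_cutoff_mul_zeta_eq_zero {U b : ℕ} (hb : b ≤ U) (F : ArithmeticFunction ℝ) :
    ((F - cutoff U F) *
      ((ArithmeticFunction.zeta : ArithmeticFunction ℕ) : ArithmeticFunction ℝ)) b = 0 := by
  rw [ArithmeticFunction.coe_mul_zeta_apply]
  refine sum_eq_zero fun i hi => ?_
  rw [sub_cutoff_apply, if_pos ((Nat.divisor_le hi).trans hb)]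

theorem arithmeticFunction_sub_apply (F G : ArithmeticFunction ℝ) (n : ℕ) :
    (F - G) n = F n - G n := by
  rw [sub_eq_add_neg, ArithmeticFunction.add_apply, ArithmeticFunction.neg_apply, sub_eq_add_neg]

theorem abs_sub_cutoff_vonMangoldt_le (U a : ℕ) :
    |(ArithmeticFunction.vonMangoldt - cutoff U ArithmeticFunction.vonMangoldt) a| ≤ Real.log a := by
  rw [sub_cutoff_apply]
  split_ifs
  · simpa using Real.log_natCast_nonneg a
  · rw [abs_of_nonneg ArithmeticFunction.vonMangoldt_nonneg]
    exact ArithmeticFunction.vonMangoldt_le_log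

theorem typeII_sum_le {η : ℝ} {U A B : ℕ} {x : ℝ} (h : PhaseBound η U x) (hη : 1 ≤ η * U)
    (hU : 1 ≤ U) (hUB : U ^ 2 ≤ B) (hBU : B ≤ 32 * U ^ 3) (hx : 2 ^ 24 * (U : ℝ) ^ 11 ≤ x ^ 2)
    (F G : ArithmeticFunction ℝ) (hF : ∀ a, |F a| ≤ Real.log a) (hF0 : ∀ a, a ≤ U → F a = 0)
    (hG : ∀ b, |G b| ≤ #b.divisors) (hG0 : ∀ b, b ≤ U → G b = 0) :
    ‖∑ n ∈ Ioc A B, ((F * G) n : ℂ) * eu (x / n)‖ ≤ 4 * √η * B * (1 + Real.log B) ^ 4 := by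
  have hU' : (1 : ℝ) ≤ U := by exact_mod_cast hU
  have hη0 : 0 ≤ η := by by_contra! hc; nlinarith
  have hB1 : 1 ≤ B := (Nat.one_le_pow _ _ hU).trans hUB
  have hB1' : (1 : ℝ) ≤ B := by exact_mod_cast hB1
  have hl : 0 ≤ Real.log B := Real.log_natCast_nonneg B
  set T : ℝ := 2 * √η * B * (1 + Real.log B) ^ 3 with hT
  have hUN : U ≤ B / U := by rw [Nat.le_div_iff_mul_le hU]; linarith [sq U]
  rw [sum_dirichlet_mul_eq]
  set f : ℕ → ℂ := fun a => (F a : ℂ) * ∑ b ∈ Ioc (A / a) (B / a),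
    (G b : ℂ) * eu (x / ((a * b : ℕ) : ℝ)) with hf
  have h1 : ∑ a ∈ Ioc 0 B, f a = ∑ a ∈ Ioc U (B / U), f a := by
    symm
    refine sum_subset (Ioc_subset_Ioc (Nat.zero_le _) (Nat.div_le_self _ _)) fun a ha hna => ?_
    rw [mem_Ioc] at ha hna
    rcases le_or_gt a U with h2 | h2
    · simp [hf, hF0 a h2]
    · have h3 : B / U < a := by by_contra! hc; exact hna ⟨h2, hc⟩
      have h4 : B / a ≤ U := by
        rw [Nat.div_lt_iff_lt_mul hU] at h3
        exact Nat.div_le_of_le_mul (by linarith)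
      refine mul_eq_zero_of_right _ (sum_eq_zero fun b hb => ?_)
      rw [mem_Ioc] at hb
      rw [hG0 b (hb.2.trans h4)]; simp
  rw [h1]
  have key : ∀ D M : ℕ, U ≤ D → D ≤ M → M ≤ 2 * D → M ≤ B / U → ‖∑ a ∈ Ioc D M, f a‖ ≤ T := by
    intro D M hUD hDM hM2 hMN
    have hD0 : 0 < D := by omega
    have hD0' : (0 : ℝ) < D := by exact_mod_cast hD0
    have hUD' : (U : ℝ) ≤ D := by exact_mod_cast hUD
    have hDη : (D : ℝ) ≤ η * B := by
      have h2 : D * U ≤ B := by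
        rw [← Nat.le_div_iff_mul_le hU]; omega
      have h3 : (D : ℝ) * U ≤ B := by exact_mod_cast h2
      nlinarith
    have hBx : (B : ℝ) ^ 4 ≤ x ^ 2 * D := by
      have h2 : (B : ℝ) ≤ 32 * (U : ℝ) ^ 3 := by exact_mod_cast hBU
      calc (B : ℝ) ^ 4 ≤ (32 * (U : ℝ) ^ 3) ^ 4 := by gcongr
        _ = 2 ^ 20 * (U : ℝ) ^ 11 * U := by ring
        _ ≤ x ^ 2 * D := by
          have : (0 : ℝ) ≤ (U : ℝ) ^ 11 := by positivity
          gcongr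
          linarith
    have h2 := norm_bilinear_sq_le (A := A) h hη0 hU hUD hBx (Ioc D M)
      (Ioc_subset_Ioc le_rfl hM2) (fun b => G b) (fun a => F a)
    have h3 : ∑ a ∈ Ioc D M, F a ^ 2 ≤ D * Real.log B ^ 2 := by
      calc ∑ a ∈ Ioc D M, F a ^ 2 ≤ ∑ a ∈ Ioc D M, Real.log B ^ 2 := by
            refine sum_le_sum fun a ha => ?_
            rw [mem_Ioc] at ha
            rw [← sq_abs]
            have h5 : Real.log a ≤ Real.log B := by
              have h6 : a ≤ B := ha.2.trans (hMN.trans (Nat.div_le_self _ _))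
              have h7 : 0 < a := by omega
              gcongr
            have := (hF a).trans h5
            gcongr
        _ = ((M - D : ℕ) : ℝ) * Real.log B ^ 2 := by simp
        _ ≤ D * Real.log B ^ 2 := by
          gcongr
          omega
    have h4 : ∑ b ∈ Ioc 0 (B / D), G b ^ 2 ≤ B / D * (1 + Real.log B) ^ 3 := by
      calc ∑ b ∈ Ioc 0 (B / D), G b ^ 2 ≤ ∑ b ∈ Ioc 0 (B / D), (#b.divisors : ℝ) ^ 2 := by
            refine sum_le_sum fun b _ => ?_
            rw [← sq_abs]
            have := hG b
            gcongr
        _ ≤ (B / D : ℕ) * (1 + Real.log (B / D : ℕ)) ^ 3 := sum_card_divisors_sq_le _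
        _ ≤ B / D * (1 + Real.log B) ^ 3 := by
          have h5 : 1 ≤ B / D := by
            rw [Nat.one_le_div_iff hD0]
            exact hDM.trans (hMN.trans (Nat.div_le_self _ _))
          have h6 : Real.log (B / D : ℕ) ≤ Real.log B := by
            have : B / D ≤ B := Nat.div_le_self _ _
            gcongr
          have h7 : 0 ≤ Real.log (B / D : ℕ) := Real.log_natCast_nonneg _
          have h8 : ((B / D : ℕ) : ℝ) ≤ B / D := Nat.cast_div_le
          gcongr
    have hT0 : 0 ≤ T := by positivity
    refine le_of_sq_le_sq ?_ hT0
    refine h2.trans ?_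
    calc _ ≤ (D * Real.log B ^ 2) * ((η * B + η * B) * (B / D * (1 + Real.log B) ^ 3)) := by
          gcongr
      _ = 2 * η * B ^ 2 * (Real.log B ^ 2 * (1 + Real.log B) ^ 3) := by
        field_simp
        ring
      _ ≤ 2 * η * B ^ 2 * ((1 + Real.log B) ^ 3 * (1 + Real.log B) ^ 3) := by
        have : Real.log B ^ 2 ≤ (1 + Real.log B) ^ 3 := by
          nlinarith [pow_nonneg hl 3]
        gcongr
      _ ≤ 4 * η * B ^ 2 * ((1 + Real.log B) ^ 3 * (1 + Real.log B) ^ 3) := by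
        gcongr
        norm_num
      _ = T ^ 2 := by
        rw [hT, mul_pow, mul_pow, mul_pow, Real.sq_sqrt hη0]; ring
  set k := Nat.log 2 (B / U) + 1 with hk
  have hk1 : B / U ≤ 2 ^ k * U := by
    have := Nat.lt_pow_succ_log_self (b := 2) (by norm_num) (B / U)
    calc B / U ≤ 2 ^ k * 1 := by rw [hk, mul_one]; exact this.le
      _ ≤ _ := Nat.mul_le_mul_left _ hU
  refine (norm_sum_le_of_dyadic f (by positivity) key k (B / U) hUN le_rfl hk1).trans ?_
  have hk2 : (k : ℝ) ≤ 2 * (1 + Real.log B) := by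
    have h2 : Nat.log 2 (B / U) ≤ Nat.log 2 B := Nat.log_mono_right (Nat.div_le_self _ _)
    have h3 : (2 : ℝ) ^ Nat.log 2 B ≤ B := by
      exact_mod_cast Nat.pow_log_le_self 2 (by omega)
    have h4 : (Nat.log 2 B : ℝ) * Real.log 2 ≤ Real.log B := by
      rw [← Real.log_pow]
      exact Real.log_le_log (by positivity) h3
    have h5 : (Nat.log 2 (B / U) : ℝ) ≤ Nat.log 2 B := by exact_mod_cast h2
    have h6 := Real.log_two_gt_d9
    rw [hk]; push_cast
    have h7 : (0 : ℝ) ≤ Nat.log 2 B := by positivity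
    nlinarith
  calc (k : ℝ) * T ≤ 2 * (1 + Real.log B) * T := by gcongr
    _ = _ := by rw [hT]; ring

theorem norm_sum_vonMangoldt_le {η : ℝ} {U A B : ℕ} {x : ℝ} (h : PhaseBound η U x)
    (hη : 1 ≤ η * U) (hη1 : η ≤ 1) (hU : 1 ≤ U) (hUA : U ^ 3 ≤ A) (hAB : A ≤ B)
    (hBA : B ≤ 4 * A) (hBU : B ≤ 32 * U ^ 3) (hx : 2 ^ 24 * (U : ℝ) ^ 11 ≤ x ^ 2) :
    ‖∑ n ∈ Ioc A B, (ArithmeticFunction.vonMangoldt n : ℂ) * eu (x / n)‖ ≤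
      18 * √η * B * (1 + Real.log B) ^ 4 := by
  have hU' : (1 : ℝ) ≤ U := by exact_mod_cast hU
  have hη0 : 0 ≤ η := by by_contra! hc; nlinarith
  have hUA1 : U ≤ A := (Nat.le_self_pow (by norm_num) U).trans hUA
  have hB1 : 1 ≤ B := by omega
  have hB1' : (1 : ℝ) ≤ B := by exact_mod_cast hB1
  have hl : 0 ≤ Real.log B := Real.log_natCast_nonneg B
  have hU2B : U ^ 2 ≤ B := by
    refine le_trans ?_ (hUA.trans hAB)
    exact Nat.pow_le_pow_right hU (by norm_num)
  have hx9 : 2 ^ 24 * (U : ℝ) ^ 9 ≤ x ^ 2 := by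
    refine le_trans ?_ hx
    have : (U : ℝ) ^ 9 ≤ (U : ℝ) ^ 11 := pow_le_pow_right₀ hU' (by norm_num)
    linarith
  have hI := fun a (ha : 1 ≤ a) (haU : a ≤ U ^ 2) =>
    typeI_inner_le h hη0 hUA hAB hBA hBU hU hx9 ha haU
  set M : ArithmeticFunction ℝ :=
    ((ArithmeticFunction.moebius : ArithmeticFunction ℤ) : ArithmeticFunction ℝ) with hM
  set Z : ArithmeticFunction ℝ :=
    ((ArithmeticFunction.zeta : ArithmeticFunction ℕ) : ArithmeticFunction ℝ) with hZ
  have h0 : ∑ n ∈ Ioc A B, (cutoff U ArithmeticFunction.vonMangoldt n : ℂ) * eu (x / n) = 0 := by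
    refine sum_eq_zero fun n hn => ?_
    rw [mem_Ioc] at hn
    rw [cutoff_apply, if_neg (by omega)]; simp
  have h1 : ‖∑ n ∈ Ioc A B, ((cutoff U M * ArithmeticFunction.log) n : ℂ) * eu (x / n)‖ ≤
      7 * η * B * (1 + Real.log B) ^ 2 := by
    rw [sum_dirichlet_mul_eq]
    refine (typeI_sum_le (U := U) (K := 1) (L := 7 * η * B * Real.log B) _ _ zero_le_one
      (by positivity) (fun a _ _ => abs_cutoff_moebius_le U a) (fun a ha => ?_)
      (fun a ha haB haU => ?_)).trans ?_
    · rw [cutoff_apply, if_neg]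
      have : U ≤ U ^ 2 := Nat.le_self_pow (by norm_num) U
      omega
    · have h2 : 1 ≤ A / a := by
        rw [Nat.one_le_div_iff ha]
        calc a ≤ U ^ 2 := haU
          _ ≤ U ^ 3 := Nat.pow_le_pow_right hU (by norm_num)
          _ ≤ A := hUA
      have h3 := norm_sum_log_mul_le (fun b => eu (x / ((a * b : ℕ) : ℝ))) (7 * η * B * (1 / a))
        (A / a) (B / a) h2 (Nat.div_le_div_right hAB) (fun C h4 h5 => hI a ha haU C h4 h5)
      refine h3.trans ?_
      have h6 : Real.log (B / a : ℕ) ≤ Real.log B := by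
        have h7 : B / a ≤ B := Nat.div_le_self _ _
        have h8 : 1 ≤ B / a := h2.trans (Nat.div_le_div_right hAB)
        gcongr
      calc _ ≤ 7 * η * B * (1 / a) * Real.log B := by gcongr
        _ = _ := by ring
    · have h9 : 0 ≤ 7 * η * B := by positivity
      nlinarith [mul_nonneg h9 hl]
  have h2 : ‖∑ n ∈ Ioc A B, ((cutoff U M * cutoff U ArithmeticFunction.vonMangoldt * Z) n : ℂ) *
      eu (x / n)‖ ≤ 7 * η * B * (1 + Real.log B) ^ 2 := by
    rw [sum_dirichlet_mul_eq]
    refine (typeI_sum_le (U := U) (K := Real.log B) (L := 7 * η * B) _ _ hl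
      (by positivity) (fun a ha haB => (abs_cutoff_mul_cutoff_le U a).trans ?_)
      (fun a ha => cutoff_mul_cutoff_eq_zero U a ha _ _)
      (fun a ha haB haU => ?_)).trans ?_
    · gcongr
    · have h3 := hI a ha haU (A / a) le_rfl (Nat.div_le_div_right hAB)
      convert h3 using 3 with b hb
      rw [mem_Ioc] at hb
      rw [hZ, ArithmeticFunction.natCoe_apply, ArithmeticFunction.zeta_apply,
        if_neg ((Nat.zero_le _).trans_lt hb.1).ne']
      simp
    · have h9 : 0 ≤ 7 * η * B := by positivity
      nlinarith [mul_nonneg h9 hl]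
  have h3 := typeII_sum_le (A := A) h hη hU hU2B hBU hx
    (ArithmeticFunction.vonMangoldt - cutoff U ArithmeticFunction.vonMangoldt)
    ((M - cutoff U M) * Z) (abs_sub_cutoff_vonMangoldt_le U)
    (fun a ha => by rw [sub_cutoff_apply, if_pos ha])
    (abs_sub_cutoff_moebius_mul_zeta_le U) (fun b hb => sub_cutoff_mul_zeta_eq_zero hb M)
  have h4 : ∑ n ∈ Ioc A B, (ArithmeticFunction.vonMangoldt n : ℂ) * eu (x / n) =
      ∑ n ∈ Ioc A B, (cutoff U ArithmeticFunction.vonMangoldt n : ℂ) * eu (x / n) +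
      ∑ n ∈ Ioc A B, ((cutoff U M * ArithmeticFunction.log) n : ℂ) * eu (x / n) -
      ∑ n ∈ Ioc A B, ((cutoff U M * cutoff U ArithmeticFunction.vonMangoldt * Z) n : ℂ) *
        eu (x / n) +
      ∑ n ∈ Ioc A B, (((ArithmeticFunction.vonMangoldt -
        cutoff U ArithmeticFunction.vonMangoldt) * ((M - cutoff U M) * Z)) n : ℂ) * eu (x / n) := by
    rw [← sum_add_distrib, ← sum_sub_distrib, ← sum_add_distrib]
    refine sum_congr rfl fun n _ => ?_
    have h5 := congrArg (fun F : ArithmeticFunction ℝ => ((F n : ℝ) : ℂ)) (vaughan_identity U)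
    simp only [ArithmeticFunction.add_apply, arithmeticFunction_sub_apply _ (_ * _ * _)] at h5
    rw [h5]
    push_cast
    ring
  rw [h4, h0, zero_add]
  have hsq : η ≤ √η := Real.le_sqrt_of_sq_le (by nlinarith)
  have h5 : 14 * η * B * (1 + Real.log B) ^ 2 ≤ 14 * √η * B * (1 + Real.log B) ^ 4 := by
    have : (1 + Real.log B) ^ 2 ≤ (1 + Real.log B) ^ 4 :=
      pow_le_pow_right₀ (by linarith) (by norm_num)
    gcongr
  refine (norm_add_le _ _).trans ((add_le_add_left (norm_sub_le _ _) _).trans ?_)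
  linarith

theorem norm_sum_prime_sub_vonMangoldt_le {A B : ℕ} (hB : 1 ≤ B) (z : ℕ → ℂ)
    (hz : ∀ n, ‖z n‖ ≤ 1) :
    ‖∑ n ∈ Ioc A B, (ArithmeticFunction.vonMangoldt n : ℂ) * z n -
      ∑ p ∈ Ioc A B with p.Prime, (Real.log p : ℂ) * z p‖ ≤ 2 * √B * Real.log B := by
  have h0 : ∀ n, 0 ≤ ArithmeticFunction.vonMangoldt n - (if n.Prime then Real.log n else 0) := by
    intro n
    split_ifs with h
    · rw [ArithmeticFunction.vonMangoldt_apply_prime h]; simp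
    · simpa only [sub_zero] using ArithmeticFunction.vonMangoldt_nonneg
  have h1 : ∑ n ∈ Ioc A B, (ArithmeticFunction.vonMangoldt n : ℂ) * z n -
      ∑ p ∈ Ioc A B with p.Prime, (Real.log p : ℂ) * z p =
      ∑ n ∈ Ioc A B, ((ArithmeticFunction.vonMangoldt n -
        (if n.Prime then Real.log n else 0) : ℝ) : ℂ) * z n := by
    rw [sum_filter, ← sum_sub_distrib]
    refine sum_congr rfl fun n _ => ?_
    split_ifs <;> push_cast <;> ring
  rw [h1]
  have hB' : (1 : ℝ) ≤ B := by exact_mod_cast hB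
  calc _ ≤ ∑ n ∈ Ioc A B, (ArithmeticFunction.vonMangoldt n -
        (if n.Prime then Real.log n else 0)) := by
        refine norm_sum_le_of_le _ fun n _ => ?_
        rw [norm_mul, Complex.norm_real, Real.norm_eq_abs, abs_of_nonneg (h0 n)]
        exact mul_le_of_le_one_right (h0 n) (hz n)
    _ ≤ ∑ n ∈ Ioc 0 B, (ArithmeticFunction.vonMangoldt n -
        (if n.Prime then Real.log n else 0)) :=
        sum_le_sum_of_subset_of_nonneg (Ioc_subset_Ioc (Nat.zero_le _) le_rfl)
          fun n _ _ => h0 n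
    _ = Chebyshev.psi B - Chebyshev.theta B := by
        rw [sum_sub_distrib, Chebyshev.psi, Chebyshev.theta, Nat.floor_natCast, sum_filter]
    _ ≤ _ := Chebyshev.psi_sub_theta_le hB'

theorem phaseBound_of_log_le {w U : ℕ} {x η : ℝ} (hw : 2 ≤ w)
    (hl : 10 ^ 20 * (w : ℝ) ^ 2 ≤ Real.log U) (hx : Real.log |x| ≤ w * Real.log U)
    (hη : 10 * Real.exp (-(Real.log U / (10 ^ 17 * (w : ℝ) ^ 2))) ≤ η) :
    PhaseBound η U x := by
  intro D A B hUD hDA hAB hBD y hy hyx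
  have hw' : (2 : ℝ) ≤ w := by exact_mod_cast hw
  have hl0 : 0 < Real.log U := lt_of_lt_of_le (by positivity) hl
  have hU0 : 0 < U := by
    by_contra! hc
    have : U = 0 := by omega
    simp [this] at hl0
  have hU0' : (0 : ℝ) < U := by exact_mod_cast hU0
  have hD0' : (0 : ℝ) < D := by exact_mod_cast hU0.trans_le hUD
  have hUD' : Real.log U ≤ Real.log D := by gcongr
  have hy0 : y ≠ 0 := by
    rintro rfl
    have : (0 : ℝ) < (D : ℝ) ^ 3 := by positivity
    simp at hy; linarith
  have hy0' : 0 < |y| := abs_pos.mpr hy0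
  have h1 : Real.exp (3 / 2 * Real.log D) ≤ |y| := by
    refine le_of_sq_le_sq ?_ hy0'.le
    rw [sq_abs, ← Real.exp_nat_mul]
    have : ((2 : ℕ) : ℝ) * (3 / 2 * Real.log D) = Real.log ((D : ℝ) ^ 3) := by
      rw [Real.log_pow]; push_cast; ring
    rw [this, Real.exp_log (by positivity)]
    exact hy
  have h2 : |y| ≤ Real.exp (w * Real.log D) := by
    rw [← Real.log_le_iff_le_exp hy0']
    calc Real.log |y| ≤ Real.log |x| := by gcongr
      _ ≤ w * Real.log U := hx
      _ ≤ _ := by gcongr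
  refine (norm_sum_eu_div_le hw (hl.trans hUD') hDA hAB hBD h1 h2).trans ?_
  have h3 : Real.exp (-(Real.log D / (10 ^ 17 * (w : ℝ) ^ 2))) ≤
      Real.exp (-(Real.log U / (10 ^ 17 * (w : ℝ) ^ 2))) := by
    gcongr
  calc _ = (10 * Real.exp (-(Real.log D / (10 ^ 17 * (w : ℝ) ^ 2)))) * D := by ring
    _ ≤ η * D := by gcongr; linarith

set_option maxHeartbeats 1000000 in
open Filter Topology in
/-- Equidistribution of `x / p` over the primes in short dyadic ranges. -/
theorem exists_norm_sum_prime_le {ε δ : ℝ} (hε : 0 < ε) (hδ : 0 < δ) :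
    ∃ n₀ : ℕ, ∀ n : ℕ, n₀ ≤ n → ∀ m : ℕ,
      Real.exp (Real.log n ^ ((2 : ℝ) / 3 + ε)) ≤ m → m ≤ n →
      ∀ (x : ℝ) (A B : ℕ), Real.exp (19 / 10 * Real.log m) ≤ |x| → |x| ≤ 100 * n →
      m ≤ A → A ≤ B → B ≤ 4 * m →
      ‖∑ p ∈ Ioc A B with p.Prime, (Real.log p : ℂ) * eu (x / p)‖ ≤ δ * m := by
  have hpow : ∀ s : ℝ, 0 < s → Tendsto (fun L : ℝ => L ^ s) atTop atTop :=
    fun s hs => tendsto_rpow_atTop hs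
  have hlim : Tendsto (fun L : ℝ => (L ^ (3 * ε)) ^ (4 / (3 * ε)) *
      Real.exp (-(1 / (2048 * 10 ^ 17)) * (L ^ (3 * ε)))) atTop (𝓝 0) :=
    (tendsto_rpow_mul_exp_neg_mul_atTop_nhds_zero (4 / (3 * ε)) (1 / (2048 * 10 ^ 17))
      (by norm_num)).comp (hpow _ (by positivity))
  have hlim2 : Tendsto (fun L : ℝ => (L ^ ((2 : ℝ) / 3)) ^ ((3 : ℝ) / 2) *
      Real.exp (-(1 / 2) * (L ^ ((2 : ℝ) / 3)))) atTop (𝓝 0) :=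
    (tendsto_rpow_mul_exp_neg_mul_atTop_nhds_zero (3 / 2) (1 / 2)
      (by norm_num)).comp (hpow _ (by positivity))
  have hev : ∀ᶠ L : ℝ in atTop, 10 ≤ L ∧ 200 ≤ L ^ ((2 : ℝ) / 3) ∧
      10 ^ 20 * 1024 ≤ L ^ (3 * ε) ∧
      (L ^ (3 * ε)) ^ (4 / (3 * ε)) * Real.exp (-(1 / (2048 * 10 ^ 17)) * (L ^ (3 * ε))) <
        δ / 200000 ∧
      (L ^ ((2 : ℝ) / 3)) ^ ((3 : ℝ) / 2) * Real.exp (-(1 / 2) * (L ^ ((2 : ℝ) / 3))) < δ / 20 := by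
    filter_upwards [eventually_ge_atTop 10, (hpow ((2 : ℝ) / 3) (by norm_num)).eventually_ge_atTop 200,
      (hpow (3 * ε) (by positivity)).eventually_ge_atTop (10 ^ 20 * 1024),
      hlim.eventually_lt_const (show (0 : ℝ) < δ / 200000 by positivity),
      hlim2.eventually_lt_const (show (0 : ℝ) < δ / 20 by positivity)] with L h1 h2 h3 h4 h5
    exact ⟨h1, h2, h3, h4, h5⟩
  have hev' := (Real.tendsto_log_atTop.comp tendsto_natCast_atTop_atTop).eventually hev
  obtain ⟨n₀, hn₀⟩ := eventually_atTop.mp hev'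
  refine ⟨n₀, fun n hn m hm hmn x A B hx1 hx2 hmA hAB hB4 => ?_⟩
  obtain ⟨hL10, hL23, hL3, h4, h5⟩ := hn₀ n hn
  simp only [Function.comp] at hL10 hL23 hL3 h4 h5
  obtain ⟨L, hL⟩ : ∃ L, L = Real.log n := ⟨_, rfl⟩
  rw [← hL] at hL10 hL23 hL3 h4 h5 hm
  have hL0 : 0 < L := by linarith
  have hm0 : (0 : ℝ) < m := (Real.exp_pos _).trans_le hm
  have hn0 : (0 : ℝ) < n := hm0.trans_le (by exact_mod_cast hmn)
  obtain ⟨M, hM⟩ : ∃ M, M = Real.log m := ⟨_, rfl⟩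
  have hmM : (m : ℝ) = Real.exp M := by rw [hM, Real.exp_log hm0]
  have hML : M ≤ L := by rw [hM, hL]; gcongr
  have hLM : L ^ ((2 : ℝ) / 3 + ε) ≤ M := by rwa [hmM, Real.exp_le_exp] at hm
  have hLM2 : L ^ ((2 : ℝ) / 3) ≤ M := by
    refine le_trans ?_ hLM
    exact Real.rpow_le_rpow_of_exponent_le (by linarith) (by linarith)
  have hM200 : 200 ≤ M := hL23.trans hLM2
  have hM0 : 0 < M := by linarith
  rw [← hM] at hx1
  obtain ⟨κ, hκ⟩ : ∃ κ, κ = L ^ (3 * ε) := ⟨_, rfl⟩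
  rw [← hκ] at hL3 h4
  have hκM : κ * L ^ 2 ≤ M ^ 3 := by
    have e1 : κ * L ^ 2 = (L ^ ((2 : ℝ) / 3 + ε)) ^ (3 : ℕ) := by
      rw [← Real.rpow_natCast (L ^ ((2 : ℝ) / 3 + ε)), ← Real.rpow_mul hL0.le, hκ,
        ← Real.rpow_natCast L, ← Real.rpow_add hL0]
      congr 1; push_cast; ring
    rw [e1]
    gcongr
  have hκ0 : 0 < κ := by linarith
  -- the parameter `w`
  obtain ⟨w, hw1, hw2⟩ : ∃ w : ℕ, 8 * L / M ≤ w ∧ (w : ℝ) ≤ 16 * L / M := by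
    refine ⟨⌈8 * L / M⌉₊, Nat.le_ceil _, ?_⟩
    have e1 := (Nat.ceil_lt_add_one (show 0 ≤ 8 * L / M by positivity)).le
    have e2 : 1 ≤ 8 * L / M := by rw [le_div_iff₀ hM0]; linarith
    calc _ ≤ 8 * L / M + 8 * L / M := by linarith
      _ = _ := by ring
  have hw8 : (8 : ℝ) ≤ w := by
    refine le_trans ?_ hw1
    rw [le_div_iff₀ hM0]; linarith
  have hwM : (w : ℝ) ^ 2 * κ ≤ 256 * M := by
    rw [le_div_iff₀ hM0] at hw2
    have e1 : (w * M) ^ 2 ≤ (16 * L) ^ 2 := by gcongr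
    have e2 : (w : ℝ) ^ 2 * κ * (M ^ 2 * L ^ 2) ≤ 256 * M * (M ^ 2 * L ^ 2) := by
      calc (w : ℝ) ^ 2 * κ * (M ^ 2 * L ^ 2) = (w * M) ^ 2 * (κ * L ^ 2) := by ring
        _ ≤ (16 * L) ^ 2 * M ^ 3 := by gcongr
        _ = _ := by ring
    exact le_of_mul_le_mul_right e2 (by positivity)
  -- the parameter `U`
  obtain ⟨U, hU1, hU2⟩ : ∃ U : ℕ, (U : ℝ) ≤ Real.exp (M / 3) ∧ Real.exp (M / 3) < U + 1 :=
    ⟨⌊Real.exp (M / 3)⌋₊, Nat.floor_le (by positivity), Nat.lt_floor_add_one _⟩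
  have hU3 : Real.exp (M / 4) ≤ U := by
    have e1 : Real.exp (M / 3) = Real.exp (M / 4) * Real.exp (M / 12) := by
      rw [← Real.exp_add]; congr 1; ring
    have e2 : 2 ≤ Real.exp (M / 12) := by linarith [Real.add_one_le_exp (M / 12)]
    have e3 : 1 ≤ Real.exp (M / 4) := Real.one_le_exp (by positivity)
    nlinarith
  have hUpos : (1 : ℝ) ≤ U := (Real.one_le_exp (by positivity)).trans hU3
  have hUpos' : 1 ≤ U := by exact_mod_cast hUpos
  have hUlog : M / 4 ≤ Real.log U := by rwa [Real.le_log_iff_exp_le (by linarith)]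
  have hU3m : U ^ 3 ≤ m := by
    have : (U : ℝ) ^ 3 ≤ (m : ℝ) := by
      calc (U : ℝ) ^ 3 ≤ Real.exp (M / 3) ^ 3 := by gcongr
        _ = (m : ℝ) := by rw [← Real.exp_nat_mul, hmM]; congr 1; push_cast; ring
    exact_mod_cast this
  have hmU : m ≤ 8 * U ^ 3 := by
    have : (m : ℝ) ≤ 8 * (U : ℝ) ^ 3 := by
      calc (m : ℝ) = Real.exp (M / 3) ^ 3 := by
            rw [← Real.exp_nat_mul, hmM]; congr 1; push_cast; ring
        _ ≤ (2 * U) ^ 3 := by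
          gcongr
          linarith
        _ = _ := by ring
    exact_mod_cast this
  obtain ⟨η, hη⟩ : ∃ η, η = 10 * Real.exp (-(1 / (1024 * 10 ^ 17)) * κ) := ⟨_, rfl⟩
  have hMw : κ / 1024 ≤ M / 4 / (w : ℝ) ^ 2 := by
    rw [le_div_iff₀ (by positivity)]; linarith
  have hx0 : 0 < |x| := (Real.exp_pos _).trans_le hx1
  have hP : PhaseBound η U x := by
    refine phaseBound_of_log_le (w := w) (by exact_mod_cast (by linarith : (2 : ℝ) ≤ w)) ?_ ?_ ?_
    · refine le_trans ?_ hUlog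
      rw [← le_div_iff₀ (by positivity)]
      linarith
    · calc Real.log |x| ≤ Real.log (100 * n) := by gcongr
        _ = Real.log 100 + L := by rw [Real.log_mul (by norm_num) hn0.ne', hL]
        _ ≤ 2 * L := by
          have : Real.log 100 ≤ 10 := by
            rw [Real.log_le_iff_le_exp (by norm_num)]
            have := Real.add_one_le_exp (5 : ℝ)
            have h10 : Real.exp 10 = Real.exp 5 ^ 2 := by rw [← Real.exp_nat_mul]; norm_num
            have h5 : (5 + 1 : ℝ) ≤ Real.exp 5 := this
            have h25 : Real.exp 5 = Real.exp (5 / 2) ^ 2 := by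
              rw [← Real.exp_nat_mul]; norm_num
            have h7 := Real.add_one_le_exp ((5 : ℝ) / 2)
            rw [h10, h25]
            nlinarith [sq_nonneg (Real.exp (5 / 2) - 7 / 2)]
          linarith
        _ = 8 * L / M * (M / 4) := by field_simp; ring
        _ ≤ w * Real.log U := by gcongr
    · rw [hη]
      have : 1 / (1024 * 10 ^ 17) * κ ≤ Real.log U / (10 ^ 17 * (w : ℝ) ^ 2) := by
        calc 1 / (1024 * 10 ^ 17) * κ = κ / 1024 / 10 ^ 17 := by ring
          _ ≤ M / 4 / (w : ℝ) ^ 2 / 10 ^ 17 := by gcongr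
          _ = M / 4 / (10 ^ 17 * (w : ℝ) ^ 2) := by rw [div_div _ _ ((10 : ℝ) ^ 17), mul_comm]
          _ ≤ _ := by gcongr
      gcongr
      linarith
  have hηU : 1 ≤ η * U := by
    have e1 : κ / 1024 ≤ M / 4 := by
      refine hMw.trans (div_le_self (by positivity) ?_)
      nlinarith
    calc (1 : ℝ) ≤ 10 * Real.exp (-(1 / (1024 * 10 ^ 17)) * κ + M / 4) := by
          have e2 : (1 : ℝ) ≤ Real.exp (-(1 / (1024 * 10 ^ 17)) * κ + M / 4) := by
            refine Real.one_le_exp ?_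
            linarith
          linarith only [e2]
      _ = η * Real.exp (M / 4) := by rw [Real.exp_add, hη]; ring
      _ ≤ η * U := by
        have : 0 ≤ η := by rw [hη]; positivity
        gcongr
  have hη1 : η ≤ 1 := by
    have e1 : Real.exp (-(1 / (1024 * 10 ^ 17)) * κ) ≤ Real.exp (-1000) := by
      gcongr
      linarith
    have e2 : Real.exp (-1000) ≤ 1 / 1001 := by
      rw [Real.exp_neg, ← one_div]
      have := Real.add_one_le_exp (1000 : ℝ)
      gcongr
      linarith
    rw [hη]; linarith
  have hxU : 2 ^ 24 * (U : ℝ) ^ 11 ≤ x ^ 2 := by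
    calc 2 ^ 24 * (U : ℝ) ^ 11 ≤ Real.exp 1 ^ 24 * Real.exp (M / 3) ^ 11 := by
          have : (2 : ℝ) ≤ Real.exp 1 := by linarith [Real.add_one_le_exp (1 : ℝ)]
          gcongr
      _ = Real.exp (24 + 11 * M / 3) := by
          rw [← Real.exp_nat_mul, ← Real.exp_nat_mul, ← Real.exp_add]
          congr 1; push_cast; ring
      _ ≤ Real.exp (2 * (19 / 10 * M)) := by gcongr; linarith
      _ = Real.exp (19 / 10 * M) ^ 2 := by rw [← Real.exp_nat_mul]; push_cast; rfl
      _ ≤ |x| ^ 2 := by gcongr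
      _ = x ^ 2 := sq_abs x
  have hmain := norm_sum_vonMangoldt_le hP hηU hη1 hUpos' (hU3m.trans hmA) hAB (by omega)
    (by omega) hxU
  have hB1 : 1 ≤ B := hUpos'.trans ((Nat.le_self_pow (by norm_num) U).trans
    (hU3m.trans (hmA.trans hAB)))
  have hsub := norm_sum_prime_sub_vonMangoldt_le (A := A) hB1 (fun n => eu (x / n))
    (fun n => by simp)
  have hBm : (B : ℝ) ≤ 4 * m := by exact_mod_cast hB4
  have hB0 : (0 : ℝ) < B := by exact_mod_cast hB1
  have hlogB : Real.log B ≤ 2 + L := by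
    calc Real.log B ≤ Real.log (4 * m) := by gcongr
      _ = Real.log 4 + M := by rw [Real.log_mul (by norm_num) hm0.ne', hM]
      _ ≤ 2 + L := by
        have : Real.log 4 ≤ 2 := by
          rw [Real.log_le_iff_le_exp (by norm_num)]
          have h10 : Real.exp 2 = Real.exp 1 ^ 2 := by rw [← Real.exp_nat_mul]; norm_num
          nlinarith [Real.add_one_le_exp (1 : ℝ)]
        linarith
  have hlogB0 : 0 ≤ Real.log B := Real.log_natCast_nonneg B
  have hsq : √η ≤ 4 * Real.exp (-(1 / (2048 * 10 ^ 17)) * κ) := by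
    refine Real.sqrt_le_iff.mpr ⟨by positivity, ?_⟩
    rw [mul_pow, ← Real.exp_nat_mul, hη]
    have : ((2 : ℕ) : ℝ) * (-(1 / (2048 * 10 ^ 17)) * κ) = -(1 / (1024 * 10 ^ 17)) * κ := by
      push_cast; ring
    rw [this]
    have := Real.exp_pos (-(1 / (1024 * 10 ^ 17)) * κ)
    linarith
  have hκL : κ ^ (4 / (3 * ε)) = L ^ 4 := by
    rw [hκ, ← Real.rpow_mul hL0.le, ← Real.rpow_natCast]
    congr 1; push_cast; field_simp
  have hLL : (L ^ ((2 : ℝ) / 3)) ^ ((3 : ℝ) / 2) = L := by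
    rw [← Real.rpow_mul hL0.le]; norm_num
  rw [hκL] at h4
  rw [hLL] at h5
  have hb1 : 18 * √η * B * (1 + Real.log B) ^ 4 ≤ δ / 2 * m := by
    calc 18 * √η * B * (1 + Real.log B) ^ 4 ≤
        18 * (4 * Real.exp (-(1 / (2048 * 10 ^ 17)) * κ)) * (4 * m) * (2 * L) ^ 4 := by
          gcongr
          linarith
      _ = 4608 * m * (L ^ 4 * Real.exp (-(1 / (2048 * 10 ^ 17)) * κ)) := by ring
      _ ≤ 4608 * m * (δ / 200000) := by gcongr
      _ ≤ δ / 2 * m := by nlinarith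
  have hb2 : 2 * √B * Real.log B ≤ δ / 2 * m := by
    have e0 : √m = Real.exp (M / 2) := by
      rw [hmM, ← Real.exp_half]
    have e1 : √B ≤ 2 * √m := by
      rw [show (2 : ℝ) * √m = √(4 * m) by
        rw [Real.sqrt_mul (by norm_num), show (4 : ℝ) = 2 ^ 2 by norm_num,
          Real.sqrt_sq (by norm_num)]]
      exact Real.sqrt_le_sqrt hBm
    have e2 : L ≤ δ / 20 * √m := by
      rw [e0]
      have e3 : L ≤ δ / 20 * Real.exp (1 / 2 * L ^ ((2 : ℝ) / 3)) := by
        have e4 : -(1 / 2) * L ^ ((2 : ℝ) / 3) = -(1 / 2 * L ^ ((2 : ℝ) / 3)) := by ring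
        rw [e4, Real.exp_neg, ← div_eq_mul_inv, div_lt_iff₀ (Real.exp_pos _)] at h5
        exact h5.le
      refine e3.trans ?_
      gcongr
      linarith
    calc 2 * √B * Real.log B ≤ 2 * (2 * √m) * (2 * L) := by
          gcongr
          linarith
      _ = 8 * √m * L := by ring
      _ ≤ 8 * √m * (δ / 20 * √m) := by gcongr
      _ = 8 / 20 * δ * (√m * √m) := by ring
      _ = 8 / 20 * δ * m := by rw [Real.mul_self_sqrt hm0.le]
      _ ≤ _ := by nlinarith
  have htri := norm_sub_norm_le (∑ p ∈ Ioc A B with p.Prime, (Real.log p : ℂ) * eu (x / p))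
    (∑ n ∈ Ioc A B, (ArithmeticFunction.vonMangoldt n : ℂ) * eu (x / n))
  rw [norm_sub_rev] at htri
  linarith

theorem sum_digits_two_le {n k : ℕ} (hnk : n ≤ k) (hk : 1 ≤ k) :
    ((Nat.digits 2 n).sum : ℝ) ≤ 3 / 2 * Real.log k + 1 := by
  have h1 : (Nat.digits 2 n).sum ≤ (Nat.digits 2 n).length := by
    have := List.sum_le_card_nsmul (Nat.digits 2 n) 1 fun x hx => by
      have := Nat.digits_lt_base (by norm_num : 1 < 2) hx
      omega
    simpa using this
  have h2 : (Nat.digits 2 n).length ≤ Nat.log 2 k + 1 := by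
    rcases Nat.eq_zero_or_pos n with rfl | hn
    · simp
    · rw [Nat.length_digits 2 n (by norm_num) hn.ne']
      have := Nat.log_mono_right (b := 2) hnk
      omega
  have h3 : (2 : ℝ) ^ Nat.log 2 k ≤ k := by
    exact_mod_cast Nat.pow_log_le_self 2 (by omega)
  have h4 : (Nat.log 2 k : ℝ) * Real.log 2 ≤ Real.log k := by
    rw [← Real.log_pow]
    exact Real.log_le_log (by positivity) h3
  have h5 := Real.log_two_gt_d9
  have h6 : ((Nat.digits 2 n).sum : ℝ) ≤ Nat.log 2 k + 1 := by exact_mod_cast h1.trans h2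
  have h7 : (0 : ℝ) ≤ Nat.log 2 k := by positivity
  nlinarith

theorem padicValNat_two_descFactorial {n m : ℕ} (hmn : m ≤ n) :
    padicValNat 2 (n.descFactorial m) + (Nat.digits 2 n).sum = m + (Nat.digits 2 (n - m)).sum := by
  have : Fact (Nat.Prime 2) := ⟨Nat.prime_two⟩
  have h1 := sub_one_mul_padicValNat_factorial (p := 2) n
  have h2 := sub_one_mul_padicValNat_factorial (p := 2) (n - m)
  have h3 := congrArg (padicValNat 2) (Nat.factorial_mul_descFactorial hmn)
  rw [padicValNat.mul (Nat.factorial_ne_zero _) (Nat.descFactorial_eq_zero_iff_lt.not.mpr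
    (by omega))] at h3
  have h4 := Nat.digit_sum_le 2 n
  have h5 := Nat.digit_sum_le 2 (n - m)
  omega

/-- Two representations of the same falling factorial have close lengths. -/
theorem sub_le_log_of_descFactorial_eq {n m n' m' : ℕ} (hmn : m ≤ n) (hmn' : m' ≤ n')
    (hn : n' ≤ n) (hn3 : 20 ≤ n) (h : n.descFactorial m = n'.descFactorial m') :
    (m' : ℝ) - m ≤ 4 * Real.log n := by
  have h1 := padicValNat_two_descFactorial hmn
  have h2 := padicValNat_two_descFactorial hmn'
  rw [h] at h1
  have h3 : m' ≤ m + (Nat.digits 2 (n - m)).sum + (Nat.digits 2 n').sum := by omega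
  have h4 := sum_digits_two_le (Nat.sub_le n m) (by omega)
  have h5 := sum_digits_two_le hn (by omega)
  have h6 : (m' : ℝ) ≤ m + (Nat.digits 2 (n - m)).sum + (Nat.digits 2 n').sum := by
    exact_mod_cast h3
  have h7 : 2 ≤ Real.log n := by
    rw [Real.le_log_iff_exp_le (by positivity)]
    have : Real.exp 2 = Real.exp 1 ^ 2 := by rw [← Real.exp_nat_mul]; norm_num
    have h8 := Real.exp_one_lt_d9
    have h9 : (20 : ℝ) ≤ n := by exact_mod_cast hn3
    rw [this]
    nlinarith [Real.exp_pos 1]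
  linarith

theorem descFactorial_mul_pow_le {n n' : ℕ} (hn : n' ≤ n) (m : ℕ) (hm : m ≤ n') :
    n'.descFactorial m * n ^ m ≤ n.descFactorial m * n' ^ m := by
  induction m with
  | zero => simp
  | succ k ih =>
    rw [Nat.descFactorial_succ, Nat.descFactorial_succ, pow_succ, pow_succ]
    have h1 : (n' - k) * n ≤ (n - k) * n' := by
      obtain ⟨a, rfl⟩ := Nat.exists_eq_add_of_le (by omega : k ≤ n')
      obtain ⟨b, rfl⟩ := Nat.exists_eq_add_of_le hn
      have h2 : k + a - k = a := by omega
      have h3 : k + a + b - k = a + b := by omega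
      rw [h2, h3]
      nlinarith
    calc (n' - k) * n'.descFactorial k * (n ^ k * n)
        = ((n' - k) * n) * (n'.descFactorial k * n ^ k) := by ring
      _ ≤ ((n - k) * n') * (n.descFactorial k * n' ^ k) :=
          Nat.mul_le_mul h1 (ih (by omega))
      _ = _ := by ring

theorem descFactorial_add (n a b : ℕ) :
    n.descFactorial (a + b) = n.descFactorial a * (n - a).descFactorial b := by
  induction b with
  | zero => simp
  | succ b ih =>
    rw [← add_assoc, Nat.descFactorial_succ, ih, Nat.descFactorial_succ, Nat.sub_sub]
    ring

theorem descFactorial_pos {n m : ℕ} (h : m ≤ n) : 0 < n.descFactorial m :=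
  Nat.pos_of_ne_zero (Nat.descFactorial_eq_zero_iff_lt.not.mpr (by omega))

/-- Upper bound for the gap between the tops of two representations. -/
theorem mul_sub_le_of_descFactorial_eq {n m n' m' : ℕ} (hmm : m ≤ m') (hmn' : m' ≤ n')
    (hn : n' ≤ n) (hn3 : 20 ≤ n) (h : n.descFactorial m = n'.descFactorial m') :
    (m : ℝ) * ((n : ℝ) - n') ≤ 4 * n * Real.log n ^ 2 := by
  have h1 := descFactorial_mul_pow_le hn m (hmm.trans hmn')
  have hsub := sub_le_log_of_descFactorial_eq ((hmm.trans hmn').trans hn) hmn' hn hn3 h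
  obtain ⟨k, rfl⟩ := Nat.exists_eq_add_of_le hmm
  rw [h, descFactorial_add, mul_assoc] at h1
  have h2 := Nat.le_of_mul_le_mul_left h1 (descFactorial_pos (hmm.trans hmn'))
  have h3 : n ^ m ≤ n ^ k * n' ^ m := by
    refine h2.trans (Nat.mul_le_mul_right _ ?_)
    exact (Nat.descFactorial_le_pow _ _).trans (Nat.pow_le_pow_left (by omega) _)
  have hn0 : (0 : ℝ) < n := by
    have : 0 < n := by omega
    exact_mod_cast this
  have hl : 0 ≤ Real.log n := Real.log_natCast_nonneg n
  rcases Nat.eq_zero_or_pos n' with h0 | hn'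
  · have : m = 0 := by omega
    subst this
    simp only [Nat.cast_zero, zero_mul]; positivity
  have hn0' : (0 : ℝ) < n' := by exact_mod_cast hn'
  have h4 : (m : ℝ) * Real.log n ≤ k * Real.log n + m * Real.log n' := by
    have h5 : ((n : ℝ)) ^ m ≤ (n : ℝ) ^ k * (n' : ℝ) ^ m := by exact_mod_cast h3
    have h6 := Real.log_le_log (by positivity) h5
    rwa [Real.log_mul (by positivity) (by positivity), Real.log_pow, Real.log_pow,
      Real.log_pow] at h6
  have h5 : ((n : ℝ) - n') / n ≤ Real.log n - Real.log n' := by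
    have := Real.log_le_sub_one_of_pos (show (0 : ℝ) < n' / n by positivity)
    rw [Real.log_div hn0'.ne' hn0.ne'] at this
    have e : ((n : ℝ) - n') / n = 1 - n' / n := by field_simp
    rw [e]; linarith
  have h6 : (m : ℝ) * (((n : ℝ) - n') / n) ≤ k * Real.log n := by
    have : (0 : ℝ) ≤ m := by positivity
    nlinarith
  push_cast at hsub
  have h7 : (m : ℝ) * ((n : ℝ) - n') ≤ k * Real.log n * n := by
    have : (m : ℝ) * ((n : ℝ) - n') = (m : ℝ) * (((n : ℝ) - n') / n) * n := by field_simp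
    rw [this]
    gcongr
  calc _ ≤ _ := h7
    _ ≤ (4 * Real.log n) * Real.log n * n := by gcongr; linarith
    _ = _ := by ring

theorem descFactorial_le_exp_mul {n d : ℕ} (m : ℕ) (hm : m + d < n) :
    (n.descFactorial m : ℝ) ≤
      Real.exp (m * (d / ((n : ℝ) - d - m))) * (n - d).descFactorial m := by
  have key : ∀ j ≤ m, (n.descFactorial j : ℝ) ≤
      Real.exp (j * (d / ((n : ℝ) - d - m))) * (n - d).descFactorial j := by
    intro j
    induction j with
    | zero => simp
    | succ j ih =>
      intro hj
      have ih := ih (by omega)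
      rw [Nat.descFactorial_succ, Nat.descFactorial_succ]
      have hc1 : ((n - j : ℕ) : ℝ) = n - j := Nat.cast_sub (by omega)
      have hc2 : ((n - d - j : ℕ) : ℝ) = n - d - j := by
        rw [Nat.cast_sub (by omega), Nat.cast_sub (by omega)]
      have hnm : (m : ℝ) + d < n := by exact_mod_cast hm
      have hjm : (j : ℝ) + 1 ≤ m := by exact_mod_cast hj
      have hd : (0 : ℝ) ≤ d := by positivity
      have h1 : ((n - j : ℕ) : ℝ) ≤ Real.exp (d / ((n : ℝ) - d - m)) * (n - d - j : ℕ) := by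
        rw [hc1, hc2]
        have h2 := Real.add_one_le_exp ((d : ℝ) / ((n : ℝ) - d - m))
        have h3 : (0 : ℝ) < (n : ℝ) - d - j := by linarith
        have h4 : (d : ℝ) ≤ d / ((n : ℝ) - d - m) * ((n : ℝ) - d - j) := by
          rw [div_mul_eq_mul_div, le_div_iff₀ (by linarith)]
          gcongr
          linarith
        nlinarith
      push_cast
      rw [add_mul, one_mul, Real.exp_add]
      calc ((n - j : ℕ) : ℝ) * (n.descFactorial j : ℝ) ≤
          (Real.exp (d / ((n : ℝ) - d - m)) * (n - d - j : ℕ)) *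
          (Real.exp (j * (d / ((n : ℝ) - d - m))) * (n - d).descFactorial j) := by
            gcongr
        _ = _ := by ring
  exact key m le_rfl

/-- Lower bound for the gap between the tops of two representations. -/
theorem le_mul_sub_of_descFactorial_eq {n m n' m' : ℕ} (hmm : m < m') (hmn' : m' < n')
    (hn : n' ≤ n) (hm4 : 4 * m ≤ n) (h4m : 4 ≤ m) (hn3 : 10 ^ 6 ≤ n)
    (h : n.descFactorial m = n'.descFactorial m') :
    n ≤ m * (n - n') := by
  by_contra! hc
  obtain ⟨d, rfl⟩ := Nat.exists_eq_add_of_le hn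
  have hd : n' + d - n' = d := by omega
  rw [hd] at hc
  have hn2 : 20 ≤ n' + d := by omega
  have hsub := sub_le_log_of_descFactorial_eq (by omega) hmn'.le hn hn2 h
  have hlog : Real.log ((n' + d : ℕ) : ℝ) ≤ ((n' + d : ℕ) : ℝ) / 100 := by
    have hnR : (10 : ℝ) ^ 6 ≤ ((n' + d : ℕ) : ℝ) := by exact_mod_cast hn3
    have h1 := Real.log_le_sub_one_of_pos (show 0 < √((n' + d : ℕ) : ℝ) by positivity)
    rw [Real.log_sqrt (by positivity)] at h1
    have h2 : (200 : ℝ) ≤ √((n' + d : ℕ) : ℝ) := Real.le_sqrt_of_sq_le (by linarith)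
    have h3 := Real.mul_self_sqrt (show 0 ≤ ((n' + d : ℕ) : ℝ) by positivity)
    nlinarith
  have hd4 : 4 * d ≤ n' + d := by nlinarith
  obtain ⟨k, rfl⟩ := Nat.exists_eq_add_of_le hmm.le
  obtain ⟨j, rfl⟩ := Nat.exists_eq_add_of_le (show 1 ≤ k by omega)
  have h1 := descFactorial_le_exp_mul (n := n' + d) (d := d) m (by omega)
  rw [Nat.add_sub_cancel, h, descFactorial_add] at h1
  have h2 : n' - m - j ≤ (n' - m).descFactorial (1 + j) := by
    rw [add_comm 1 j, Nat.descFactorial_succ]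
    exact Nat.le_mul_of_pos_right _ (descFactorial_pos (by omega))
  have h3 : ((n' - m).descFactorial (1 + j) : ℝ) ≤
      Real.exp (m * (d / (((n' + d : ℕ) : ℝ) - d - m))) := by
    have h4 : (0 : ℝ) < (n'.descFactorial m : ℝ) := by
      exact_mod_cast descFactorial_pos (by omega : m ≤ n')
    push_cast at h1 ⊢
    rw [mul_comm] at h1
    exact le_of_mul_le_mul_right h1 h4
  have hm4' : (4 : ℝ) * m ≤ ((n' + d : ℕ) : ℝ) := by exact_mod_cast hm4
  have hd4' : (4 : ℝ) * d ≤ ((n' + d : ℕ) : ℝ) := by exact_mod_cast hd4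
  have hc' : (m : ℝ) * d < ((n' + d : ℕ) : ℝ) := by exact_mod_cast hc
  have hn3' : (10 : ℝ) ^ 6 ≤ ((n' + d : ℕ) : ℝ) := by exact_mod_cast hn3
  have h5 : Real.exp (m * (d / (((n' + d : ℕ) : ℝ) - d - m))) ≤ 8 := by
    have h6 : m * (d / (((n' + d : ℕ) : ℝ) - d - m)) ≤ 2 := by
      rw [← mul_div_assoc, div_le_iff₀ (by linarith)]
      linarith
    have h7 : Real.exp 2 = Real.exp 1 ^ 2 := by rw [← Real.exp_nat_mul]; norm_num
    have h8 := Real.exp_one_lt_d9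
    have h9 := Real.exp_le_exp.mpr h6
    nlinarith [Real.exp_pos 1]
  have h6 : ((n' - m - j : ℕ) : ℝ) ≤ 8 := le_trans (by exact_mod_cast h2) (h3.trans h5)
  have h7 : n' - m - j ≤ 8 := by exact_mod_cast h6
  have h8 : n' ≤ 8 + m + j := by omega
  have h9 : (n' : ℝ) ≤ 8 + m + j := by exact_mod_cast h8
  push_cast at hsub hm4' hd4' hn3' hlog
  linarith

theorem exists_pow_dvd_of_pow_dvd_descFactorial {n M p e : ℕ} (hp : p.Prime) (hM : 1 ≤ M)
    (hMp : M ≤ p) (hMn : M ≤ n) (h : p ^ e ∣ n.descFactorial M) :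
    ∃ i < M, p ^ e ∣ n - i := by
  induction M, hM using Nat.le_induction generalizing e with
  | base => exact ⟨0, one_pos, by simpa using h⟩
  | succ M hM ih =>
    rw [Nat.descFactorial_succ] at h
    by_cases hd : p ∣ n - M
    · refine ⟨M, M.lt_succ_self, ?_⟩
      have hnd : ¬ p ∣ n.descFactorial M := by
        intro hc
        obtain ⟨i, hi, hi'⟩ := ih (by omega) (by omega) (e := 1) (by simpa using hc)
        rw [pow_one] at hi'
        have h1 : p ∣ M - i := by
          have := Nat.dvd_sub hi' hd
          rwa [show n - i - (n - M) = M - i by omega] at this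
        have := Nat.le_of_dvd (by omega) h1
        omega
      exact (Nat.Coprime.pow_left e ((Nat.Prime.coprime_iff_not_dvd hp).mpr hnd)).dvd_of_dvd_mul_right h
    · obtain ⟨i, hi, hi'⟩ := ih (by omega) (by omega)
        ((Nat.Coprime.pow_left e ((Nat.Prime.coprime_iff_not_dvd hp).mpr hd)).dvd_of_dvd_mul_left h)
      exact ⟨i, by omega, hi'⟩

theorem pow_factorization_choose_dvd {N M N' M' p : ℕ} (hM : 1 ≤ M) (hMM : M ≤ M')
    (hMN' : M' ≤ N') (hD : N' + M ≤ N) (heq : N.descFactorial M = N'.descFactorial M')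
    (hp : p.Prime) (hpM : M' < p) :
    p ^ (N.choose M).factorization p ∣
      (N - N' + M' - 1).choose (M + M' - 1) * primorial (M + M' - 1) := by
  set e := (N.choose M).factorization p with he
  have h0 : p ^ e ∣ N.descFactorial M := by
    rw [Nat.descFactorial_eq_factorial_mul_choose]
    exact Dvd.dvd.mul_left (Nat.ordProj_dvd _ _) _
  obtain ⟨i, hi, hi'⟩ := exists_pow_dvd_of_pow_dvd_descFactorial hp hM (by omega) (by omega) h0
  rw [heq] at h0
  obtain ⟨j, hj, hj'⟩ := exists_pow_dvd_of_pow_dvd_descFactorial hp (by omega) hpM.le hMN' h0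
  have h1 := Nat.dvd_sub hi' hj'
  obtain ⟨D, rfl⟩ := Nat.exists_eq_add_of_le (show N' ≤ N by omega)
  have h2 : N' + D - N' + M' - 1 = D + M' - 1 := by omega
  rw [h2]
  set K := M + M' - 1 with hK
  have h3 : N' + D - i - (N' - j) ∣ (D + M' - 1).descFactorial K := by
    rw [Nat.descFactorial_eq_prod_range]
    refine (dvd_of_eq ?_).trans (dvd_prod_of_mem _ (mem_range.mpr
      (show M' - 1 + i - j < K by omega)))
    omega
  have h4 := h1.trans h3
  rw [Nat.descFactorial_eq_factorial_mul_choose] at h4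
  have hC0 : (D + M' - 1).choose K ≠ 0 := (Nat.choose_pos (by omega)).ne'
  have hp0 : primorial K ≠ 0 := (primorial_pos K).ne'
  rw [hp.pow_dvd_iff_le_factorization (mul_ne_zero (Nat.factorial_ne_zero _) hC0),
    Nat.factorization_mul (Nat.factorial_ne_zero _) hC0] at h4
  rw [hp.pow_dvd_iff_le_factorization (mul_ne_zero hC0 hp0), Nat.factorization_mul hC0 hp0]
  simp only [Finsupp.coe_add, Pi.add_apply] at h4 ⊢
  have h5 : K.factorial.factorization p ≤ (primorial K).factorization p := by
    rcases le_or_gt p K with h6 | h6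
    · have h7 := Nat.factorization_factorial_le_div_pred hp K
      have h8 : K / (p - 1) ≤ 1 := by
        rw [← Nat.lt_succ_iff, Nat.div_lt_iff_lt_mul (by have := hp.two_le; omega)]
        omega
      have h9 : p ∣ primorial K := dvd_prod_of_mem (fun q => q)
        (by simp only [mem_filter, mem_range]; exact ⟨by omega, hp⟩)
      have h10 := (hp.dvd_iff_one_le_factorization hp0).mp h9
      omega
    · rw [Nat.factorization_factorial_eq_zero_of_lt h6]
      exact Nat.zero_le _
  omega

theorem choose_le_mul_pow {N M N' M' : ℕ} (hM : 1 ≤ M) (hMM : M ≤ M')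
    (hMN' : M' ≤ N') (hD : N' + M ≤ N) (heq : N.descFactorial M = N'.descFactorial M') :
    N.choose M ≤ ((N - N' + M' - 1).choose (M + M' - 1) * 4 ^ (M + M' - 1)) *
      N ^ (Nat.primeCounting M') := by
  have hX : (N - N' + M' - 1).choose (M + M' - 1) * primorial (M + M' - 1) ≤
      (N - N' + M' - 1).choose (M + M' - 1) * 4 ^ (M + M' - 1) :=
    Nat.mul_le_mul_left _ (primorial_le_four_pow _)
  set f : ℕ → ℕ := fun p => p ^ (N.choose M).factorization p with hf
  have h1 : N.choose M = ∏ p ∈ (range (N + 1)).filter Nat.Prime, f p := by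
    rw [prod_filter_of_ne, Nat.prod_pow_factorization_choose N M (by omega)]
    intro p _ hp
    by_contra hc
    exact hp (by simp [hf, Nat.factorization_eq_zero_of_not_prime _ hc])
  have h2 : ∏ p ∈ ((range (N + 1)).filter Nat.Prime).filter (M' < ·), f p ≤
      (N - N' + M' - 1).choose (M + M' - 1) * primorial (M + M' - 1) := by
    refine Nat.le_of_dvd (Nat.mul_pos (Nat.choose_pos (by omega)) (primorial_pos _)) ?_
    refine prod_dvd_of_isRelPrime (fun p hp q hq hpq => ?_) fun p hp => ?_
    · simp only [coe_filter, Set.mem_ofPred_eq, mem_filter] at hp hq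
      rw [Function.onFun, ← Nat.coprime_iff_isRelPrime]
      exact Nat.Coprime.pow _ _ ((Nat.coprime_primes hp.1.2 hq.1.2).mpr hpq)
    · simp only [mem_filter] at hp
      exact pow_factorization_choose_dvd hM hMM hMN' hD heq hp.1.2 hp.2
  have h3 : ∏ p ∈ ((range (N + 1)).filter Nat.Prime).filter (fun p => ¬ M' < p), f p ≤
      N ^ Nat.primeCounting M' := by
    calc _ ≤ ∏ p ∈ ((range (N + 1)).filter Nat.Prime).filter (fun p => ¬ M' < p), N :=
          prod_le_prod' fun p _ => Nat.pow_factorization_choose_le (by omega)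
      _ = N ^ #(((range (N + 1)).filter Nat.Prime).filter (fun p => ¬ M' < p)) := by simp
      _ ≤ N ^ Nat.primeCounting M' := by
        refine Nat.pow_le_pow_right (by omega) ?_
        rw [Nat.primeCounting, Nat.primeCounting', Nat.count_eq_card_filter_range]
        refine card_le_card fun p hp => ?_
        simp only [mem_filter, mem_range] at hp ⊢
        exact ⟨by omega, hp.1.2⟩
  rw [h1, ← prod_filter_mul_prod_filter_not _ (M' < ·)]
  exact Nat.mul_le_mul (h2.trans hX) h3

theorem primeCounting_mul_log_le {x : ℕ} (hx : 2 ≤ x) :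
    (Nat.primeCounting x : ℝ) * Real.log x ≤ 5 * x := by
  have hx' : (2 : ℝ) ≤ x := by exact_mod_cast hx
  have h1 := Chebyshev.pi_le_log4_mul_div (show (1 : ℝ) < x by linarith)
  rw [Nat.floor_natCast] at h1
  have hl : 0 < Real.log x := Real.log_pos (by linarith)
  have h2 : Real.log √(x : ℝ) = Real.log x / 2 := Real.log_sqrt (by positivity)
  rw [h2] at h1
  have h3 : Real.log 4 = 2 * Real.log 2 := by
    rw [show (4 : ℝ) = 2 ^ 2 by norm_num, Real.log_pow]; norm_num
  have h4 := Real.log_two_lt_d9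
  have h5 : √(x : ℝ) * Real.log x ≤ 2 * x := by
    have h6 := Real.log_le_sub_one_of_pos (show 0 < √(x : ℝ) by positivity)
    rw [h2] at h6
    have h7 := Real.mul_self_sqrt (show (0 : ℝ) ≤ x by positivity)
    nlinarith [Real.sqrt_nonneg (x : ℝ)]
  calc (Nat.primeCounting x : ℝ) * Real.log x ≤
      (Real.log 4 * x / (Real.log x / 2) + √(x : ℝ)) * Real.log x := by gcongr
    _ = 2 * Real.log 4 * x + √(x : ℝ) * Real.log x := by field_simp
    _ ≤ 2 * (2 * 0.7) * x + 2 * x := by gcongr; linarith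
    _ ≤ 5 * x := by linarith

theorem log_div_le_log_choose {N M : ℕ} (hM : 1 ≤ M) (h2 : 2 * M ≤ N) :
    (M : ℝ) * Real.log (N / (2 * M)) ≤ Real.log (N.choose M) := by
  have hM' : (0 : ℝ) < M := by exact_mod_cast hM
  have h2' : (2 : ℝ) * M ≤ N := by exact_mod_cast h2
  have h3 : ((N : ℝ) / (2 * M)) ^ M ≤ N.choose M := by
    refine le_trans ?_ (Nat.pow_le_choose M N)
    have h4 : ((M.factorial : ℕ) : ℝ) ≤ (M : ℝ) ^ M := by exact_mod_cast Nat.factorial_le_pow M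
    have h5 : (N : ℝ) / 2 ≤ ((N + 1 - M : ℕ) : ℝ) := by
      rw [Nat.cast_sub (by omega)]; push_cast; linarith
    calc ((N : ℝ) / (2 * M)) ^ M = (N / 2) ^ M / (M : ℝ) ^ M := by
          rw [← div_pow]; congr 1; field_simp
      _ ≤ _ := by
        have : (0 : ℝ) < M.factorial := by exact_mod_cast Nat.factorial_pos M
        gcongr
  rw [← Real.log_pow]
  have : (0 : ℝ) < N := by linarith
  exact Real.log_le_log (by positivity) h3

theorem log_choose_le {a b : ℕ} (hb : 1 ≤ b) (hab : b ≤ a) :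
    Real.log (a.choose b) ≤ b * (1 + Real.log (a / b)) := by
  have hb' : (0 : ℝ) < b := by exact_mod_cast hb
  have ha' : (0 : ℝ) < a := by exact_mod_cast (by omega : 0 < a)
  have h1 := Real.pow_div_factorial_le_exp (x := b) hb'.le b
  have h2 : ((a.choose b : ℕ) : ℝ) ≤ Real.exp b * (a / b) ^ b := by
    refine (Nat.choose_le_pow_div b a).trans ?_
    have h3 : (0 : ℝ) < b.factorial := by exact_mod_cast Nat.factorial_pos b
    rw [div_le_iff₀ h3] at h1 ⊢
    rw [div_pow, ← mul_div_assoc, div_mul_eq_mul_div, le_div_iff₀ (by positivity)]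
    nlinarith [pow_pos ha' b]
  have h3 : (0 : ℝ) < a.choose b := by exact_mod_cast Nat.choose_pos hab
  have h4 := Real.log_le_log h3 h2
  rw [Real.log_mul (by positivity) (by positivity), Real.log_exp, Real.log_pow] at h4
  linarith

/-- Two disjoint factorial blocks with equal products cannot be short and close together. -/
theorem mul_le_of_descFactorial_eq {N M N' M' : ℕ} (hM : 1 ≤ M) (hMM : M < M')
    (hMN' : M' ≤ N') (hD : N' + M ≤ N) (h2 : 2 * M ≤ N)
    (hlog : Real.log N ≤ 4 * Real.log M') (hg : ((M' : ℝ) - M) * Real.log (12 * N) ≤ M)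
    (heq : N.descFactorial M = N'.descFactorial M') :
    (N : ℝ) * M ≤ Real.exp 50 * ((N : ℝ) - N' + M') ^ 2 := by
  have h0 := choose_le_mul_pow hM hMM.le hMN' hD heq
  obtain ⟨D, rfl⟩ := Nat.exists_eq_add_of_le (show N' ≤ N by omega)
  set N := N' + D with hN
  have e1 : N - N' = D := by omega
  have e2 : (N : ℝ) - N' = D := by rw [hN]; push_cast; ring
  rw [e1] at h0
  rw [e2]
  obtain ⟨g, rfl⟩ := Nat.exists_eq_add_of_le (show M + 1 ≤ M' by omega)
  have e3 : M + (M + 1 + g) - 1 = 2 * M + g := by omega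
  have e4 : D + (M + 1 + g) - 1 = D + M + g := by omega
  rw [e3, e4] at h0
  have hM0 : (1 : ℝ) ≤ M := by exact_mod_cast hM
  have hN0 : (1 : ℝ) ≤ N := by exact_mod_cast (by omega : 1 ≤ N)
  have hg0 : (0 : ℝ) ≤ g := by positivity
  have hDM : (M : ℝ) ≤ D := by exact_mod_cast (by omega : M ≤ D)
  push_cast at hg ⊢
  have hl12 : 2 ≤ Real.log (12 * N) := by
    rw [Real.le_log_iff_exp_le (by positivity), show (2 : ℝ) = 1 + 1 by norm_num, Real.exp_add]
    have := Real.exp_one_lt_d9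
    nlinarith [Real.exp_pos 1]
  have hgM : (1 : ℝ) + g ≤ M := by nlinarith
  have hDN : (D : ℝ) + M + g + 1 ≤ N := by
    exact_mod_cast (by omega : D + M + g + 1 ≤ N)
  have hcp : (0 : ℝ) < (D + M + g).choose (2 * M + g) := by
    exact_mod_cast Nat.choose_pos (by omega)
  have h3 : Real.log (N.choose M) ≤ Real.log ((D + M + g).choose (2 * M + g)) +
      (2 * M + g) * Real.log 4 + Nat.primeCounting (M + 1 + g) * Real.log N := by
    have h4 : ((N.choose M : ℕ) : ℝ) ≤ ((D + M + g).choose (2 * M + g) * 4 ^ (2 * M + g)) *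
      (N : ℝ) ^ (Nat.primeCounting (M + 1 + g)) := by exact_mod_cast h0
    have h5 : (0 : ℝ) < N.choose M := by exact_mod_cast Nat.choose_pos (by omega)
    have h6 := Real.log_le_log h5 h4
    rw [Real.log_mul (by positivity) (by positivity), Real.log_mul (by positivity) (by positivity),
      Real.log_pow, Real.log_pow] at h6
    push_cast at h6
    exact h6
  have h4 := log_choose_le (show 1 ≤ 2 * M + g by omega) (show 2 * M + g ≤ D + M + g by omega)
  push_cast at h4
  have h5 := log_div_le_log_choose hM h2
  have h6 : (Nat.primeCounting (M + 1 + g) : ℝ) * Real.log N ≤ 40 * M := by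
    have h7 := primeCounting_mul_log_le (show 2 ≤ M + 1 + g by omega)
    push_cast at h7 hlog
    have h8 : (0 : ℝ) ≤ Nat.primeCounting (M + 1 + g) := by positivity
    nlinarith
  have hlog4 : Real.log 4 ≤ 3 / 2 := by
    have h3 : Real.log 4 = 2 * Real.log 2 := by
      rw [show (4 : ℝ) = 2 ^ 2 by norm_num, Real.log_pow]; norm_num
    have h4 := Real.log_two_lt_d9
    linarith
  set Q : ℝ := (D + M + g) / M with hQ
  have hQ0 : 0 < Q := by positivity
  have h7 : Real.log ((D + M + g) / (2 * M + g)) ≤ Real.log Q := by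
    rw [hQ]; gcongr; linarith
  have h8 : Real.log ((D + M + g) / (2 * M + g)) + 5 / 2 ≤ 3 * Real.log (12 * N) := by
    have : Real.log ((D + M + g) / (2 * M + g)) ≤ Real.log (12 * N) := by
      gcongr
      rw [div_le_iff₀ (by positivity)]
      nlinarith
    linarith
  have h9 : (2 * M + g) * (1 + Real.log ((D + M + g) / (2 * M + g))) + (2 * M + g) * (3 / 2) ≤
      2 * M * (Real.log Q + 5 / 2) + 3 * M := by
    have h10 := mul_le_mul_of_nonneg_left h8 hg0
    have h11 := mul_le_mul_of_nonneg_left h7 (show (0 : ℝ) ≤ 2 * M by linarith)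
    nlinarith
  have h10 : (M : ℝ) * Real.log (N / (2 * M)) ≤ M * (2 * Real.log Q + 50 - Real.log 4) := by
    have h11 : (2 * M + g) * Real.log 4 ≤ (2 * M + g) * (3 / 2) := by gcongr
    have h12 : M * Real.log 4 ≤ M * (3 / 2) := by gcongr
    have h13 : M * (2 * Real.log Q + 50 - Real.log 4) =
      2 * M * Real.log Q + 50 * M - M * Real.log 4 := by ring
    have h14 : 2 * M * (Real.log Q + 5 / 2) = 2 * M * Real.log Q + 5 * M := by ring
    linarith only [h11, h12, h13, h14, h9, h3, h4, h5, h6, hM0]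
  have h11 := le_of_mul_le_mul_left h10 (by linarith)
  obtain ⟨E, hE⟩ : ∃ E, E = Real.exp 50 := ⟨_, rfl⟩
  have hE0 : 0 < E := hE ▸ Real.exp_pos _
  have hEl : Real.log E = 50 := by rw [hE, Real.log_exp]
  rw [← hE]
  have h12 : (N : ℝ) / (2 * M) ≤ E * Q ^ 2 / 4 := by
    rw [← Real.log_le_log_iff (by positivity) (by positivity), Real.log_div (by positivity)
      (by positivity), Real.log_div (show E * Q ^ 2 ≠ 0 by positivity)
      (by positivity), Real.log_mul hE0.ne' (by positivity), hEl, Real.log_pow]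
    rw [Real.log_div (by positivity) (by positivity)] at h11
    push_cast
    linarith
  rw [hQ, div_le_iff₀ (by positivity), div_pow] at h12
  have h13 : (N : ℝ) * M ≤ E * (D + M + g) ^ 2 / 2 := by
    have : E * ((D + M + g) ^ 2 / (M : ℝ) ^ 2) / 4 * (2 * M) =
        E * (D + M + g) ^ 2 / 2 / M := by field_simp; ring
    rw [this, le_div_iff₀ (by linarith)] at h12
    exact h12
  refine h13.trans ?_
  have h14 : (D + M + g : ℝ) ^ 2 ≤ (D + (M + 1 + g)) ^ 2 :=
    pow_le_pow_left₀ (by positivity) (by linarith) 2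
  have h15 := mul_le_mul_of_nonneg_left h14 hE0.le
  have h16 : 0 ≤ E * (D + M + g : ℝ) ^ 2 := by positivity
  linarith only [h15, h16]

theorem eventually_mul_log_pow_lt (C : ℝ) (k : ℕ) {s : ℝ} (hs : 0 < s) :
    ∀ᶠ n : ℕ in Filter.atTop, C * Real.log n ^ k < (n : ℝ) ^ s := by
  have h1 := (isLittleO_log_rpow_rpow_atTop (k : ℝ) hs).comp_tendsto
    tendsto_natCast_atTop_atTop
  have h2 := h1.bound (show (0 : ℝ) < 1 / (|C| + 1) by positivity)
  filter_upwards [h2, Filter.eventually_ge_atTop 2] with n hn hn2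
  have hn0 : (0 : ℝ) < n := by exact_mod_cast (by omega : 0 < n)
  have h3 : 0 < (n : ℝ) ^ s := Real.rpow_pos_of_pos hn0 _
  have hl : 0 < Real.log n := Real.log_pos (by exact_mod_cast hn2)
  simp only [Function.comp_apply, Real.rpow_natCast, Real.norm_eq_abs] at hn
  rw [abs_of_pos (by positivity), abs_of_pos h3, div_mul_eq_mul_div, one_mul,
    le_div_iff₀ (by positivity)] at hn
  have h4 : 0 < Real.log n ^ k := by positivity
  nlinarith [le_abs_self C]

theorem descFactorial_eq_of_descFactorial_eq {n m d h : ℕ} (hd : d ≤ m) (hmn : m ≤ n)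
    (heq : n.descFactorial m = (n - d).descFactorial (m + h)) :
    n.descFactorial d = (n - m).descFactorial (d + h) := by
  have h1 := descFactorial_add n d (m - d)
  have h2 := descFactorial_add (n - d) (m - d) (d + h)
  rw [show d + (m - d) = m by omega] at h1
  rw [show m - d + (d + h) = m + h by omega, show n - d - (m - d) = n - m by omega] at h2
  have h3 := descFactorial_pos (show m - d ≤ n - d by omega)
  rw [h1, h2, mul_comm] at heq
  exact Nat.eq_of_mul_eq_mul_left h3 heq

theorem exists_descFactorial_ne_of_medium : ∃ n₀ : ℕ, ∀ n m n' m' : ℕ, n₀ ≤ n → m < m' → m' < n' →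
    n' < n → (n : ℝ) ^ (0.34 : ℝ) ≤ m → (m : ℝ) ≤ (n : ℝ) ^ (0.6 : ℝ) →
    n.descFactorial m ≠ n'.descFactorial m' := by
  obtain ⟨E, hE⟩ : ∃ E, E = Real.exp 50 := ⟨_, rfl⟩
  have hE1 : 1 ≤ E := hE ▸ Real.one_le_exp (by norm_num)
  have ev := ((((eventually_mul_log_pow_lt (144 * E) 4 (show (0 : ℝ) < 0.02 by norm_num)).and
    (eventually_mul_log_pow_lt 4 0 (show (0 : ℝ) < 0.4 by norm_num))).and
    (eventually_mul_log_pow_lt 16 2 (show (0 : ℝ) < 0.34 by norm_num))).and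
    (Filter.eventually_ge_atTop (10 ^ 6)))
  obtain ⟨n₀, hn₀⟩ := Filter.eventually_atTop.1 ev
  refine ⟨n₀, fun n m n' m' hn hmm hmn' hnn hlo hhi heq => ?_⟩
  obtain ⟨⟨⟨c1, c2⟩, c3⟩, c4⟩ := hn₀ n hn
  rw [pow_zero, mul_one] at c2
  obtain ⟨x, hx⟩ : ∃ x : ℝ, x = n := ⟨_, rfl⟩
  rw [← hx] at c1 c2 c3 hlo hhi
  obtain ⟨L, hL⟩ : ∃ L, L = Real.log x := ⟨_, rfl⟩
  rw [← hL] at c1 c3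
  have hx6 : (10 : ℝ) ^ 6 ≤ x := by rw [hx]; exact_mod_cast c4
  have hx0 : 0 < x := by linarith
  have hL3 : 3 ≤ L := by
    rw [hL, Real.le_log_iff_exp_le hx0, show (3 : ℝ) = 1 + 1 + 1 by norm_num, Real.exp_add,
      Real.exp_add]
    have h1 := Real.exp_one_lt_d9
    have h2 := Real.exp_pos 1
    have h3 : Real.exp 1 * Real.exp 1 ≤ 9 := by nlinarith
    nlinarith
  have hE0 : 0 < E := by linarith
  have hx34 : 0 < x ^ (0.34 : ℝ) := Real.rpow_pos_of_pos hx0 _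
  have hm144 : 144 ≤ (m : ℝ) := by nlinarith
  have hx46 : x ^ (0.4 : ℝ) * x ^ (0.6 : ℝ) = x := by
    rw [← Real.rpow_add hx0]; norm_num
  have h4m : 4 * (m : ℝ) ≤ x := by
    nlinarith [Real.rpow_pos_of_pos hx0 (0.6 : ℝ)]
  have h4m' : 4 * m ≤ n := by rw [hx] at h4m; exact_mod_cast h4m
  have hm144' : 144 ≤ m := by exact_mod_cast hm144
  have b1 := sub_le_log_of_descFactorial_eq (by omega) hmn'.le hnn.le (by omega) heq
  have b2 := mul_sub_le_of_descFactorial_eq hmm.le hmn'.le hnn.le (by omega) heq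
  have b3 := le_mul_sub_of_descFactorial_eq hmm hmn' hnn.le h4m' (by omega) c4 heq
  obtain ⟨d, rfl⟩ := Nat.exists_eq_add_of_le hnn.le
  obtain ⟨h, rfl⟩ := Nat.exists_eq_add_of_le hmm.le
  have hd : x - n' = d := by rw [hx]; push_cast; ring
  have hh : ((m + h : ℕ) : ℝ) - m = h := by push_cast; ring
  rw [← hx, ← hL] at b1 b2
  rw [hh] at b1
  rw [hd] at b2
  rw [show n' + d - n' = d by omega] at b3
  have b3' : x ≤ m * d := by rw [hx]; exact_mod_cast b3
  have hl12 : Real.log (12 * x) ≤ 2 * L := by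
    rw [Real.log_mul (by norm_num) hx0.ne']
    have : Real.log 12 ≤ Real.log 16 := Real.log_le_log (by norm_num) (by norm_num)
    rw [show (16 : ℝ) = 2 ^ 4 by norm_num, Real.log_pow] at this
    have := Real.log_two_lt_d9
    push_cast at *
    linarith
  have hl12' : 0 ≤ Real.log (12 * x) := Real.log_nonneg (by linarith)
  have hhl : (h : ℝ) * Real.log (12 * x) ≤ x ^ (0.34 : ℝ) := by
    have : (h : ℝ) * Real.log (12 * x) ≤ (4 * L) * (2 * L) :=
      mul_le_mul b1 hl12 hl12' (by linarith)
    nlinarith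
  have hhm : (h : ℝ) ≤ m := by nlinarith
  have hm0 : (0 : ℝ) < m := by linarith
  by_cases hcase : m ≤ d
  · have hcase' : (m : ℝ) ≤ d := by exact_mod_cast hcase
    have key := mul_le_of_descFactorial_eq (by omega) hmm hmn'.le (by omega) (by omega)
      (N := n' + d) ?_ (by rw [hh, ← hx]; exact hhl.trans hlo) heq
    · rw [← hx, hd, ← hE] at key
      push_cast at key
      have k1 : (d + (m + h) : ℝ) ^ 2 ≤ (3 * d) ^ 2 :=
        pow_le_pow_left₀ (by positivity) (by linarith) 2
      have k2 : x * m ≤ E * (3 * d) ^ 2 := key.trans (by gcongr)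
      have k3 : ((m : ℝ) * d) ^ 2 ≤ (4 * x * L ^ 2) ^ 2 := pow_le_pow_left₀ (by positivity) b2 2
      have k4 : x * (m : ℝ) ^ 3 ≤ x * (x * (144 * E * L ^ 4)) := by
        calc x * (m : ℝ) ^ 3 = x * m * m ^ 2 := by ring
          _ ≤ E * (3 * d) ^ 2 * m ^ 2 := by gcongr
          _ = 9 * E * (m * d) ^ 2 := by ring
          _ ≤ 9 * E * (4 * x * L ^ 2) ^ 2 := by gcongr
          _ = _ := by ring
      have k5 := le_of_mul_le_mul_left k4 hx0
      have k6 : (x ^ (0.34 : ℝ)) ^ 3 ≤ (m : ℝ) ^ 3 := pow_le_pow_left₀ hx34.le hlo 3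
      have k7 : (x ^ (0.34 : ℝ)) ^ 3 = x * x ^ (0.02 : ℝ) := by
        rw [← Real.rpow_natCast, ← Real.rpow_mul hx0.le]
        nth_rw 2 [← Real.rpow_one x]
        rw [← Real.rpow_add hx0]
        norm_num
      rw [k7] at k6
      have k8 := mul_lt_mul_of_pos_left c1 hx0
      linarith
    · rw [← hx]
      have k1 : Real.log (x ^ (0.34 : ℝ)) ≤ Real.log ((m + h : ℕ) : ℝ) :=
        Real.log_le_log hx34 (hlo.trans (by push_cast; linarith [show (0 : ℝ) ≤ h by positivity]))
      rw [Real.log_rpow hx0] at k1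
      linarith
  · have hcase' : (d : ℝ) ≤ m := by exact_mod_cast (by omega : d ≤ m)
    have hdx : x ^ (0.4 : ℝ) ≤ d := by
      have k1 : x ≤ x ^ (0.6 : ℝ) * d := b3'.trans (by gcongr)
      have k2 : 0 < x ^ (0.6 : ℝ) := Real.rpow_pos_of_pos hx0 _
      have k3 : x ^ (0.6 : ℝ) * x ^ (0.4 : ℝ) ≤ x ^ (0.6 : ℝ) * d := by
        rw [mul_comm, hx46]; exact k1
      exact le_of_mul_le_mul_left k3 k2
    have hmh : m + h ≤ 2 * m := by
      have : h ≤ m := by exact_mod_cast hhm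
      omega
    have heq' := descFactorial_eq_of_descFactorial_eq (n := n' + d) (m := m) (d := d) (h := h)
      (by omega) (by omega) (by rw [show n' + d - d = n' by omega]; exact heq)
    have hx4 : x ^ (0.34 : ℝ) ≤ x ^ (0.4 : ℝ) :=
      Real.rpow_le_rpow_of_exponent_le (by linarith) (by norm_num)
    have hd0 : 1 ≤ d := by
      have : (0 : ℝ) < d := by linarith
      exact_mod_cast this
    have hdh : ((d + h : ℕ) : ℝ) - d = h := by push_cast; ring
    have key := mul_le_of_descFactorial_eq hd0 (show d < d + h by omega)
      (show d + h ≤ n' + d - m by omega) (by omega) (by omega)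
      (N := n' + d) ?_ (by rw [hdh, ← hx]; exact (hhl.trans hx4).trans hdx) heq'
    · have k0 : ((n' + d - m : ℕ) : ℝ) = x - m := by rw [Nat.cast_sub (by omega), ← hx]
      rw [← hx, k0, ← hE] at key
      push_cast at key
      have k1 : (x - (x - m) + (d + h) : ℝ) ^ 2 ≤ (3 * m) ^ 2 :=
        pow_le_pow_left₀ (by ring_nf; positivity) (by linarith) 2
      have k2 : x * d ≤ E * (3 * m) ^ 2 := key.trans (by gcongr)
      have k3 : x * x ≤ 9 * E * (m : ℝ) ^ 3 := by
        calc x * x ≤ x * (m * d) := by gcongr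
          _ = x * d * m := by ring
          _ ≤ E * (3 * m) ^ 2 * m := by gcongr
          _ = _ := by ring
      have k4 : (m : ℝ) ^ 3 ≤ (x ^ (0.6 : ℝ)) ^ 3 := pow_le_pow_left₀ hm0.le hhi 3
      have k5 : (x ^ (0.6 : ℝ)) ^ 3 * x ^ (0.2 : ℝ) = x * x := by
        rw [← Real.rpow_natCast, ← Real.rpow_mul hx0.le, ← Real.rpow_add hx0]
        norm_num
        rw [sq]
      have k6 : 9 * E * (m : ℝ) ^ 3 ≤ 9 * E * (x ^ (0.6 : ℝ)) ^ 3 := by gcongr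
      have k7 : x ^ (0.02 : ℝ) ≤ x ^ (0.2 : ℝ) :=
        Real.rpow_le_rpow_of_exponent_le (by linarith) (by norm_num)
      have k8 : 144 * E * 1 ≤ 144 * E * L ^ 4 := by
        gcongr
        exact one_le_pow₀ (by linarith)
      have k9 : 0 < (x ^ (0.6 : ℝ)) ^ 3 := pow_pos (Real.rpow_pos_of_pos hx0 _) 3
      have k10 : 9 * E < x ^ (0.2 : ℝ) := by linarith
      have k11 := mul_lt_mul_of_pos_left k10 k9
      linarith
    · rw [← hx]
      have k1 : Real.log (x ^ (0.4 : ℝ)) ≤ Real.log ((d + h : ℕ) : ℝ) :=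
        Real.log_le_log (by linarith)
          (hdx.trans (by push_cast; linarith [show (0 : ℝ) ≤ h by positivity]))
      rw [Real.log_rpow hx0] at k1
      linarith

theorem log_descFactorial {n d : ℕ} (h : d ≤ n) :
    Real.log (n.descFactorial d) = ∑ i ∈ range d, Real.log ((n : ℝ) - i) := by
  rw [Nat.descFactorial_eq_prod_range, Nat.cast_prod, Real.log_prod]
  · refine sum_congr rfl fun i hi => ?_
    rw [Nat.cast_sub (by have := mem_range.1 hi; omega)]
  · intro i hi
    have := mem_range.1 hi
    exact_mod_cast (by omega : n - i ≠ 0)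

theorem sum_sum_sub_add (a b : ℕ) :
    ∑ i ∈ range a, ∑ j ∈ range b, ((a : ℝ) - i + j) = a * b * (a + b) / 2 := by
  have h1 (k : ℕ) : ∑ i ∈ range k, (i : ℝ) = k * (k - 1) / 2 := by
    induction k with
    | zero => simp
    | succ k ih => rw [sum_range_succ, ih]; push_cast; ring
  simp only [sum_add_distrib, sum_sub_distrib, sum_const, card_range, nsmul_eq_mul, ← mul_sum, h1]
  ring

/-- Comparison of the average logarithms over two adjacent blocks. -/
theorem log_descFactorial_sub_bounds {n a b : ℕ} (h : a + b ≤ n) :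
    (a : ℝ) * b * (a + b) / (2 * n) ≤
      b * Real.log (n.descFactorial a) - a * Real.log ((n - a).descFactorial b) ∧
    b * Real.log (n.descFactorial a) - a * Real.log ((n - a).descFactorial b) ≤
      (a : ℝ) * b * (a + b) / (2 * ((n : ℝ) - a - b + 1)) := by
  have hG : b * Real.log (n.descFactorial a) - a * Real.log ((n - a).descFactorial b) =
      ∑ i ∈ range a, ∑ j ∈ range b, (Real.log ((n : ℝ) - i) - Real.log ((n : ℝ) - a - j)) := by
    rw [log_descFactorial (by omega), log_descFactorial (by omega), Nat.cast_sub (by omega)]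
    simp only [sum_sub_distrib, sum_const, card_range, nsmul_eq_mul, ← mul_sum]
  rw [hG]
  have h' : (a : ℝ) + b ≤ n := by exact_mod_cast h
  have hS := sum_sum_sub_add a b
  have key (i : ℕ) (hi : i ∈ range a) (j : ℕ) (hj : j ∈ range b) :
      ((a : ℝ) - i + j) / n ≤ Real.log ((n : ℝ) - i) - Real.log ((n : ℝ) - a - j) ∧
      Real.log ((n : ℝ) - i) - Real.log ((n : ℝ) - a - j) ≤
        ((a : ℝ) - i + j) / ((n : ℝ) - a - b + 1) := by
    have hi' : (i : ℝ) + 1 ≤ a := by exact_mod_cast mem_range.1 hi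
    have hj' : (j : ℝ) + 1 ≤ b := by exact_mod_cast mem_range.1 hj
    have hi0 : (0 : ℝ) ≤ i := by positivity
    have hj0 : (0 : ℝ) ≤ j := by positivity
    have hx : 0 < (n : ℝ) - i := by linarith
    have hy : 0 < (n : ℝ) - a - j := by linarith
    have hz : 0 < (n : ℝ) - a - b + 1 := by linarith
    rw [← Real.log_div hx.ne' hy.ne']
    constructor
    · refine le_trans ?_ (Real.one_sub_inv_le_log_of_pos (by positivity))
      rw [inv_div, one_sub_div hx.ne']
      rw [show (n : ℝ) - i - (n - a - j) = a - i + j by ring]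
      gcongr
      · linarith
      · linarith
    · refine (Real.log_le_sub_one_of_pos (by positivity)).trans ?_
      rw [div_sub_one hy.ne', show (n : ℝ) - i - (n - a - j) = a - i + j by ring]
      gcongr
      · linarith
      · linarith
  constructor
  · calc (a : ℝ) * b * (a + b) / (2 * n) =
        ∑ i ∈ range a, ∑ j ∈ range b, ((a : ℝ) - i + j) / n := by
          simp only [← sum_div]
          rw [hS, div_div]
      _ ≤ _ := sum_le_sum fun i hi => sum_le_sum fun j hj => (key i hi j hj).1
  · calc _ ≤ ∑ i ∈ range a, ∑ j ∈ range b, ((a : ℝ) - i + j) / ((n : ℝ) - a - b + 1) :=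
          sum_le_sum fun i hi => sum_le_sum fun j hj => (key i hi j hj).2
      _ = _ := by
          simp only [← sum_div]
          rw [hS, div_div]

theorem le_of_adjacent_block_bounds {x y u v r s A B D H : ℝ}
    (ga1 : u * v * (u + v) / (2 * x) ≤ v * A - u * B)
    (ga2 : v * A - u * B ≤ u * v * (u + v) / (2 * (x - u - v + 1)))
    (gb1 : (u + r) * (v + s) * (u + r + (v + s)) / (2 * (x - y)) ≤ (v + s) * A - (u + r) * B)
    (gb2 : (v + s) * A - (u + r) * B ≤ (u + r) * (v + s) * (u + r + (v + s)) /
      (2 * (x - y - (u + r) - (v + s) + 1)))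
    (hA : u + r ≤ A) (hl' : y + u + v + r + s + 2 ≤ x) (hdm' : u + v ≤ y + 1)
    (p1 : 1 ≤ u) (p2 : 1 ≤ v) (q1 : 1 ≤ r) (q2 : 1 ≤ s)
    (hΔpos : 0 < u * s - v * r → 1 ≤ u * s - v * r)
    (hD1 : u ≤ D) (hD2 : v ≤ D) (hH1 : r ≤ H) (hH2 : s ≤ H) (hHD : H ≤ D)
    (hm : 2 * D + 2 * H ≤ 2 * y) :
    x - y - u - v - r - s ≤ 3 * D ^ 2 * H + 3 * D ^ 3 * (y / x) := by
  have hA0 : 0 < A := by linarith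
  have hΔ : (u * s - v * r) * A = u * ((v + s) * A - (u + r) * B) - (u + r) * (v * A - u * B) := by
    ring
  have hx0 : 0 < x := by linarith
  have hxy : 0 < x - y := by linarith
  have t1 : 0 < x - u - v + 1 := by linarith
  have hpos : 0 < (u * s - v * r) * A := by
    rw [hΔ]
    have k1 := mul_le_mul_of_nonneg_left gb1 (by linarith : 0 ≤ u)
    have k2 := mul_le_mul_of_nonneg_left ga2 (by linarith : 0 ≤ u + r)
    have k3 : u * v * (u + v) / (2 * (x - u - v + 1)) ≤ u * v * (u + v) / (2 * (x - y)) := by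
      gcongr u * v * (u + v) / (2 * ?_)
      linarith
    have k4 := mul_le_mul_of_nonneg_left k3 (by linarith : 0 ≤ u + r)
    have k5 : (u + r) * (u * v * (u + v) / (2 * (x - y))) <
        u * ((u + r) * (v + s) * (u + r + (v + s)) / (2 * (x - y))) := by
      rw [← mul_div_assoc, ← mul_div_assoc]
      gcongr ?_ / _
      have k6 : v * (u + v) < (v + s) * (u + r + (v + s)) :=
        mul_lt_mul (by linarith) (by linarith) (by linarith) (by linarith)
      have k7 := mul_lt_mul_of_pos_left k6 (show 0 < u * (u + r) by positivity)
      linarith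
    linarith
  have hΔ1 := hΔpos (pos_of_mul_pos_left hpos hA0.le)
  have hup : A ≤ u * ((v + s) * A - (u + r) * B) - (u + r) * (v * A - u * B) := by
    rw [← hΔ]; nlinarith
  obtain ⟨l, hlx⟩ : ∃ l, l = x - y - u - v - r - s := ⟨_, rfl⟩
  rw [← hlx]
  have hl0 : 0 < l := by linarith
  have k1 := mul_le_mul_of_nonneg_left gb2 (by linarith : 0 ≤ u)
  have k2 := mul_le_mul_of_nonneg_left ga1 (by linarith : 0 ≤ u + r)
  have k3 : (u + r) * (v + s) * (u + r + (v + s)) / (2 * (x - y - (u + r) - (v + s) + 1)) ≤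
      (u + r) * (v + s) * (u + r + (v + s)) / (2 * l) := by
    gcongr (u + r) * (v + s) * (u + r + (v + s)) / (2 * ?_)
    linarith
  have k4 := mul_le_mul_of_nonneg_left k3 (by linarith : 0 ≤ u)
  have k5 : u + r ≤ u * ((u + r) * (v + s) * (u + r + (v + s)) / (2 * l)) -
      (u + r) * (u * v * (u + v) / (2 * x)) := by linarith
  have k6 : u * ((u + r) * (v + s) * (u + r + (v + s)) / (2 * l)) -
      (u + r) * (u * v * (u + v) / (2 * x)) = (u + r) * (u / (2 * l) *
        ((v + s) * (u + r + (v + s)) - v * (u + v) + v * (u + v) * ((x - l) / x))) := by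
    field_simp
    ring
  rw [k6] at k5
  have k7 : 1 ≤ u / (2 * l) *
        ((v + s) * (u + r + (v + s)) - v * (u + v) + v * (u + v) * ((x - l) / x)) :=
    le_of_mul_le_mul_left (by linarith) (show 0 < u + r by linarith)
  rw [div_mul_eq_mul_div, le_div_iff₀ (by positivity)] at k7
  have hD0 : 0 < D := by linarith
  have hH0 : 0 < H := by linarith
  have k8 : (v + s) * (u + r + (v + s)) - v * (u + v) ≤ 6 * (D * H) := by
    have e1 : v * r ≤ D * H := by gcongr
    have e2 : v * s ≤ D * H := by gcongr
    have e3 : s * u ≤ H * D := by gcongr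
    have e4 : s * r ≤ D * H := by gcongr; linarith
    have e5 : s * s ≤ D * H := by gcongr; linarith
    linarith
  have k9 : (x - l) / x ≤ 3 * (y / x) := by
    rw [← mul_div_assoc]
    gcongr
    linarith
  have k10 : v * (u + v) * ((x - l) / x) ≤ D * (D + D) * (3 * (y / x)) := by
    have : 0 ≤ (x - l) / x := div_nonneg (by linarith) hx0.le
    gcongr
  have k11 : u * ((v + s) * (u + r + (v + s)) - v * (u + v) + v * (u + v) * ((x - l) / x)) ≤
      D * (6 * (D * H) + D * (D + D) * (3 * (y / x))) :=
    mul_le_mul hD1 (by linarith) (by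
      by_contra hneg
      push Not at hneg
      nlinarith) hD0.le
  have k12 : D * (6 * (D * H) + D * (D + D) * (3 * (y / x))) =
    2 * (3 * D ^ 2 * H + 3 * D ^ 3 * (y / x)) := by ring
  linarith

theorem le_of_three_solutions {n m d₁ d₂ h₁ h₂ : ℕ} (hd1 : 1 ≤ d₁) (hd2 : 1 ≤ d₂) (hh1 : 1 ≤ h₁)
    (hh2 : 1 ≤ h₂) (hl : m + d₁ + d₂ + h₁ + h₂ + 2 ≤ n) (hdm : d₁ + d₂ ≤ m + 1)
    (eq1 : n.descFactorial d₁ = (n - m).descFactorial (d₁ + h₁))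
    (eq2 : (n - d₁).descFactorial d₂ = (n - m - (d₁ + h₁)).descFactorial (d₂ + h₂))
    {D H : ℝ} (hD1 : d₁ ≤ D) (hD2 : d₂ ≤ D) (hH1 : h₁ ≤ H) (hH2 : h₂ ≤ H) (hHD : H ≤ D)
    (hm : 2 * D + 2 * H ≤ 2 * m) :
    (n : ℝ) - m - d₁ - d₂ - h₁ - h₂ ≤ 3 * D ^ 2 * H + 3 * D ^ 3 * (m / n) := by
  have hln : n - (n - m) = m := by omega
  obtain ⟨ga1, ga2⟩ := log_descFactorial_sub_bounds (n := n) (a := d₁) (b := d₂) (by omega)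
  obtain ⟨gb1, gb2⟩ := log_descFactorial_sub_bounds (n := n - m) (a := d₁ + h₁) (b := d₂ + h₂)
    (by omega)
  rw [← eq1, ← eq2, Nat.cast_sub (by omega)] at gb1 gb2
  have hA : (d₁ : ℝ) + h₁ ≤ Real.log (n.descFactorial d₁) := by
    rw [eq1]
    have h1 := Nat.pow_sub_le_descFactorial (n - m) (d₁ + h₁)
    have h2 : 3 ^ (d₁ + h₁) ≤ (n - m).descFactorial (d₁ + h₁) :=
      (Nat.pow_le_pow_left (by omega) _).trans h1
    have h3 : (3 : ℝ) ^ (d₁ + h₁) ≤ ((n - m).descFactorial (d₁ + h₁) : ℕ) := by exact_mod_cast h2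
    have h4 := Real.log_le_log (by positivity) h3
    rw [Real.log_pow] at h4
    have h5 : 1 ≤ Real.log 3 := by
      rw [Real.le_log_iff_exp_le (by norm_num)]
      have := Real.exp_one_lt_d9
      linarith
    have h6 : (0 : ℝ) ≤ (d₁ + h₁ : ℕ) := by positivity
    push_cast at h4 h6
    nlinarith
  obtain ⟨A, hAe⟩ : ∃ A, A = Real.log (n.descFactorial d₁) := ⟨_, rfl⟩
  obtain ⟨B, hBe⟩ : ∃ B, B = Real.log ((n - d₁).descFactorial d₂) := ⟨_, rfl⟩
  rw [← hAe] at ga1 ga2 gb1 gb2 hA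
  rw [← hBe] at ga1 ga2 gb1 gb2
  push_cast at gb1 gb2
  have hl' : (m : ℝ) + d₁ + d₂ + h₁ + h₂ + 2 ≤ n := by exact_mod_cast hl
  have hdm' : (d₁ : ℝ) + d₂ ≤ m + 1 := by exact_mod_cast hdm
  have p1 : (1 : ℝ) ≤ d₁ := by exact_mod_cast hd1
  have p2 : (1 : ℝ) ≤ d₂ := by exact_mod_cast hd2
  have q1 : (1 : ℝ) ≤ h₁ := by exact_mod_cast hh1
  have q2 : (1 : ℝ) ≤ h₂ := by exact_mod_cast hh2
  have hΔpos : (0 : ℝ) < d₁ * h₂ - d₂ * h₁ → (1 : ℝ) ≤ d₁ * h₂ - d₂ * h₁ := by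
    intro h
    have : (0 : ℤ) < (d₁ : ℤ) * h₂ - d₂ * h₁ := by exact_mod_cast h
    have : (1 : ℤ) ≤ (d₁ : ℤ) * h₂ - d₂ * h₁ := this
    exact_mod_cast this
  exact le_of_adjacent_block_bounds ga1 ga2 gb1 gb2 hA hl' hdm' p1 p2 q1 q2 hΔpos hD1 hD2 hH1
    hH2 hHD hm

theorem exists_two_pow_dvd_of_descFactorial_eq {n l d e V : ℕ} (hd : 1 ≤ d) (hdn : d ≤ n)
    (hel : e ≤ l) (heq : n.descFactorial d = l.descFactorial e)
    (h : d * V + (Nat.digits 2 l).sum ≤ e) : ∃ i < d, 2 ^ V ∣ n - i := by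
  by_contra! hc
  have h1 := padicValNat_two_descFactorial hel
  have h2 : d * V ≤ padicValNat 2 (l.descFactorial e) := by omega
  rw [← heq, Nat.descFactorial_eq_prod_range, ← Nat.factorization_def _ Nat.prime_two,
    Nat.factorization_prod (by intro i hi; have := mem_range.1 hi; omega),
    Finsupp.finsetSum_apply] at h2
  have h3 : ∑ i ∈ range d, (n - i).factorization 2 < ∑ i ∈ range d, V := by
    refine sum_lt_sum_of_nonempty ⟨0, mem_range.2 hd⟩ fun i hi => ?_
    have hi' := mem_range.1 hi
    by_contra hv
    push Not at hv
    exact hc i hi' ((Nat.prime_two.pow_dvd_iff_le_factorization (by omega)).2 hv)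
  rw [sum_const, card_range, smul_eq_mul] at h3
  omega

theorem mul_log_le_mul_log_of_descFactorial_eq {n l d e : ℕ} (hdn : d ≤ n)
    (heq : n.descFactorial d = l.descFactorial e) :
    d * Real.log ((n + 1 - d : ℕ) : ℝ) ≤ e * Real.log l := by
  have h1 := Nat.pow_sub_le_descFactorial n d
  have h2 := Nat.descFactorial_le_pow l e
  have h3 : (((n + 1 - d : ℕ) : ℝ)) ^ d ≤ (l : ℝ) ^ e := by exact_mod_cast (h1.trans (heq ▸ h2))
  have h4 : (0 : ℝ) < (n + 1 - d : ℕ) := by exact_mod_cast (by omega : 0 < n + 1 - d)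
  have h5 := Real.log_le_log (by positivity) h3
  rwa [Real.log_pow, Real.log_pow] at h5

theorem exists_two_pow_dvd_sub {n l d e V : ℕ} (hd : 1 ≤ d) (hdn : d ≤ n) (hel : e ≤ l) (hl : 1 ≤ l)
    (heq : n.descFactorial d = l.descFactorial e) {P : ℝ} (hP : 1 ≤ P) (hlP : Real.log l ≤ P)
    (hnP : 6 * P ^ 2 ≤ Real.log ((n + 1 - d : ℕ) : ℝ)) (hV : (V : ℝ) ≤ 2 * P + 1) :
    ∃ i < d, 2 ^ V ∣ n - i := by
  refine exists_two_pow_dvd_of_descFactorial_eq hd hdn hel heq ?_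
  have h1 := mul_log_le_mul_log_of_descFactorial_eq hdn heq
  have h2 := sum_digits_two_le le_rfl hl
  have hd' : (1 : ℝ) ≤ d := by exact_mod_cast hd
  have h3 : (d : ℝ) * (6 * P ^ 2) ≤ e * P :=
    (mul_le_mul_of_nonneg_left hnP (by positivity)).trans
      (h1.trans (mul_le_mul_of_nonneg_left hlP (by positivity)))
  have h4 : (d : ℝ) * (6 * P) ≤ e := by
    refine le_of_mul_le_mul_right ?_ (show 0 < P by linarith)
    linarith
  have h5 : (d : ℝ) * V ≤ d * (2 * P + 1) := mul_le_mul_of_nonneg_left hV (by positivity)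
  have h6 : (d : ℝ) * V + ((Nat.digits 2 l).sum : ℕ) ≤ e := by nlinarith
  exact_mod_cast h6

theorem eventually_log_sq_le : ∀ᶠ L : ℝ in Filter.atTop, 6 * (8 + 6 * Real.log L) ^ 2 ≤ L - 1 := by
  have h1 := (Real.isLittleO_pow_log_id_atTop (n := 2)).bound (show (0 : ℝ) < 1 / 1000 by norm_num)
  filter_upwards [h1, Filter.eventually_ge_atTop 2000] with L hL hL2
  simp only [Real.norm_eq_abs, id] at hL
  rw [abs_of_nonneg (by positivity), abs_of_nonneg (by linarith)] at hL
  nlinarith [sq_nonneg (8 - 6 * Real.log L)]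

set_option maxHeartbeats 1000000 in
theorem false_of_adjacent_blocks {n m d₁ d₂ h₁ h₂ l : ℕ} (p1 : 1 ≤ d₁) (p2 : 1 ≤ d₂) (q1 : 1 ≤ h₁)
    (q2 : 1 ≤ h₂) (hl : 1 ≤ l) (hnn : n = m + h₁ + h₂ + l + d₂ + d₁) {x L : ℝ} (hx : x = n)
    (hL : L = Real.log x) (c1 : 6144 * L ^ 6 < x ^ (0.2 : ℝ))
    (c2 : 6 * (8 + 6 * Real.log L) ^ 2 ≤ L - 1) (c3 : 3 ≤ L) (hx20 : 20 ≤ x)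
    (hlo : x ^ (0.6 : ℝ) ≤ m) (hh1 : (h₁ : ℝ) ≤ 4 * L) (hh2 : (h₂ : ℝ) ≤ 4 * L)
    (hd1 : (m : ℝ) * d₁ ≤ 4 * x * L ^ 2) (hd2 : (m : ℝ) * d₂ ≤ 4 * x * L ^ 2)
    (heq1 : n.descFactorial m = (n - d₁).descFactorial (m + h₁))
    (heq2 : (n - d₁).descFactorial (m + h₁) = (n - d₁ - d₂).descFactorial (m + h₁ + h₂)) : False := by
  have hx0 : 0 < x := by linarith
  have hxe : x = m + h₁ + h₂ + l + d₂ + d₁ := by rw [hx, hnn]; push_cast; ring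
  have hx2 : x ^ (0.2 : ℝ) * x ^ (0.4 : ℝ) = x ^ (0.6 : ℝ) := by
    rw [← Real.rpow_add hx0]; norm_num
  have hx3 : x ^ (0.4 : ℝ) * x ^ (0.6 : ℝ) = x := by
    rw [← Real.rpow_add hx0]; norm_num
  have hx4 : 1 ≤ x ^ (0.4 : ℝ) := Real.one_le_rpow (by linarith) (by norm_num)
  have hL6 : L ^ 2 ≤ L ^ 6 := pow_le_pow_right₀ (by linarith) (by norm_num)
  have hL9 : 9 ≤ L ^ 2 := by nlinarith
  have hx5 : 6144 * L ^ 2 * x ^ (0.4 : ℝ) ≤ m := by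
    refine le_trans ?_ hlo
    rw [← hx2]
    gcongr
    linarith
  have hm20 : (6144 * 9 : ℝ) ≤ m := by nlinarith
  have hm20' : 6144 * 9 ≤ m := by exact_mod_cast hm20
  have hm0 : (0 : ℝ) < m := by linarith
  have hL0 : 0 < L := by linarith
  obtain ⟨D, hD⟩ : ∃ D, D = 4 * x * L ^ 2 / m := ⟨_, rfl⟩
  have hmD : m * D = 4 * x * L ^ 2 := by rw [hD]; field_simp
  have hDd1 : (d₁ : ℝ) ≤ D := by rw [hD, le_div_iff₀ hm0]; linarith
  have hDd2 : (d₂ : ℝ) ≤ D := by rw [hD, le_div_iff₀ hm0]; linarith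
  have hmx : (m : ℝ) ≤ x := by
    rw [hxe]
    linarith [show (0 : ℝ) ≤ d₁ by positivity, show (0 : ℝ) ≤ d₂ by positivity,
      show (0 : ℝ) ≤ h₁ by positivity, show (0 : ℝ) ≤ h₂ by positivity,
      show (0 : ℝ) ≤ l by positivity]
  have hHD : 4 * L ≤ D := by
    rw [hD, le_div_iff₀ hm0]
    have : L * m ≤ L ^ 2 * x := by
      have : L ≤ L ^ 2 := by nlinarith
      gcongr
    linarith
  have hDm : 8 * D ≤ m := by
    have h1 : D ≤ 4 * L ^ 2 * x ^ (0.4 : ℝ) := by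
      rw [hD, div_le_iff₀ hm0]
      calc 4 * x * L ^ 2 = 4 * L ^ 2 * x ^ (0.4 : ℝ) * x ^ (0.6 : ℝ) := by
            rw [mul_assoc (4 * L ^ 2), hx3]; ring
        _ ≤ 4 * L ^ 2 * x ^ (0.4 : ℝ) * m := by gcongr
    nlinarith [mul_nonneg (sq_nonneg L) (show 0 ≤ x ^ (0.4 : ℝ) by linarith)]
  have hdm : d₁ + d₂ ≤ m := by
    have : (d₁ : ℝ) + d₂ ≤ m := by linarith
    exact_mod_cast this
  have hl1 : (x : ℝ) ≤ m + m / 2 + l := by rw [hxe]; linarith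
  have eq1 : n.descFactorial d₁ = (n - m).descFactorial (d₁ + h₁) :=
    descFactorial_eq_of_descFactorial_eq (by omega) (by omega) heq1
  have eq2 : (n - d₁).descFactorial d₂ = (n - m - (d₁ + h₁)).descFactorial (d₂ + h₂) := by
    have := descFactorial_eq_of_descFactorial_eq (n := n - d₁) (m := m + h₁) (d := d₂) (h := h₂)
      (by omega) (by omega) heq2
    rw [this]
    congr 1
    omega
  have hxx : x ^ (0.2 : ℝ) ≤ x := by
    nth_rw 2 [← Real.rpow_one x]
    exact Real.rpow_le_rpow_of_exponent_le (by linarith) (by norm_num)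
  by_cases hcase : (l : ℝ) ≤ 1536 * L ^ 6
  · have hmx2 : x < 2 * m := by
      by_contra! hc
      linarith only [hc, hl1, hcase, c1, hxx, hL6, hL9]
    have hD8 : D ≤ 8 * L ^ 2 := by
      rw [hD, div_le_iff₀ hm0]
      have := mul_le_mul_of_nonneg_right hmx2.le (sq_nonneg L)
      linarith only [this]
    have hL2 : L ≤ L ^ 2 := by nlinarith only [c3]
    have hR : ((n - m : ℕ) : ℝ) ≤ 2000 * L ^ 6 := by
      rw [Nat.cast_sub (by omega), ← hx]
      linarith only [hxe, hD8, hDd1, hDd2, hh1, hh2, hcase, hL2, hL6]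
    obtain ⟨P, hP⟩ : ∃ P, P = 8 + 6 * Real.log L := ⟨_, rfl⟩
    rw [← hP] at c2
    have hlL : 0 ≤ Real.log L := Real.log_nonneg (by linarith)
    have hlR : Real.log (2000 * L ^ 6) ≤ P := by
      rw [Real.log_mul (by norm_num) (by positivity), Real.log_pow, hP]
      have h1 : Real.log 2000 ≤ Real.log 2048 := Real.log_le_log (by norm_num) (by norm_num)
      rw [show (2048 : ℝ) = 2 ^ 11 by norm_num, Real.log_pow] at h1
      have := Real.log_two_lt_d9
      push_cast at h1 ⊢
      linarith only [h1, this, hlL]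
    have hlogle (k : ℕ) (hk : n - d₁ - d₂ ≤ k) : L - 1 ≤ Real.log k := by
      have hk' : x / Real.exp 1 ≤ k := by
        rw [div_le_iff₀ (Real.exp_pos 1)]
        have h1 : x - d₁ - d₂ ≤ k := by
          have : n ≤ k + d₁ + d₂ := by omega
          have : (n : ℝ) ≤ k + d₁ + d₂ := by exact_mod_cast this
          rw [hx]; linarith only [this]
        have h2 := Real.exp_one_gt_d9
        have h3 : x / 2 ≤ k := by linarith only [h1, hDd1, hDd2, hDm, hmx]
        have h4 : x / 2 * 2 ≤ k * Real.exp 1 := by gcongr; linarith only [h2]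
        linarith only [h4]
      have := Real.log_le_log (by positivity) hk'
      rwa [Real.log_div hx0.ne' (Real.exp_pos 1).ne', Real.log_exp, ← hL] at this
    have hV : ((Nat.log 2 (d₁ + d₂) + 1 : ℕ) : ℝ) ≤ 2 * P + 1 := by
      have h1 := Nat.pow_log_le_self 2 (show d₁ + d₂ ≠ 0 by omega)
      have h2 : (2 : ℝ) ^ Nat.log 2 (d₁ + d₂) ≤ d₁ + d₂ := by exact_mod_cast h1
      have h3 := Real.log_le_log (by positivity)
        (h2.trans (show (d₁ + d₂ : ℝ) ≤ 2000 * L ^ 6 by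
          linarith only [hDd1, hDd2, hD8, hL6, hL9]))
      rw [Real.log_pow] at h3
      have := Real.log_two_gt_d9
      have h4 : (0 : ℝ) ≤ Nat.log 2 (d₁ + d₂) := by positivity
      have h5 := mul_le_mul_of_nonneg_left this.le h4
      push_cast
      linarith only [h3, h5, hlR, h4]
    have hlP (k : ℕ) (hk1 : 1 ≤ k) (hk : k ≤ n - m) : Real.log k ≤ P := by
      refine le_trans (Real.log_le_log (by exact_mod_cast hk1) ?_) hlR
      exact le_trans (by exact_mod_cast hk) hR
    obtain ⟨i, hi, hi'⟩ := exists_two_pow_dvd_sub p1 (by omega) (by omega) (by omega) eq1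
      (by rw [hP]; linarith) (hlP _ (by omega) le_rfl)
      (c2.trans (hlogle _ (by omega))) hV
    obtain ⟨j, hj, hj'⟩ := exists_two_pow_dvd_sub p2 (by omega) (by omega) (by omega) eq2
      (by rw [hP]; linarith) (hlP _ (by omega) (by omega))
      (c2.trans (hlogle _ (by omega))) hV
    have h1 := Nat.le_of_dvd (by omega) (Nat.dvd_sub hi' hj')
    have h2 := Nat.lt_pow_succ_log_self (show 1 < 2 by norm_num) (d₁ + d₂)
    rw [Nat.succ_eq_add_one] at h2
    omega
  · push Not at hcase
    have hl2 : 2 ≤ l := by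
      have : (2 : ℝ) ≤ l := by linarith only [hcase, hL6, hL9]
      exact_mod_cast this
    have key := le_of_three_solutions p1 p2 q1 q2 (by omega) (by omega) eq1 eq2 hDd1 hDd2 hh1 hh2 hHD
      (by linarith)
    rw [← hx] at key
    have e1 : x - m - d₁ - d₂ - h₁ - h₂ = l := by rw [hxe]; ring
    have e2 : D * (m / x) = 4 * L ^ 2 := by
      rw [← mul_div_assoc, div_eq_iff hx0.ne']; linarith
    have e3 : 3 * D ^ 3 * (m / x) = 12 * D ^ 2 * L ^ 2 := by
      calc 3 * D ^ 3 * (m / x) = 3 * D ^ 2 * (D * (m / x)) := by ring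
        _ = _ := by rw [e2]; ring
    rw [e1, e3] at key
    have e4 : (l : ℝ) ≤ 24 * D ^ 2 * L ^ 2 := by
      have : D ^ 2 * L ≤ D ^ 2 * L ^ 2 := by
        gcongr
        nlinarith only [c3]
      linarith only [this, key]
    have e5 : l * (m : ℝ) ^ 2 ≤ 384 * L ^ 6 * x ^ 2 := by
      calc l * (m : ℝ) ^ 2 ≤ 24 * D ^ 2 * L ^ 2 * m ^ 2 := by gcongr
        _ = 24 * L ^ 2 * (m * D) ^ 2 := by ring
        _ = _ := by rw [hmD]; ring
    by_cases h2m : 2 * m ≤ x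
    · have e6 : x / 4 * (m : ℝ) ^ 2 ≤ 384 * L ^ 6 * x ^ 2 := by
        refine le_trans ?_ e5
        gcongr
        linarith only [h2m, hl1]
      have e7 : x * (x ^ (0.6 : ℝ)) ^ 2 ≤ x * (1536 * L ^ 6 * x) := by
        have : (x ^ (0.6 : ℝ)) ^ 2 ≤ (m : ℝ) ^ 2 := by gcongr
        have := mul_le_mul_of_nonneg_left this hx0.le
        linarith only [this, e6]
      have e8 := le_of_mul_le_mul_left e7 hx0
      have e9 : (x ^ (0.6 : ℝ)) ^ 2 = x ^ (0.2 : ℝ) * x := by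
        rw [← Real.rpow_natCast, ← Real.rpow_mul hx0.le]
        nth_rw 3 [← Real.rpow_one x]
        rw [← Real.rpow_add hx0]
        norm_num
      rw [e9] at e8
      have e10 := le_of_mul_le_mul_right e8 hx0
      have : 0 < L ^ 6 := by positivity
      linarith only [this, e10, c1]
    · push Not at h2m
      have e6 : l * (x / 2) ^ 2 ≤ 384 * L ^ 6 * x ^ 2 := by
        refine le_trans ?_ e5
        gcongr
        linarith only [h2m]
      have e7 : l * x ^ 2 ≤ 1536 * L ^ 6 * x ^ 2 := by linarith only [e6]
      have := le_of_mul_le_mul_right e7 (show 0 < x ^ 2 by positivity)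
      linarith only [this, hcase]


set_option maxHeartbeats 1000000 in
theorem exists_not_three_of_large : ∃ n₀ : ℕ, ∀ n₁ m₁ n₂ m₂ n₃ m₃ : ℕ, n₀ ≤ n₁ → m₁ < m₂ → m₂ < m₃ →
    m₃ < n₃ → n₃ < n₂ → n₂ < n₁ → (n₁ : ℝ) ^ (0.6 : ℝ) ≤ m₁ →
    n₁.descFactorial m₁ = n₂.descFactorial m₂ →
    n₂.descFactorial m₂ ≠ n₃.descFactorial m₃ := by
  have ev := (((eventually_mul_log_pow_lt 6144 6 (show (0 : ℝ) < 0.2 by norm_num)).and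
    ((Real.tendsto_log_atTop.comp tendsto_natCast_atTop_atTop).eventually
      eventually_log_sq_le)).and
    ((Real.tendsto_log_atTop.comp tendsto_natCast_atTop_atTop).eventually
      (Filter.eventually_ge_atTop (3 : ℝ)))).and
    (Filter.eventually_ge_atTop 20)
  obtain ⟨n₀, hn₀⟩ := Filter.eventually_atTop.1 ev
  refine ⟨n₀, fun n₁ m₁ n₂ m₂ n₃ m₃ hn hm12 hm23 hmn hn32 hn21 hlo heq1 heq2 => ?_⟩
  obtain ⟨⟨⟨c1, c2⟩, c3⟩, c4⟩ := hn₀ n₁ hn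
  simp only [Function.comp_apply] at c2 c3
  obtain ⟨d₂, rfl⟩ := Nat.exists_eq_add_of_le hn32.le
  obtain ⟨d₁, rfl⟩ := Nat.exists_eq_add_of_le hn21.le
  obtain ⟨h₁, rfl⟩ := Nat.exists_eq_add_of_le hm12.le
  obtain ⟨h₂, rfl⟩ := Nat.exists_eq_add_of_le hm23.le
  obtain ⟨l, rfl⟩ := Nat.exists_eq_add_of_le hmn.le
  obtain ⟨m, rfl⟩ : ∃ m, m = m₁ := ⟨_, rfl⟩
  obtain ⟨n, hnn⟩ : ∃ n, n = m + h₁ + h₂ + l + d₂ + d₁ := ⟨_, rfl⟩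
  have hn2 : m + h₁ + h₂ + l + d₂ = n - d₁ := by omega
  have hn3 : m + h₁ + h₂ + l = n - d₁ - d₂ := by omega
  rw [← hnn] at hn c1 c2 c3 c4 hlo heq1
  obtain ⟨x, hx⟩ : ∃ x : ℝ, x = n := ⟨_, rfl⟩
  obtain ⟨L, hL⟩ : ∃ L, L = Real.log x := ⟨_, rfl⟩
  rw [← hx] at c1 c2 c3 hlo
  rw [← hL] at c1 c2 c3
  have hx20 : 20 ≤ x := by rw [hx]; exact_mod_cast c4
  have hx0 : 0 < x := by linarith
  have hxe : x = m + h₁ + h₂ + l + d₂ + d₁ := by rw [hx, hnn]; push_cast; ring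
  have p1 : 1 ≤ d₁ := by omega
  have p2 : 1 ≤ d₂ := by omega
  have q1 : 1 ≤ h₁ := by omega
  have q2 : 1 ≤ h₂ := by omega
  have hm20 : (20 : ℝ) ≤ m := by
    have h1 : (20 : ℝ) ≤ x ^ (0.2 : ℝ) := by
      have : (1 : ℝ) ≤ L ^ 6 := one_le_pow₀ (by linarith)
      linarith
    have h2 : x ^ (0.2 : ℝ) ≤ x ^ (0.6 : ℝ) :=
      Real.rpow_le_rpow_of_exponent_le (by linarith) (by norm_num)
    linarith
  have hm20' : 20 ≤ m := by exact_mod_cast hm20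
  have b1 := sub_le_log_of_descFactorial_eq (by omega) (by omega) (by omega) c4 heq1
  have b2 := mul_sub_le_of_descFactorial_eq (by omega) (by omega) (by omega) c4 heq1
  have b3 := sub_le_log_of_descFactorial_eq (by omega) (by omega) (by omega) (by omega) heq2
  have b4 := mul_sub_le_of_descFactorial_eq (by omega) (by omega) (by omega) (by omega) heq2
  rw [← hx] at b1 b2
  rw [← hL] at b1 b2
  obtain ⟨y, hy⟩ : ∃ y : ℝ, y = ((m + h₁ + h₂ + l + d₂ : ℕ) : ℝ) := ⟨_, rfl⟩
  rw [← hy] at b2 b3 b4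
  have hye : y = m + h₁ + h₂ + l + d₂ := by rw [hy]; push_cast; ring
  have hy1 : 1 ≤ y := by rw [hy]; exact_mod_cast (by omega : 1 ≤ m + h₁ + h₂ + l + d₂)
  have hyx : y ≤ x := by rw [hye, hxe]; linarith [show (0 : ℝ) ≤ d₁ by positivity]
  have hly : Real.log y ≤ L := by rw [hL]; gcongr
  have hly0 : 0 ≤ Real.log y := Real.log_nonneg hy1
  push_cast at b1 b2 b3 b4
  have hh1 : (h₁ : ℝ) ≤ 4 * L := by linarith
  have hh2 : (h₂ : ℝ) ≤ 4 * L := by linarith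
  have hd1 : (m : ℝ) * d₁ ≤ 4 * x * L ^ 2 := by
    have : x - y = d₁ := by rw [hxe, hye]; ring
    rwa [this] at b2
  have hd2 : (m : ℝ) * d₂ ≤ 4 * x * L ^ 2 := by
    have h1 : y - (m + h₁ + h₂ + l) = d₂ := by rw [hye]; ring
    rw [h1] at b4
    have h2 : 4 * y * Real.log y ^ 2 ≤ 4 * x * L ^ 2 := by gcongr
    have h3 : (m : ℝ) * d₂ ≤ (m + h₁) * d₂ := by gcongr; linarith [show (0 : ℝ) ≤ h₁ by positivity]
    linarith
  rw [hn2] at heq1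
  rw [hn2, hn3] at heq2
  exact false_of_adjacent_blocks p1 p2 q1 q2 (by omega) hnn hx hL c1 c2 c3 hx20 hlo hh1 hh2 hd1 hd2
    heq1 heq2

theorem exists_trig_test {c : ℝ} (hc : c ^ 2 ≤ 1 / 2) : ∃ (g : ℝ → ℝ) (U V : ℕ → ℝ),
    (∀ t, (Real.cos t - c) * g t = ∑ j ∈ range 5, U j * Real.cos (j * t)) ∧
    (∀ t, Real.cos t * ((Real.cos t - c) * g t) = ∑ j ∈ range 5, V j * Real.cos (j * t)) ∧
    U 0 = 0 ∧ 1 / 50 ≤ V 0 ^ 2 ∧ (∀ j, |U j| ≤ 5 ∧ |V j| ≤ 5) ∧ ∀ t, 0 ≤ g t ∧ g t ≤ 6 := by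
  obtain ⟨l, hl2, hlc⟩ : ∃ l : ℝ, l ^ 2 ≤ 2 ∧ c * (l ^ 2 + 2) = 2 * l := by
    have h1 : 0 ≤ 1 - 2 * c ^ 2 := by linarith
    have h2 := Real.sqrt_nonneg (1 - 2 * c ^ 2)
    have h3 := Real.sq_sqrt h1
    set s := √(1 - 2 * c ^ 2)
    have h4 : 0 < 1 + s := by linarith
    refine ⟨2 * c / (1 + s), ?_, ?_⟩
    · rw [div_pow, div_le_iff₀ (by positivity)]
      nlinarith
    · field_simp
      linear_combination c * h3
  obtain ⟨u1, hu1⟩ : ∃ u, u = 1 - 2 * c * l + 3 * l ^ 2 / 4 := ⟨_, rfl⟩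
  obtain ⟨u2, hu2⟩ : ∃ u, u = l - c * l ^ 2 / 2 := ⟨_, rfl⟩
  obtain ⟨u3, hu3⟩ : ∃ u, u = l ^ 2 / 4 := ⟨_, rfl⟩
  have hcos (t : ℝ) : Real.cos (2 * t) = 2 * Real.cos t ^ 2 - 1 ∧
      Real.cos (3 * t) = 4 * Real.cos t ^ 3 - 3 * Real.cos t ∧
      Real.cos (4 * t) = 8 * Real.cos t ^ 4 - 8 * Real.cos t ^ 2 + 1 := by
    refine ⟨Real.cos_two_mul t, Real.cos_three_mul t, ?_⟩
    rw [show 4 * t = 2 * (2 * t) by ring, Real.cos_two_mul, Real.cos_two_mul]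
    ring
  have habs : |c * l| ≤ 1 := by
    rw [← sq_le_one_iff_abs_le_one, mul_pow]
    nlinarith [sq_nonneg c, sq_nonneg l]
  obtain ⟨hc1, hc2⟩ := abs_le.1 habs
  have habl : |l| ≤ 3 / 2 := abs_le_of_sq_le_sq (by linarith) (by norm_num)
  obtain ⟨hl1, hl3⟩ := abs_le.1 habl
  have habc : |c| ≤ 1 := abs_le_of_sq_le_sq (by linarith) (by norm_num)
  obtain ⟨hc3, hc4⟩ := abs_le.1 habc
  have b1 : |u1| ≤ 5 := by rw [abs_le]; constructor <;> nlinarith [sq_nonneg l]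
  have b2 : |u2| ≤ 5 := by rw [abs_le]; constructor <;> nlinarith [sq_nonneg l]
  have b3 : |u3| ≤ 1 := by rw [abs_le]; constructor <;> nlinarith [sq_nonneg l]
  have b1' : 0.3 ≤ u1 := by
    have h1 : u1 * (l ^ 2 + 2) = 2 - 3 / 2 * l ^ 2 + 3 / 4 * (l ^ 2) ^ 2 := by
      rw [hu1]
      linear_combination -2 * l * hlc
    nlinarith [sq_nonneg (l ^ 2 - 1), sq_nonneg l]
  refine ⟨fun t => (1 + l * Real.cos t) ^ 2,
    fun j => if j = 1 then u1 else if j = 2 then u2 else if j = 3 then u3 else 0,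
    fun j => if j = 0 then u1 / 2 else if j = 1 then u2 / 2 else if j = 2 then (u1 + u3) / 2 else
      if j = 3 then u2 / 2 else if j = 4 then u3 / 2 else 0, fun t => ?_, fun t => ?_, by simp, ?_,
      fun j => ⟨?_, ?_⟩, fun t => ⟨sq_nonneg _, ?_⟩⟩
  · obtain ⟨h2, h3, h4⟩ := hcos t
    simp only [sum_range_succ, range_zero, sum_empty]
    norm_num
    rw [h2, h3, hu1, hu2, hu3]
    linear_combination (-1 / 2) * hlc
  · obtain ⟨h2, h3, h4⟩ := hcos t
    simp only [sum_range_succ, range_zero, sum_empty]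
    norm_num
    rw [h2, h3, h4, hu1, hu2, hu3]
    linear_combination (-1 / 2) * Real.cos t * hlc
  · norm_num
    nlinarith
  · dsimp only
    rw [abs_le] at *
    split_ifs <;> constructor <;> linarith
  · dsimp only
    rw [abs_le] at *
    split_ifs <;> constructor <;> linarith
  · have h1 : |l * Real.cos t| ≤ 1.42 := by
      refine abs_le_of_sq_le_sq ?_ (by norm_num)
      rw [mul_pow]
      nlinarith [Real.cos_sq_le_one t, sq_nonneg (Real.cos t), sq_nonneg l]
    obtain ⟨h2, h3⟩ := abs_le.1 h1
    simp only
    nlinarith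

theorem sum_le_of_sign_condition {ι : Type*} (S : Finset ι) (w α β : ι → ℝ) (hw : ∀ i ∈ S, 0 ≤ w i)
    {c η δ : ℝ} (hc : c ^ 2 ≤ 1 / 2) (hη1 : η ≤ 1)
    (hs : ∀ i ∈ S, ∃ a b : ℝ, |a| ≤ η ∧ |b| ≤ η ∧
      0 ≤ (Real.cos (α i) - c - a) * (Real.cos (β i) - c - b))
    (hG : ∀ j ∈ range 5, ∀ k ∈ range 5, (j ≠ 0 ∨ k ≠ 0) →
      |∑ i ∈ S, w i * (Real.cos (j * α i) * Real.cos (k * β i))| ≤ δ) :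
    (1 / 50 - 360 * η) * ∑ i ∈ S, w i ≤ 1250 * δ := by
  obtain ⟨g, U, V, hU, hV, hU0, hV0, hb, hg⟩ := exists_trig_test hc
  have hδ : 0 ≤ δ := (abs_nonneg _).trans (hG 1 (by simp) 0 (by simp) (by simp))
  have hlow : ∀ i ∈ S, - (360 * η) ≤ (Real.cos (α i) - c) * g (α i) *
      ((Real.cos (β i) - c) * g (β i)) * (1 - Real.cos (α i) * Real.cos (β i)) := by
    intro i hi
    obtain ⟨a, b, ha, hb, hab⟩ := hs i hi
    have hη : 0 ≤ η := (abs_nonneg _).trans ha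
    have hX := Real.abs_cos_le_one (α i)
    have hY := Real.abs_cos_le_one (β i)
    obtain ⟨g1, g2⟩ := hg (α i)
    obtain ⟨g3, g4⟩ := hg (β i)
    generalize g (α i) = p at *
    generalize g (β i) = q at *
    generalize Real.cos (α i) = X at *
    generalize Real.cos (β i) = Y at *
    have hc1 : |c| ≤ 1 := abs_le_of_sq_le_sq (by linarith) (by norm_num)
    have hXc : |X - c| ≤ 2 := (abs_sub _ _).trans (by linarith)
    have hYc : |Y - c| ≤ 2 := (abs_sub _ _).trans (by linarith)
    have hXY : |X * Y| ≤ 1 := by rw [abs_mul]; exact mul_le_one₀ hX (abs_nonneg _) hY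
    obtain ⟨e1, e2⟩ := abs_le.1 hXY
    have f1 : |b * (X - c)| ≤ η * 2 := by rw [abs_mul]; gcongr
    have f2 : |a * (Y - c)| ≤ η * 2 := by rw [abs_mul]; gcongr
    have f3 : |a * b| ≤ η * η := by rw [abs_mul]; gcongr
    have f4 : - (5 * η) ≤ (X - c) * (Y - c) := by
      have f5 := neg_abs_le (b * (X - c))
      have f6 := neg_abs_le (a * (Y - c))
      have f7 := le_abs_self (a * b)
      nlinarith
    have f5 : (X - c) * p * ((Y - c) * q) * (1 - X * Y) =
      (X - c) * (Y - c) * (p * q * (1 - X * Y)) := by ring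
    rw [f5]
    have f6 : 0 ≤ p * q * (1 - X * Y) := by
      have : 0 ≤ 1 - X * Y := by linarith
      positivity
    have f7 : p * q * (1 - X * Y) ≤ 6 * 6 * 2 := by
      have : 0 ≤ 1 - X * Y := by linarith
      gcongr
      linarith
    calc -(360 * η) = -(5 * η) * (6 * 6 * 2) := by ring
      _ ≤ -(5 * η) * (p * q * (1 - X * Y)) :=
          mul_le_mul_of_nonpos_left f7 (by linarith)
      _ ≤ _ := by gcongr
  have hexp : ∀ i ∈ S, (Real.cos (α i) - c) * g (α i) *
      ((Real.cos (β i) - c) * g (β i)) * (1 - Real.cos (α i) * Real.cos (β i)) =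
      ∑ j ∈ range 5, ∑ k ∈ range 5,
        (U j * U k - V j * V k) * (Real.cos (j * α i) * Real.cos (k * β i)) := by
    intro i hi
    have h1 : (Real.cos (α i) - c) * g (α i) *
      ((Real.cos (β i) - c) * g (β i)) * (1 - Real.cos (α i) * Real.cos (β i)) =
      (Real.cos (α i) - c) * g (α i) * ((Real.cos (β i) - c) * g (β i)) -
      (Real.cos (α i) * ((Real.cos (α i) - c) * g (α i))) *
        (Real.cos (β i) * ((Real.cos (β i) - c) * g (β i))) := by ring
    rw [h1, hV, hV, hU, hU, sum_mul_sum, sum_mul_sum, ← sum_sub_distrib]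
    refine sum_congr rfl fun j _ => ?_
    rw [← sum_sub_distrib]
    exact sum_congr rfl fun k _ => by ring
  have h1 : -(360 * η) * ∑ i ∈ S, w i ≤ ∑ j ∈ range 5, ∑ k ∈ range 5,
      (U j * U k - V j * V k) * ∑ i ∈ S, w i * (Real.cos (j * α i) * Real.cos (k * β i)) := by
    calc -(360 * η) * ∑ i ∈ S, w i = ∑ i ∈ S, w i * -(360 * η) := by rw [mul_comm, sum_mul]
      _ ≤ ∑ i ∈ S, w i * ∑ j ∈ range 5, ∑ k ∈ range 5,
          (U j * U k - V j * V k) * (Real.cos (j * α i) * Real.cos (k * β i)) := by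
        refine sum_le_sum fun i hi => mul_le_mul_of_nonneg_left ?_ (hw i hi)
        rw [← hexp i hi]
        exact hlow i hi
      _ = _ := by
        simp only [mul_sum]
        rw [sum_comm]
        refine sum_congr rfl fun j _ => ?_
        rw [sum_comm]
        refine sum_congr rfl fun k _ => sum_congr rfl fun i _ => by ring
  have h2 : ∀ j ∈ range 5, ∀ k ∈ range 5, (U j * U k - V j * V k) *
      ∑ i ∈ S, w i * (Real.cos (j * α i) * Real.cos (k * β i)) ≤
      50 * δ - if j = 0 then if k = 0 then 1 / 50 * ∑ i ∈ S, w i else 0 else 0 := by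
    intro j hj k hk
    by_cases h0 : j ≠ 0 ∨ k ≠ 0
    · have h3 := hG j hj k hk h0
      have h4 : |U j * U k - V j * V k| ≤ 50 := by
        refine (abs_sub _ _).trans ?_
        rw [abs_mul, abs_mul]
        have e1 : |U j| * |U k| ≤ 5 * 5 :=
          mul_le_mul (hb j).1 (hb k).1 (abs_nonneg _) (by norm_num)
        have e2 : |V j| * |V k| ≤ 5 * 5 :=
          mul_le_mul (hb j).2 (hb k).2 (abs_nonneg _) (by norm_num)
        linarith
      have h5 : (if j = 0 then if k = 0 then 1 / 50 * ∑ i ∈ S, w i else 0 else 0) = 0 := by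
        split_ifs <;> simp_all
      rw [h5, sub_zero]
      refine (le_abs_self _).trans ?_
      rw [abs_mul]
      exact mul_le_mul h4 h3 (abs_nonneg _) (by norm_num)
    · push Not at h0
      obtain ⟨rfl, rfl⟩ := h0
      have hW : 0 ≤ ∑ i ∈ S, w i := sum_nonneg hw
      simp only [hU0, Nat.cast_zero, zero_mul, Real.cos_zero, mul_one, if_true]
      nlinarith
  have h3 := h1.trans (sum_le_sum fun j hj => sum_le_sum fun k hk => h2 j hj k hk)
  simp only [sum_sub_distrib, sum_const, card_range] at h3
  have h4 : ∑ j ∈ range 5, ∑ k ∈ range 5,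
      (if j = 0 then if k = 0 then 1 / 50 * ∑ i ∈ S, w i else 0 else (0 : ℝ)) =
      1 / 50 * ∑ i ∈ S, w i := by
    generalize 1 / 50 * ∑ i ∈ S, w i = z
    simp
  rw [h4] at h3
  simp only [nsmul_eq_mul] at h3
  push_cast at h3
  linarith

theorem prime_dvd_descFactorial_iff {p n m : ℕ} (hp : p.Prime) (hmp : m < p) (hmn : m ≤ n) :
    p ∣ n.descFactorial m ↔ n % p < m := by
  rw [Nat.descFactorial_eq_prod_range, hp.prime.dvd_finsetProd_iff]
  constructor
  · rintro ⟨i, hi, hd⟩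
    have him := mem_range.1 hi
    have : i ≡ n [MOD p] := (Nat.modEq_iff_dvd' (by omega)).2 hd
    have h2 : i % p = n % p := this
    rw [Nat.mod_eq_of_lt (by omega)] at h2
    omega
  · intro h
    exact ⟨n % p, mem_range.2 h, Nat.dvd_sub_mod n⟩

theorem cos_sub_div_eq {p n m : ℕ} (hp : 0 < p) :
    Real.cos (2 * Real.pi * ((n : ℝ) - (m - 1) / 2) / p) =
      Real.cos (2 * Real.pi * (((n % p : ℕ) : ℝ) - (m - 1) / 2) / p) := by
  have hp' : (p : ℝ) ≠ 0 := by positivity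
  have h : (n : ℝ) = (n % p : ℕ) + p * (n / p : ℕ) := by exact_mod_cast (Nat.mod_add_div n p).symm
  rw [← Real.cos_add_nat_mul_two_pi (2 * Real.pi * (((n % p : ℕ) : ℝ) - (m - 1) / 2) / p) (n / p)]
  congr 1
  nth_rewrite 1 [h]
  field_simp
  ring

theorem cos_le_cos_of_mod_lt {p n m : ℕ} (hmp : m < p) (h : n % p < m) :
    Real.cos (Real.pi * m / p) ≤ Real.cos (2 * Real.pi * ((n : ℝ) - (m - 1) / 2) / p) := by
  have hp : (0 : ℝ) < p := by exact_mod_cast (by omega : 0 < p)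
  have hmp' : (m : ℝ) ≤ p := by exact_mod_cast hmp.le
  have hr : ((n % p : ℕ) : ℝ) + 1 ≤ m := by exact_mod_cast h
  have hr0 : (0 : ℝ) ≤ ((n % p : ℕ) : ℝ) := by positivity
  rw [cos_sub_div_eq (by omega), ← Real.cos_abs (2 * Real.pi * _ / p)]
  apply Real.cos_le_cos_of_nonneg_of_le_pi (abs_nonneg _)
  · rw [div_le_iff₀ hp]
    exact mul_le_mul_of_nonneg_left hmp' Real.pi_pos.le
  · rw [abs_div, abs_mul, abs_of_pos hp, abs_of_pos Real.two_pi_pos]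
    gcongr ?_ / _
    have : |((n % p : ℕ) : ℝ) - (m - 1) / 2| ≤ m / 2 := by
      rw [abs_le]; constructor <;> linarith
    nlinarith [Real.pi_pos]

theorem cos_le_cos_of_le_mod {p n m : ℕ} (hmp : m < p) (h : m ≤ n % p) :
    Real.cos (2 * Real.pi * ((n : ℝ) - (m - 1) / 2) / p) ≤ Real.cos (Real.pi * m / p) := by
  have hp : (0 : ℝ) < p := by exact_mod_cast (by omega : 0 < p)
  have hr : (m : ℝ) ≤ ((n % p : ℕ) : ℝ) := by exact_mod_cast h
  have hr0 : ((n % p : ℕ) : ℝ) + 1 ≤ p := by exact_mod_cast Nat.mod_lt n (by omega : p > 0)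
  rw [cos_sub_div_eq (by omega)]
  set r : ℝ := ((n % p : ℕ) : ℝ)
  have hpi := Real.pi_pos
  have hm0 : (0 : ℝ) ≤ m := by positivity
  have h1 : Real.pi * m / p ≤ 2 * Real.pi * (r - (m - 1) / 2) / p := by
    gcongr ?_ / _
    nlinarith
  have h2 : Real.pi * m / p ≤ 2 * Real.pi - 2 * Real.pi * (r - (m - 1) / 2) / p := by
    rw [le_sub_iff_add_le, ← add_div, div_le_iff₀ hp]
    nlinarith
  rcases le_total (2 * Real.pi * (r - (m - 1) / 2) / p) Real.pi with h3 | h3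
  · exact Real.cos_le_cos_of_nonneg_of_le_pi (by positivity) h3 h1
  · rw [← Real.cos_two_pi_sub (2 * Real.pi * (r - (m - 1) / 2) / p)]
    exact Real.cos_le_cos_of_nonneg_of_le_pi (by positivity) (by linarith) h2

theorem cos_sub_mul_cos_sub_nonneg {p n m n' m' : ℕ} (hp : p.Prime) (hmp : m < p) (hmp' : m' < p)
    (hmn : m ≤ n) (hmn' : m' ≤ n') (h : n.descFactorial m = n'.descFactorial m') :
    0 ≤ (Real.cos (2 * Real.pi * ((n : ℝ) - (m - 1) / 2) / p) - Real.cos (Real.pi * m / p)) *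
      (Real.cos (2 * Real.pi * ((n' : ℝ) - (m' - 1) / 2) / p) - Real.cos (Real.pi * m' / p)) := by
  have hiff : n % p < m ↔ n' % p < m' := by
    rw [← prime_dvd_descFactorial_iff hp hmp hmn, h, prime_dvd_descFactorial_iff hp hmp' hmn']
  rcases lt_or_ge (n % p) m with h1 | h1
  · exact mul_nonneg (sub_nonneg.2 (cos_le_cos_of_mod_lt hmp h1))
      (sub_nonneg.2 (cos_le_cos_of_mod_lt hmp' (hiff.1 h1)))
  · exact mul_nonneg_of_nonpos_of_nonpos (sub_nonpos.2 (cos_le_cos_of_le_mod hmp h1))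
      (sub_nonpos.2 (cos_le_cos_of_le_mod hmp'
        (not_lt.1 fun h2 ↦ (not_lt.2 h1) (hiff.2 h2))))

/-- The real part of the exponential sum over primes. -/
theorem abs_sum_log_mul_cos_le (S : Finset ℕ) (z : ℝ) :
    |∑ p ∈ S, Real.log p * Real.cos (2 * Real.pi * z / p)| ≤
      ‖∑ p ∈ S, (Real.log p : ℂ) * eu (z / p)‖ := by
  have : ∑ p ∈ S, Real.log p * Real.cos (2 * Real.pi * z / p) =
      (∑ p ∈ S, (Real.log p : ℂ) * eu (z / p)).re := by
    rw [Complex.re_sum]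
    refine sum_congr rfl fun p _ ↦ ?_
    rw [Complex.re_ofReal_mul, eu, ← Complex.exp_ofReal_mul_I_re]
    congr 3
    push_cast
    ring
  rw [this]
  exact Complex.abs_re_le_norm _

theorem abs_sum_log_mul_cos_mul_cos_le (S : Finset ℕ) (x y D : ℝ) (j k : ℕ)
    (h1 : ‖∑ p ∈ S, (Real.log p : ℂ) * eu ((j * x + k * y) / p)‖ ≤ D)
    (h2 : ‖∑ p ∈ S, (Real.log p : ℂ) * eu ((j * x - k * y) / p)‖ ≤ D) :
    |∑ p ∈ S, Real.log p * (Real.cos (j * (2 * Real.pi * x / p)) *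
      Real.cos (k * (2 * Real.pi * y / p)))| ≤ D := by
  have h3 := (abs_sum_log_mul_cos_le S (j * x + k * y)).trans h1
  have h4 := (abs_sum_log_mul_cos_le S (j * x - k * y)).trans h2
  have : ∑ p ∈ S, Real.log p * (Real.cos (j * (2 * Real.pi * x / p)) *
      Real.cos (k * (2 * Real.pi * y / p))) =
      (∑ p ∈ S, Real.log p * Real.cos (2 * Real.pi * (j * x + k * y) / p) +
        ∑ p ∈ S, Real.log p * Real.cos (2 * Real.pi * (j * x - k * y) / p)) / 2 := by
    rw [← sum_add_distrib, sum_div]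
    refine sum_congr rfl fun p _ ↦ ?_
    have e1 : 2 * Real.pi * (j * x + k * y) / p =
      j * (2 * Real.pi * x / p) + k * (2 * Real.pi * y / p) := by ring
    have e2 : 2 * Real.pi * (j * x - k * y) / p =
      j * (2 * Real.pi * x / p) - k * (2 * Real.pi * y / p) := by ring
    rw [e1, e2, Real.cos_add, Real.cos_sub]
    ring
  rw [this, abs_le]
  rw [abs_le] at h3 h4
  constructor <;> linarith

theorem frequency_bounds {N X x y : ℝ} {j k : ℕ} (hj : j ≤ 4) (hk : k ≤ 4) (hjk : j ≠ 0 ∨ k ≠ 0)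
    (hX : X ≤ x - y) (hX0 : 0 ≤ X) (hxy : x - y ≤ N / 50) (hx1 : N / 2 ≤ x) (hx2 : x ≤ N) :
    (X ≤ |j * x + k * y| ∧ |j * x + k * y| ≤ 100 * N) ∧
      (X ≤ |j * x - k * y| ∧ |j * x - k * y| ≤ 100 * N) := by
  have hy : 0 ≤ y := by linarith
  have hx : 0 ≤ x := by linarith
  interval_cases j <;> interval_cases k <;> norm_num at hjk <;> push_cast <;>
    refine ⟨⟨le_abs.2 ?_, abs_le.2 ⟨?_, ?_⟩⟩, ⟨le_abs.2 ?_, abs_le.2 ⟨?_, ?_⟩⟩⟩ <;>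
    first
      | linarith only [hX, hX0, hxy, hx1, hx2]
      | (left; linarith only [hX, hX0, hxy, hx1, hx2])
      | (right; linarith only [hX, hX0, hxy, hx1, hx2])

theorem sum_log_prime_le_of_descFactorial_eq {n m n' m' A B : ℕ} {c η D X : ℝ}
    (hm : 0 < m) (hmn : m ≤ n) (hmn' : m' ≤ n') (hmm : m ≤ m')
    (h : n.descFactorial m = n'.descFactorial m')
    (hX0 : 0 ≤ X) (hXd : X ≤ (n : ℝ) - n') (hd : (n : ℝ) - n' + m' ≤ n / 50)
    (hc : c ^ 2 ≤ 1 / 2) (hη : η ≤ 1)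
    (hp : ∀ p ∈ Ioc A B, p.Prime → m' < p ∧ |Real.cos (Real.pi * m / p) - c| ≤ η ∧
      |Real.cos (Real.pi * m' / p) - c| ≤ η)
    (hD : ∀ z : ℝ, X ≤ |z| → |z| ≤ 100 * n →
      ‖∑ p ∈ Ioc A B with p.Prime, (Real.log p : ℂ) * eu (z / p)‖ ≤ D) :
    (1 / 50 - 360 * η) * ∑ p ∈ Ioc A B with p.Prime, Real.log p ≤ 1250 * D := by
  have hmm' : (m : ℝ) ≤ m' := by exact_mod_cast hmm
  have hm0 : (0 : ℝ) ≤ m := by positivity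
  have hm1 : (1 : ℝ) ≤ m := by exact_mod_cast hm
  refine sum_le_of_sign_condition {p ∈ Ioc A B | p.Prime} (fun p ↦ Real.log p)
    (fun p ↦ 2 * Real.pi * ((n : ℝ) - (m - 1) / 2) / p)
    (fun p ↦ 2 * Real.pi * ((n' : ℝ) - (m' - 1) / 2) / p) ?_ hc hη ?_ ?_
  · intro p hp'
    exact Real.log_natCast_nonneg p
  · intro p hp'
    obtain ⟨hp1, hp2⟩ := mem_filter.1 hp'
    obtain ⟨h1, h2, h3⟩ := hp p hp1 hp2
    refine ⟨_, _, h2, h3, ?_⟩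
    convert cos_sub_mul_cos_sub_nonneg hp2 (hmm.trans_lt h1) h1 hmn hmn' h using 2 <;> ring
  · intro j hj k hk hjk
    have hj := mem_range.1 hj
    have hk := mem_range.1 hk
    obtain ⟨⟨h1, h2⟩, h3, h4⟩ := frequency_bounds (N := n) (X := X)
      (x := (n : ℝ) - (m - 1) / 2) (y := (n' : ℝ) - (m' - 1) / 2)
      (by omega : j ≤ 4) (by omega : k ≤ 4) hjk (by linarith) hX0 (by linarith) (by linarith)
      (by linarith)
    exact abs_sum_log_mul_cos_mul_cos_le _ _ _ _ _ _ (hD _ h1 h2) (hD _ h3 h4)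

theorem cos_sq_le_half {x : ℝ} (h1 : Real.pi / 4 ≤ x) (h2 : x ≤ 3 * Real.pi / 4) :
    Real.cos x ^ 2 ≤ 1 / 2 := by
  have h : Real.cos (2 * x) ≤ 0 :=
    Real.cos_nonpos_of_pi_div_two_le_of_le (by linarith) (by linarith)
  rw [Real.cos_two_mul] at h
  linarith

theorem cos_near_of_mem_slice {m m' K i p : ℕ} (hm : 0 < m) (hmm : m ≤ m')
    (hK : 360000 ≤ K) (hsmall : 288000 * (m' - m) ≤ m)
    (h1 : m * (4 * K + 8 * i) < 3 * K * p) (h2 : 3 * K * p ≤ m * (4 * K + 8 * (i + 1))) :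
    m' < p ∧
      |Real.cos (Real.pi * m / p) - Real.cos (Real.pi * (3 * K / (4 * K + 8 * i)))| ≤ 1 / 36000 ∧
      |Real.cos (Real.pi * m' / p) - Real.cos (Real.pi * (3 * K / (4 * K + 8 * i)))| ≤
        1 / 36000 := by
  have hp43 : 4 * m < 3 * p := by
    by_contra! h
    have : 3 * p * K ≤ 4 * m * K := Nat.mul_le_mul_right K h
    nlinarith [Nat.zero_le (m * i)]
  have hmp : m' < p := by omega
  refine ⟨hmp, ?_⟩
  have hK' : (360000 : ℝ) ≤ K := by exact_mod_cast hK
  have hi' : (0 : ℝ) ≤ i := by positivity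
  have hm' : (0 : ℝ) < m := by exact_mod_cast hm
  have h1' : (m : ℝ) * (4 * K + 8 * i) < 3 * K * p := by exact_mod_cast h1
  have h2' : 3 * K * (p : ℝ) ≤ m * (4 * K + 8 * (i + 1)) := by exact_mod_cast h2
  have hp43' : 4 * (m : ℝ) < 3 * p := by exact_mod_cast hp43
  have hp : (0 : ℝ) < p := by linarith
  have hr : (0 : ℝ) < 4 * K + 8 * i := by linarith
  have e1 : |(m : ℝ) / p - 3 * K / (4 * K + 8 * i)| ≤ 3 / 2 / K := by
    rw [abs_sub_comm, div_sub_div _ _ hr.ne' hp.ne', abs_of_nonneg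
      (div_nonneg (by linarith) (by positivity)), div_le_div_iff₀ (by positivity) (by linarith)]
    have h3 : 3 * K * (p : ℝ) - (4 * K + 8 * i) * m ≤ 8 * m := by linarith
    have h4 : 8 * (m : ℝ) * K ≤ 3 / 2 * ((4 * K + 8 * i) * p) := by nlinarith
    nlinarith
  have hpi := Real.pi_pos
  have hpi4 := Real.pi_le_four
  have e2 : 3 / 2 / (K : ℝ) ≤ 1 / 240000 := by
    rw [div_le_div_iff₀ (by linarith) (by norm_num)]
    linarith
  have e3 : |(m' : ℝ) / p - m / p| ≤ 1 / 384000 := by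
    have hs : 288000 * ((m' : ℝ) - m) ≤ m := by
      rw [← Nat.cast_sub hmm]; exact_mod_cast hsmall
    have hmm' : (m : ℝ) ≤ m' := by exact_mod_cast hmm
    rw [← sub_div, abs_of_nonneg (div_nonneg (by linarith) hp.le),
      div_le_div_iff₀ hp (by norm_num)]
    linarith
  have key : ∀ a b : ℝ, |Real.cos (Real.pi * a) - Real.cos (Real.pi * b)| ≤ 4 * |a - b| := by
    intro a b
    refine (Real.abs_cos_sub_cos_le _ _).trans ?_
    rw [← mul_sub, abs_mul, abs_of_pos hpi]
    exact mul_le_mul_of_nonneg_right hpi4 (abs_nonneg _)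
  rw [mul_div_assoc Real.pi (m : ℝ) p, mul_div_assoc Real.pi (m' : ℝ) p]
  constructor
  · refine (key _ _).trans ?_
    linarith only [e1, e2]
  · refine (key _ _).trans ?_
    have := abs_sub_le ((m' : ℝ) / p) (m / p) (3 * K / (4 * K + 8 * i))
    linarith only [this, e1, e2, e3]

theorem cos_slice_sq_le {K i : ℕ} (hi : i < K) :
    Real.cos (Real.pi * (3 * K / (4 * K + 8 * i))) ^ 2 ≤ 1 / 2 := by
  have hi' : (i : ℝ) < K := by exact_mod_cast hi
  have hi0 : (0 : ℝ) ≤ i := by positivity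
  have hpi := Real.pi_pos
  apply cos_sq_le_half
  · rw [div_eq_mul_inv]
    refine mul_le_mul_of_nonneg_left ?_ hpi.le
    rw [le_div_iff₀ (by linarith)]
    linarith
  · rw [mul_comm 3 Real.pi, mul_div_assoc Real.pi 3 4]
    refine mul_le_mul_of_nonneg_left ?_ hpi.le
    rw [div_le_iff₀ (by linarith)]
    linarith

theorem sum_log_prime_Ioc_le {n m n' m' K : ℕ} {D X : ℝ} (hK : 360000 ≤ K)
    (hm : 0 < m) (hmn : m ≤ n) (hmn' : m' ≤ n') (hmm : m ≤ m')
    (h : n.descFactorial m = n'.descFactorial m') (hsmall : 288000 * (m' - m) ≤ m)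
    (hX0 : 0 ≤ X) (hXd : X ≤ (n : ℝ) - n') (hd : (n : ℝ) - n' + m' ≤ n / 50)
    (hD : ∀ z : ℝ, X ≤ |z| → |z| ≤ 100 * n → ∀ A B : ℕ, m ≤ A → A ≤ B → B ≤ 4 * m →
      ‖∑ p ∈ Ioc A B with p.Prime, (Real.log p : ℂ) * eu (z / p)‖ ≤ D) :
    ∑ p ∈ Ioc (4 * m / 3) (4 * m) with p.Prime, Real.log p ≤ 125000 * K * D := by
  have hK0 : 0 < K := by omega
  set r : ℕ → ℕ := fun i ↦ m * (4 * K + 8 * i) / (3 * K) with hr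
  have hmono : Monotone r := fun i j hij ↦ Nat.div_le_div_right (by gcongr)
  have hr0 : r 0 = 4 * m / 3 := by
    have : m * (4 * K + 8 * 0) = (4 * m) * K := by ring
    simp only [hr]
    rw [this, Nat.mul_div_mul_right _ _ hK0]
  have hrK : r K = 4 * m := by
    have : m * (4 * K + 8 * K) = (4 * m) * (3 * K) := by ring
    simp only [hr]
    rw [this, Nat.mul_div_cancel _ (by omega)]
  have hslice : ∀ i < K, ∑ p ∈ Ioc (r i) (r (i + 1)) with p.Prime, Real.log p ≤ 125000 * D := by
    intro i hi
    have := sum_log_prime_le_of_descFactorial_eq (A := r i) (B := r (i + 1)) (η := 1 / 36000)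
      (D := D) (X := X) hm hmn hmn' hmm h hX0 hXd hd (cos_slice_sq_le hi) (by norm_num) ?_ ?_
    · norm_num at this
      linarith
    · intro p hp _
      obtain ⟨hp1, hp2⟩ := mem_Ioc.1 hp
      refine cos_near_of_mem_slice hm hmm hK hsmall ?_ ?_
      · have := (Nat.div_lt_iff_lt_mul (by omega : 0 < 3 * K)).1 hp1
        rwa [mul_comm p] at this
      · have := (Nat.le_div_iff_mul_le (by omega : 0 < 3 * K)).1 hp2
        rwa [mul_comm p] at this
    · intro z hz1 hz2
      refine hD z hz1 hz2 _ _ ?_ (hmono (by omega)) ?_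
      · have := hmono (Nat.zero_le i)
        omega
      · have := hmono (show i + 1 ≤ K from hi)
        omega
  have hsum : ∀ j ≤ K, ∑ p ∈ Ioc (r 0) (r j) with p.Prime, Real.log p ≤ 125000 * j * D := by
    intro j
    induction j with
    | zero => simp
    | succ j ih =>
      intro hj
      have h1 := ih (by omega)
      have h2 := hslice j (by omega)
      rw [sum_filter] at h1 h2 ⊢
      rw [← sum_Ioc_consecutive _ (hmono (Nat.zero_le j)) (hmono (Nat.le_succ j))]
      push_cast
      linarith
  have := hsum K le_rfl
  rwa [hr0, hrK] at this

theorem exists_le_sum_log_prime_Ioc : ∃ m₀ : ℕ, ∀ m : ℕ, m₀ ≤ m →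
    (m : ℝ) / 2 ≤ ∑ p ∈ Ioc (4 * m / 3) (4 * m) with p.Prime, Real.log p := by
  obtain ⟨N₀, hN₀⟩ := Filter.eventually_atTop.1
    (eventually_mul_log_pow_lt 40 1 (by norm_num : (0 : ℝ) < 1 / 2))
  refine ⟨N₀ + 1, fun m hm ↦ ?_⟩
  have h1 := hN₀ (4 * m) (by omega)
  rw [pow_one, ← Real.sqrt_eq_rpow] at h1
  have hm1 : (1 : ℝ) ≤ m := by exact_mod_cast (by omega : 1 ≤ m)
  have hge := Chebyshev.theta_ge (4 * m)
  have hle := Chebyshev.theta_le_log4_mul_x (x := ((4 * m / 3 : ℕ) : ℝ)) (by positivity)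
  have hdiff : Chebyshev.theta ((4 * m : ℕ) : ℝ) - Chebyshev.theta ((4 * m / 3 : ℕ) : ℝ) =
      ∑ p ∈ Ioc (4 * m / 3) (4 * m) with p.Prime, Real.log p := by
    rw [Chebyshev.theta, Chebyshev.theta, Nat.floor_natCast, Nat.floor_natCast, sum_filter,
      sum_filter, sum_filter,
      ← sum_Ioc_consecutive _ (Nat.zero_le (4 * m / 3)) (by omega : 4 * m / 3 ≤ 4 * m)]
    ring
  rw [← hdiff]
  have hN : ((4 * m : ℕ) : ℝ) = 4 * m := by push_cast; ring
  have hdiv : ((4 * m / 3 : ℕ) : ℝ) ≤ 4 * m / 3 := by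
    have := Nat.cast_div_le (α := ℝ) (m := 4 * m) (n := 3)
    push_cast at this
    exact this
  have hlog4 : Real.log 4 = 2 * Real.log 2 := by
    rw [show (4 : ℝ) = 2 ^ 2 by norm_num, Real.log_pow]; norm_num
  rw [hlog4] at hle
  have hl2 := Real.log_two_gt_d9
  rw [hN] at h1 hge
  rw [hN]
  set N : ℝ := 4 * m with hNm
  have hN4 : 4 ≤ N := by linarith
  have hlogN : 0 ≤ Real.log N := Real.log_nonneg (by linarith)
  have hlog1 : Real.log (N + 1) ≤ 2 * Real.log N := by
    rw [← Real.log_rpow (by linarith)]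
    apply Real.log_le_log (by linarith)
    norm_num
    nlinarith
  have hs1 : 1 ≤ Real.sqrt N := Real.one_le_sqrt.2 (by linarith)
  have hs2 : Real.sqrt N * Real.sqrt N = N := Real.mul_self_sqrt (by linarith)
  have h3 : 40 * (Real.sqrt N * Real.log N) ≤ N := by nlinarith only [h1, hs1, hs2]
  have h4 : Real.log N ≤ Real.sqrt N * Real.log N := by nlinarith only [hs1, hlogN]
  have h5 : 2 * Real.log 2 * ((4 * m / 3 : ℕ) : ℝ) ≤ 2 * Real.log 2 * (4 * m / 3) :=
    mul_le_mul_of_nonneg_left hdiv (by linarith)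
  have h6 : 0.69 * (m : ℝ) ≤ Real.log 2 * m := by nlinarith only [hl2, hm1]
  nlinarith only [hge, hle, h3, h4, h5, h6, hlog1, hNm]

theorem eventually_mul_log_sq_le_exp (C : ℝ) {ε : ℝ} (hε : 0 < ε) :
    ∀ᶠ n : ℕ in Filter.atTop, C * Real.log n ^ 2 ≤ Real.exp (Real.log n ^ ((2 : ℝ) / 3 + ε)) := by
  have hlim : Filter.Tendsto (fun n : ℕ ↦ Real.log n) Filter.atTop Filter.atTop :=
    Real.tendsto_log_atTop.comp tendsto_natCast_atTop_atTop
  filter_upwards [hlim.eventually_ge_atTop (max 1 (720 * C))] with n hn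
  have h1 : 1 ≤ Real.log n := (le_max_left _ _).trans hn
  have h2 : 720 * C ≤ Real.log n := (le_max_right _ _).trans hn
  set L := Real.log n
  have h0 : 0 ≤ L := by linarith
  have h3 : L ^ 4 / 720 ≤ Real.exp (L ^ ((2 : ℝ) / 3)) := by
    have := Real.pow_div_factorial_le_exp (L ^ ((2 : ℝ) / 3)) (by positivity) 6
    rw [← Real.rpow_natCast (L ^ _), ← Real.rpow_mul h0] at this
    norm_num [Nat.factorial] at this
    exact_mod_cast this
  have h4 : L ^ ((2 : ℝ) / 3) ≤ L ^ ((2 : ℝ) / 3 + ε) :=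
    Real.rpow_le_rpow_of_exponent_le h1 (by linarith)
  refine le_trans ?_ (h3.trans (Real.exp_le_exp.2 h4))
  have : C ≤ L ^ 2 / 720 := by nlinarith
  calc C * L ^ 2 ≤ L ^ 2 / 720 * L ^ 2 := by gcongr
    _ = L ^ 4 / 720 := by ring

theorem exists_descFactorial_ne_of_small {ε : ℝ} (hε : 0 < ε) :
    ∃ n₀ : ℕ, ∀ n m n' m' : ℕ, n₀ ≤ n → m < m' → m' < n' → n' < n →
      Real.exp (Real.log n ^ ((2 : ℝ) / 3 + ε)) ≤ m → (m : ℝ) ≤ (n : ℝ) ^ (0.34 : ℝ) →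
      n.descFactorial m ≠ n'.descFactorial m' := by
  obtain ⟨m₀, hm₀⟩ := exists_le_sum_log_prime_Ioc
  obtain ⟨n₁, hn₁⟩ := exists_norm_sum_prime_le hε (by norm_num : (0 : ℝ) < 1 / 10 ^ 12)
  obtain ⟨n₂, hn₂⟩ := Filter.eventually_atTop.1
    ((eventually_mul_log_sq_le_exp (1152000 + m₀) hε).and
      (eventually_mul_log_pow_lt 1000 0 (by norm_num : (0 : ℝ) < 0.66)))
  refine ⟨n₁ + n₂ + 10 ^ 6, fun n m n' m' hn hmm hmn' hnn hlow hup h ↦ ?_⟩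
  obtain ⟨hexp, hpow⟩ := hn₂ n (by omega)
  rw [pow_zero, mul_one] at hpow
  have hn6 : (10 : ℝ) ^ 6 ≤ n := by exact_mod_cast (by omega : 10 ^ 6 ≤ n)
  have hn0 : (0 : ℝ) < n := by linarith
  have hL1 : 1 ≤ Real.log n := by
    rw [Real.le_log_iff_exp_le hn0]
    have := Real.exp_one_lt_d9
    linarith
  have hmL : (1152000 + m₀) * Real.log n ^ 2 ≤ m := hexp.trans hlow
  have hm1000 : 1000 * (m : ℝ) ≤ n := by
    calc 1000 * (m : ℝ) ≤ (n : ℝ) ^ (0.66 : ℝ) * (n : ℝ) ^ (0.34 : ℝ) := by gcongr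
      _ = n := by rw [← Real.rpow_add hn0]; norm_num
  have hL2 : Real.log n ≤ Real.log n ^ 2 := by nlinarith only [hL1]
  have hmm₀ : (m₀ : ℝ) + 1152000 ≤ m := by
    have : (0 : ℝ) ≤ m₀ := by positivity
    nlinarith only [this, hmL, hL1, hL2]
  have hm₀L : (0 : ℝ) ≤ m₀ * Real.log n ^ 2 := by positivity
  have hm0 : 0 < m := by
    have : (0 : ℝ) < m := by
      have : (0 : ℝ) ≤ m₀ := by positivity
      linarith
    exact_mod_cast this
  have hmpos : (0 : ℝ) < m := by exact_mod_cast hm0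
  have hm4 : 4 ≤ m := by
    have : (4 : ℝ) ≤ m := by
      have : (0 : ℝ) ≤ m₀ := by positivity
      linarith
    exact_mod_cast this
  have h1000 : 1000 * m ≤ n := by exact_mod_cast hm1000
  have hlogdiff := sub_le_log_of_descFactorial_eq (by omega : m ≤ n) hmn'.le hnn.le (by omega) h
  have hdup := mul_sub_le_of_descFactorial_eq hmm.le hmn'.le hnn.le (by omega) h
  have hdlow := le_mul_sub_of_descFactorial_eq hmm hmn' hnn.le (by omega) hm4 (by omega) h
  have hsmall : 288000 * (m' - m) ≤ m := by
    have : 288000 * (((m' - m : ℕ)) : ℝ) ≤ m := by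
      rw [Nat.cast_sub hmm.le]
      linarith only [hlogdiff, hmL, hL2, hm₀L]
    exact_mod_cast this
  have hd : (n : ℝ) - n' ≤ n / 1000 := by
    have h1 : (m : ℝ) * ((n : ℝ) - n') ≤ m * (n / 1000) := by
      refine hdup.trans ?_
      nlinarith only [hmL, hm₀L, hn0]
    exact le_of_mul_le_mul_left h1 hmpos
  have hm'2 : (m' : ℝ) ≤ 2 * m := by exact_mod_cast (by omega : m' ≤ 2 * m)
  have hXd : Real.exp (19 / 10 * Real.log m) ≤ (n : ℝ) - n' := by
    have h1 : (n : ℝ) ≤ m * ((n : ℝ) - n') := by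
      rw [← Nat.cast_sub hnn.le]; exact_mod_cast hdlow
    have h2 : Real.log m ≤ 0.34 * Real.log n := by
      rw [← Real.log_rpow hn0]
      exact Real.log_le_log hmpos hup
    have h3 : (m : ℝ) * Real.exp (19 / 10 * Real.log m) ≤ n := by
      nth_rewrite 1 [← Real.exp_log hmpos]
      rw [← Real.exp_add, ← Real.le_log_iff_exp_le hn0]
      linarith only [h2, hL1]
    exact le_of_mul_le_mul_left (h3.trans h1) hmpos
  have hup' := sum_log_prime_Ioc_le (K := 360000) (D := 1 / 10 ^ 12 * m) le_rfl hm0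
    (by omega : m ≤ n) hmn'.le hmm.le h hsmall (Real.exp_pos _).le hXd
    (by linarith only [hd, hm'2, hm1000]) (fun z hz1 hz2 A B hA hAB hB ↦
      hn₁ n (by omega) m hlow (by omega) z A B hz1 hz2 hA hAB hB)
  have hlow' := hm₀ m (by
    have : (m₀ : ℝ) ≤ m := by linarith only [hmm₀]
    exact_mod_cast this)
  norm_num at hup'
  linarith only [hup', hlow', hmpos]

theorem exists_three_of_two_lt_encard {α : Type*} {s : Set α} (h : 2 < s.encard) :
    ∃ a ∈ s, ∃ b ∈ s, ∃ c ∈ s, a ≠ b ∧ a ≠ c ∧ b ≠ c := by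
  obtain ⟨t, hts, ht⟩ := Set.exists_subset_encard_eq (k := 3) (s := s)
    (by rw [show (3 : ℕ∞) = 2 + 1 by norm_num]; exact Order.add_one_le_of_lt h)
  obtain ⟨a, b, c, hab, hac, hbc, rfl⟩ := Set.encard_eq_three.1 ht
  exact ⟨a, hts (by simp), b, hts (by simp), c, hts (by simp), hab, hac, hbc⟩

theorem exists_sorted_of_pairwise_ne {α : Type*} {P : α → Prop} (f : α → ℕ) {a b c : α}
    (ha : P a) (hb : P b) (hc : P c) (hab : f a ≠ f b) (hac : f a ≠ f c) (hbc : f b ≠ f c) :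
    ∃ x y z, P x ∧ P y ∧ P z ∧ f x < f y ∧ f y < f z := by
  rcases lt_or_gt_of_ne hab with h1 | h1 <;> rcases lt_or_gt_of_ne hac with h2 | h2 <;>
    rcases lt_or_gt_of_ne hbc with h3 | h3
  · exact ⟨a, b, c, ha, hb, hc, h1, h3⟩
  · exact ⟨a, c, b, ha, hc, hb, h2, h3⟩
  · omega
  · exact ⟨c, a, b, hc, ha, hb, h2, h1⟩
  · exact ⟨b, a, c, hb, ha, hc, h1, h2⟩
  · omega
  · exact ⟨b, c, a, hb, hc, ha, h3, h2⟩
  · exact ⟨c, b, a, hc, hb, ha, h3, h1⟩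

theorem descFactorial_lt_descFactorial {n n' m : ℕ} (hm : 0 < m) (hmn : m ≤ n) (hn : n < n') :
    n.descFactorial m < n'.descFactorial m := by
  rw [Nat.descFactorial_eq_prod_range, Nat.descFactorial_eq_prod_range]
  refine prod_lt_prod_of_nonempty (fun i hi ↦ ?_) (fun i hi ↦ ?_) (nonempty_range_iff.2 hm.ne') <;>
    have := mem_range.1 hi <;> omega

theorem eq_of_descFactorial_eq {n n' m : ℕ} (hm : 0 < m) (hmn : m ≤ n) (hmn' : m ≤ n')
    (h : n.descFactorial m = n'.descFactorial m) : n = n' := by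
  rcases lt_trichotomy n n' with h1 | h1 | h1
  · exact absurd h (descFactorial_lt_descFactorial hm hmn h1).ne
  · exact h1
  · exact absurd h (descFactorial_lt_descFactorial hm hmn' h1).ne'

theorem lt_of_descFactorial_eq {n m n' m' : ℕ} (hm : m < m') (hmn' : m' < n')
    (h : n.descFactorial m = n'.descFactorial m') : n' < n := by
  by_contra! hn
  obtain ⟨k, rfl⟩ := Nat.exists_eq_add_of_lt hm
  have h1 : n.descFactorial m ≤ n'.descFactorial m := Nat.descFactorial_le m hn
  have h2 : n'.descFactorial m < n'.descFactorial (m + k + 1) := by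
    rw [add_assoc, descFactorial_add]
    have h0 : 0 < n'.descFactorial m := descFactorial_pos (by omega)
    have h3 : 1 < (n' - m).descFactorial (k + 1) := by
      obtain ⟨l, hl⟩ : ∃ l, n' - m = l + 1 := ⟨n' - m - 1, by omega⟩
      have h4 : 0 < l.descFactorial k := descFactorial_pos (by omega)
      rw [hl, Nat.succ_descFactorial_succ]
      nlinarith only [h4, (by omega : 1 < l + 1)]
    exact lt_mul_of_one_lt_right h0 h3
  omega

end FallingFactorial

/-- Falling factorial multiplicity in the interior: for every `0 < ε < 1` there is `t₀`
such that for all integers `t ≥ t₀`, the number of pairs `(n, m)` with `1 ≤ m < n`,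
`exp((log n)^(2/3+ε)) ≤ m` and `(n)_m = t` is at most `2`. -/
theorem stmt_3 (ε : ℝ) (hε0 : 0 < ε) (hε1 : ε < 1) :
    ∃ t₀ : ℕ, ∀ t : ℕ, t₀ ≤ t →
      {p : ℕ × ℕ | 1 ≤ p.2 ∧ p.2 < p.1 ∧
        Real.exp ((Real.log p.1) ^ ((2 : ℝ) / 3 + ε)) ≤ (p.2 : ℝ) ∧
        Nat.descFactorial p.1 p.2 = t}.encard ≤ 2 := by
  obtain ⟨a, ha⟩ := FallingFactorial.exists_descFactorial_ne_of_small hε0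
  obtain ⟨b, hb⟩ := FallingFactorial.exists_descFactorial_ne_of_medium
  obtain ⟨c, hc⟩ := FallingFactorial.exists_not_three_of_large
  refine ⟨(a + b + c) ^ (a + b + c) + 1, fun t ht ↦ ?_⟩
  by_contra! hlt
  obtain ⟨x, hx, y, hy, z, hz, hxy, hxz, hyz⟩ :=
    FallingFactorial.exists_three_of_two_lt_encard hlt
  have hinj : ∀ p q : ℕ × ℕ, (1 ≤ p.2 ∧ p.2 < p.1 ∧
      Real.exp ((Real.log p.1) ^ ((2 : ℝ) / 3 + ε)) ≤ (p.2 : ℝ) ∧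
        Nat.descFactorial p.1 p.2 = t) → (1 ≤ q.2 ∧ q.2 < q.1 ∧
      Real.exp ((Real.log q.1) ^ ((2 : ℝ) / 3 + ε)) ≤ (q.2 : ℝ) ∧
        Nat.descFactorial q.1 q.2 = t) → p ≠ q → p.2 ≠ q.2 := by
    rintro ⟨n, m⟩ ⟨n', m'⟩ ⟨h1, h2, -, h3⟩ ⟨-, h4, -, h5⟩ hne (rfl : m = m')
    exact hne (Prod.ext
      (FallingFactorial.eq_of_descFactorial_eq h1 h2.le h4.le (h3.trans h5.symm)) rfl)
  obtain ⟨⟨n₁, m₁⟩, ⟨n₂, m₂⟩, ⟨n₃, m₃⟩, ⟨h11, h12, h13, h14⟩, ⟨h21, h22, h23, h24⟩,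
    ⟨h31, h32, h33, h34⟩, (hm12 : m₁ < m₂), (hm23 : m₂ < m₃)⟩ :=
    FallingFactorial.exists_sorted_of_pairwise_ne Prod.snd hx hy hz
      (hinj _ _ hx hy hxy) (hinj _ _ hx hz hxz) (hinj _ _ hy hz hyz)
  dsimp only at h11 h12 h13 h14 h21 h22 h23 h24 h31 h32 h33 h34
  have heq12 := h14.trans h24.symm
  have heq23 := h24.trans h34.symm
  have hn12 := FallingFactorial.lt_of_descFactorial_eq hm12 h22 heq12
  have hn23 := FallingFactorial.lt_of_descFactorial_eq hm23 h32 heq23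
  have hn1 : a + b + c ≤ n₁ := by
    by_contra! hlt
    have h1 : n₁.descFactorial m₁ ≤ (a + b + c) ^ (a + b + c) :=
      calc n₁.descFactorial m₁ ≤ n₁ ^ m₁ := Nat.descFactorial_le_pow _ _
        _ ≤ (a + b + c) ^ m₁ := Nat.pow_le_pow_left hlt.le _
        _ ≤ (a + b + c) ^ (a + b + c) := Nat.pow_le_pow_right (by omega) (by omega)
    omega
  rcases le_total (m₁ : ℝ) ((n₁ : ℝ) ^ (0.34 : ℝ)) with h | h
  · exact ha n₁ m₁ n₂ m₂ (by omega) hm12 h22 hn12 h13 h heq12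
  rcases le_total (m₁ : ℝ) ((n₁ : ℝ) ^ (0.6 : ℝ)) with h' | h'
  · exact hb n₁ m₁ n₂ m₂ (by omega) hm12 h22 hn12 h h' heq12
  · exact hc n₁ m₁ n₂ m₂ n₃ m₃ (by omega) hm12 hm23 h32 hn23 hn12 h' heq12 heq23
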